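/- arXiv:1810.03142 — 9 statements merged into one kernel-verified Lean document; each statement's English description precedes it below -/
import Mathlib

section
/- Let n ≥ 1 and let s be an integer with 0 < s < 2n. Let f(x) = x^(2n) + x^(2n−s) + 1 be a trinomial in F_2[x]. Then the third iterate f^(3) = f ∘ f ∘ f is not irreducible over F_2. -/
open Polynomial
open Finset

theorem prod_range_prod_range_eq_diag_mul {A : Type*} [CommMonoid A] (F : ℕ → ℕ → A) (d : ℕ) :
    ∏ i ∈ range d, ∏ j ∈ range d, F i j =
      (∏ i ∈ range d, F i i) * ∏ j ∈ range d, ∏ i ∈ range j, (F i j * F j i) := by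
  induction d with
  | zero => simp
  | succ d ih =>
    simp only [prod_range_succ, prod_mul_distrib] at ih ⊢
    rw [ih]
    ac_rfl

theorem prod_one_add_two_mul_mod_eight {A ι : Type*} [CommRing A] (t : ι → A) (s : Finset ι) :
    ∃ w, ∏ i ∈ s, (1 + 2 * t i) =
      1 + 2 * ∑ i ∈ s, t i + 2 * ((∑ i ∈ s, t i) ^ 2 - ∑ i ∈ s, t i ^ 2) + 8 * w := by
  classical
  suffices H : ∃ w e, (∑ i ∈ s, t i) ^ 2 - ∑ i ∈ s, t i ^ 2 = 2 * e ∧ ∏ i ∈ s, (1 + 2 * t i) =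
      1 + 2 * ∑ i ∈ s, t i + 2 * ((∑ i ∈ s, t i) ^ 2 - ∑ i ∈ s, t i ^ 2) + 8 * w by
    obtain ⟨w, _, _, h⟩ := H
    exact ⟨w, h⟩
  induction s using Finset.induction_on with
  | empty => exact ⟨0, 0, by simp, by simp⟩
  | insert a s ha ih =>
    obtain ⟨w, e, he, hw⟩ := ih
    refine ⟨w + 2 * t a * w + t a * e, e + t a * ∑ i ∈ s, t i, ?_, ?_⟩
    · rw [sum_insert ha, sum_insert ha]
      linear_combination he
    · rw [sum_insert ha, sum_insert ha, prod_insert ha, hw]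
      linear_combination 4 * t a * he

theorem prod_one_sub_four_mul_mod_eight {A ι : Type*} [CommRing A] (u : ι → A) (s : Finset ι) :
    ∃ w, ∏ i ∈ s, (1 - 4 * u i) = 1 - 4 * ∑ i ∈ s, u i + 8 * w := by
  obtain ⟨w, hw⟩ := prod_one_add_two_mul_mod_eight (fun i => -2 * u i) s
  refine ⟨w + (∑ i ∈ s, u i) ^ 2 - ∑ i ∈ s, u i ^ 2, ?_⟩
  simp only [mul_pow, ← mul_sum] at hw
  rw [← prod_congr rfl fun i _ => show 1 + 2 * (-2 * u i) = 1 - 4 * u i by ring, hw]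
  ring

theorem sum_div_add_orbit_succ {Ω : Type*} [Field Ω] [CharP Ω 2] (x : ℕ → Ω) (e : ℕ)
    (hx : ∀ i j, i < j → j ≤ e → x i ≠ x j) (hper : x (e + 1) = x 0) :
    ∑ j ∈ range (e + 1), ∑ i ∈ range j, x (i + 1) / (x (i + 1) + x (j + 1)) =
      (∑ j ∈ range (e + 1), ∑ i ∈ range j, x i / (x i + x j)) + e := by
  rw [sum_range_succ, sum_range_succ' (fun j => ∑ i ∈ range j, x i / (x i + x j))]
  simp only [sum_range_succ' _ _, range_zero, sum_empty, add_zero, sum_add_distrib, hper, add_assoc]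
  congr 1
  rw [← sub_eq_iff_eq_add', ← sum_sub_distrib]
  rw [sum_congr rfl (g := fun _ => 1)]
  · simp
  · intro i hi
    have h : x 0 + x (i + 1) ≠ 0 := by
      intro h
      exact hx 0 (i + 1) (by omega) (by have := mem_range.1 hi; omega) (CharTwo.add_eq_zero.1 h)
    rw [add_comm (x (i + 1)), CharTwo.sub_eq_add, ← add_div, add_comm, div_self h]

theorem berlekamp_sum_ne_zero_and_ne_one {Ω : Type*} [Field Ω] [CharP Ω 2] (x : ℕ → Ω) {d m : ℕ}
    (hd : Even d) (hd0 : 0 < d)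
    (hx : ∀ i j, i < j → j < d → x i ≠ x j) (hper : x d = x 0)
    (hpow : ∀ i, x (i + 1) = x i ^ 2 ^ (2 * m)) :
    ∑ j ∈ range d, ∑ i ∈ range j, x i * x j / (x i + x j) ^ 2 ≠ 0 ∧
    ∑ j ∈ range d, ∑ i ∈ range j, x i * x j / (x i + x j) ^ 2 ≠ 1 := by
  set γ := ∑ j ∈ range d, ∑ i ∈ range j, x i / (x i + x j) with hγ
  have hβ : ∑ j ∈ range d, ∑ i ∈ range j, x i * x j / (x i + x j) ^ 2 = γ ^ 2 + γ := by
    rw [hγ, sum_pow_char 2, ← sum_add_distrib]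
    refine sum_congr rfl fun j hj => ?_
    rw [sum_pow_char 2, ← sum_add_distrib]
    refine sum_congr rfl fun i hi => ?_
    have h : x i + x j ≠ 0 := fun h =>
      hx i j (mem_range.1 hi) (mem_range.1 hj) (CharTwo.add_eq_zero.1 h)
    field_simp
    linear_combination - x i ^ 2 * CharTwo.two_eq_zero (R := Ω)
  have hfrob : γ ^ 2 ^ (2 * m) = γ + 1 := by
    obtain ⟨e, rfl⟩ : ∃ e, d = e + 1 := ⟨d - 1, by omega⟩
    have he : (e : Ω) = 1 := by
      obtain ⟨c, rfl⟩ : Odd e := by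
        by_contra h
        exact (Nat.not_even_iff_odd.2 (Nat.not_odd_iff_even.1 h).add_one) hd
      push_cast
      rw [CharTwo.two_eq_zero]; ring
    have key := sum_div_add_orbit_succ x e (fun i j h h' => hx i j h (by omega)) hper
    rw [he] at key
    rw [← key, hγ, sum_pow_char_pow 2]
    refine sum_congr rfl fun j hj => ?_
    rw [sum_pow_char_pow 2]
    refine sum_congr rfl fun i hi => ?_
    rw [div_pow, add_pow_char_pow, ← hpow, ← hpow]
  have hfix : γ ^ 4 = γ → False := by
    intro h4
    have : ∀ m, γ ^ 2 ^ (2 * m) = γ := by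
      intro m
      induction m with
      | zero => simp
      | succ m ih => rw [mul_add, pow_add, pow_mul, ih]; norm_num [h4]
    rw [this] at hfrob
    simp at hfrob
  rw [hβ]
  refine ⟨fun h => hfix ?_, fun h => hfix ?_⟩
  · linear_combination (γ^2 - γ + 1) * h - γ * CharTwo.two_eq_zero (R := Ω)
  · linear_combination (γ^2 - γ + 2) * h + (1 - 2 * γ) * CharTwo.two_eq_zero (R := Ω)

theorem psum_trinomial {A : Type*} [CommRing A] {d s : ℕ} (hs : Odd s) (hsd : s < d)
    (h2s : 2 * s ≠ d) (B : A) (y : ℕ → A)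
    (hy : ∏ i ∈ range d, (X - C (y i)) = X ^ d + X ^ (d - s) + C B) :
    ∑ i ∈ range d, y i ^ s = -(s : A) ∧ ∑ i ∈ range d, y i ^ (2 * s) = s := by
  let v : Fin d → A := fun i => y i
  let ε : ℕ → A := fun j => MvPolynomial.aeval v (MvPolynomial.esymm (Fin d) A j)
  have hcoeff : ∀ j, j ≤ d → (-1) ^ j * ε j = (X ^ d + X ^ (d - s) + C B).coeff (d - j) := by
    intro j hj
    have hprod := Fin.prod_univ_eq_prod_range (fun i => X - C (y i)) d
    rw [hy] at hprod
    have := Multiset.prod_X_sub_C_coeff (univ.val.map v) (k := d - j) (by simp)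
    rw [Multiset.map_map] at this
    simp only [Multiset.card_map, card_val, card_univ, Fintype.card_fin,
      Nat.sub_sub_self hj] at this
    simp only [ε, MvPolynomial.aeval_esymm_eq_multiset_esymm]
    rw [← this, ← hprod]
    rfl
  have hε : ∀ j, 0 < j → j ≠ s → j ≠ d → ε j = 0 := by
    intro j hj hjs hjd
    rcases lt_or_ge d j with h | h
    · simp only [ε, MvPolynomial.esymm]
      rw [powersetCard_eq_empty.2 (by simpa using h)]
      simp
    · have := hcoeff j h
      rw [coeff_add, coeff_add, coeff_X_pow, coeff_X_pow, coeff_C, if_neg (by omega),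
        if_neg (by omega), if_neg (by omega)] at this
      simpa using this
  have hεs : ε s = -1 := by
    have h := hcoeff s hsd.le
    have hpos := hs.pos
    simp only [coeff_add, coeff_X_pow, coeff_C, hs.neg_one_pow, if_neg (show d - s ≠ d by omega),
      if_neg (show d - s ≠ 0 by omega), if_true] at h
    linear_combination -h
  have newton : ∀ j, 0 < j → ∑ i ∈ range d, y i ^ j = (-1) ^ (j + 1) * j * ε j -
      ∑ a ∈ antidiagonal j with a.1 ∈ Set.Ioo 0 j, (-1) ^ a.1 * ε a.1 *
        ∑ i ∈ range d, y i ^ a.2 := by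
    intro j hj
    have := congrArg (MvPolynomial.aeval v) (MvPolynomial.psum_eq_mul_esymm_sub_sum (Fin d) A j hj)
    simp only [MvPolynomial.psum, map_sum, map_sub, map_mul, map_pow, map_neg, map_one, map_natCast,
      MvPolynomial.aeval_X, v] at this
    simpa only [← Fin.sum_univ_eq_sum_range (fun i => y i ^ _)] using this
  have hlow : ∀ j, 0 < j → j < s → ∑ i ∈ range d, y i ^ j = 0 := by
    intro j hj hjs
    rw [newton j hj, hε j hj (by omega) (by omega), sum_eq_zero]
    · simp
    · rintro ⟨a, b⟩ h
      simp only [mem_filter, HasAntidiagonal.mem_antidiagonal, Set.mem_Ioo] at h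
      rw [hε a (by omega) (by omega) (by omega)]
      simp
  have hps : ∑ i ∈ range d, y i ^ s = -(s : A) := by
    rw [newton s hs.pos, hεs, sum_eq_zero, Even.neg_one_pow hs.add_one]
    · simp
    · rintro ⟨a, b⟩ h
      simp only [mem_filter, HasAntidiagonal.mem_antidiagonal, Set.mem_Ioo] at h
      rw [hε a (by omega) (by omega) (by omega)]
      simp
  refine ⟨hps, ?_⟩
  have hpos := hs.pos
  rw [newton (2 * s) (by omega), hε (2 * s) (by omega) (by omega) h2s, sum_eq_single (s, s)]
  · simp [hεs, hps, hs.neg_one_pow]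
  · rintro ⟨a, b⟩ h hne
    simp only [mem_filter, HasAntidiagonal.mem_antidiagonal, Set.mem_Ioo] at h
    by_cases had : a = d
    · dsimp only
      rw [hlow b (by omega) (by omega), mul_zero]
    · rw [hε a (by omega) (fun h' => hne (by ext <;> simp <;> omega)) had]
      simp
  · intro h
    exfalso
    apply h
    simp
    omega

theorem four_dvd_of_four_mul_eq {A : Type*} [CommRing A] [IsDomain A] [CharZero A]
    (h2 : ¬ IsUnit (2 : A)) {N : ℤ} {a : A} (h : 4 * a = N) : 4 ∣ N := by
  have hodd : ∀ {N : ℤ} {a : A}, 2 * a = N → 2 ∣ N := by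
    intro N a h
    by_contra hN
    obtain ⟨c, rfl⟩ : Odd N := by
      rwa [← Int.not_even_iff_odd, even_iff_two_dvd]
    refine h2 (IsUnit.of_mul_eq_one (a - c) ?_)
    push_cast at h
    linear_combination h
  obtain ⟨N, rfl⟩ := hodd (a := 2 * a) (by rw [← h]; ring)
  obtain ⟨N, rfl⟩ := hodd (N := N) (a := a) (by
    push_cast at h
    apply mul_left_cancel₀ (two_ne_zero (α := A))
    linear_combination h)
  exact ⟨N, by ring⟩

theorem prod_sq_add_mul_prod_trinomial {A : Type*} [CommRing A] [IsDomain A] [CharZero A] {n k : ℕ}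
    (hk : Odd k) (B : A) (y : ℕ → A)
    (hy : ∏ i ∈ range (2 * n), (X - C (y i)) = X ^ (2 * n) + X ^ k + C B) :
    (∏ i ∈ range (2 * n), y i) * ∏ j ∈ range (2 * n), ∏ i ∈ range j, (y i + y j) ^ 2 =
      (∏ i ∈ range (2 * n), y i) ^ k := by
  have heval : ∀ z, ∏ j ∈ range (2 * n), (z - y j) = z ^ (2 * n) + z ^ k + B := by
    intro z
    simpa [eval_prod] using congrArg (eval z) hy
  have hrow : ∀ i ∈ range (2 * n), ∏ j ∈ range (2 * n), (y i + y j) = -2 * y i ^ k := by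
    intro i hi
    have h0 := heval (y i)
    rw [prod_eq_zero hi (sub_self _)] at h0
    have h1 := heval (-y i)
    rw [hk.neg_pow, (even_two_mul n).neg_pow] at h1
    have h2 : ∏ j ∈ range (2 * n), (y i + y j) = ∏ j ∈ range (2 * n), (-y i - y j) := by
      rw [← one_mul (∏ j ∈ range (2 * n), (y i + y j)), ← (even_two_mul n).neg_one_pow (α := A)]
      nth_rw 1 [← card_range (2 * n)]
      rw [← prod_const, ← prod_mul_distrib]
      exact prod_congr rfl fun j _ => by ring
    rw [h2, h1]
    linear_combination -h0
  have key := prod_range_prod_range_eq_diag_mul (fun i j => y i + y j) (2 * n)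
  rw [prod_congr rfl hrow, prod_mul_distrib, prod_const, card_range, (even_two_mul n).neg_pow,
    prod_pow] at key
  simp only [← two_mul] at key
  rw [prod_mul_distrib, prod_const, card_range, mul_assoc] at key
  rw [mul_left_cancel₀ (pow_ne_zero _ two_ne_zero) key]
  congr 1
  exact prod_congr rfl fun j _ => prod_congr rfl fun i _ => by ring

theorem prod_neg_sq_sub_trinomial {A : Type*} [CommRing A] {n s : ℕ}
    (hsd : s < 2 * n) (B : A) (y : ℕ → A)
    (hy : ∏ i ∈ range (2 * n), (X - C (y i)) = X ^ (2 * n) + X ^ (2 * n - s) + C B) :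
    ∏ j ∈ range (2 * n), ∏ i ∈ range j, (-1 * (y i - y j) ^ 2) =
      (∏ i ∈ range (2 * n), y i) ^ (2 * n - s - 1) *
        ∏ i ∈ range (2 * n), ((2 * n - s : ℕ) + 2 * n * y i ^ s) := by
  have hrow : ∀ i ∈ range (2 * n), ∏ j ∈ range (2 * n), (if i = j then 1 else y i - y j) =
      y i ^ (2 * n - s - 1) * ((2 * n - s : ℕ) + 2 * n * y i ^ s) := by
    intro i hi
    have h := Lagrange.eval_nodal_derivative_eval_node_eq (s := range (2 * n)) (v := y) hi
    rw [Lagrange.eval_nodal, Lagrange.nodal, hy] at h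
    rw [← mul_prod_erase _ _ hi, if_pos rfl, one_mul,
      prod_congr rfl fun j hj => if_neg (ne_of_mem_erase hj).symm, ← h]
    obtain ⟨k, hk⟩ : ∃ k, 2 * n = k + 1 + s := ⟨2 * n - s - 1, by omega⟩
    have hk' : (2 * n : A) = k + 1 + s := by exact_mod_cast congrArg (Nat.cast (R := A)) hk
    rw [hk', hk, show k + 1 + s - s = k + 1 by omega, show k + 1 - 1 = k by omega]
    simp only [derivative_add, derivative_X_pow, derivative_C, eval_add, eval_mul, eval_pow, eval_X,
      eval_C, eval_zero, show k + 1 + s - 1 = k + s by omega, Nat.add_sub_cancel]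
    push_cast
    ring
  have key := prod_range_prod_range_eq_diag_mul (fun i j => if i = j then 1 else y i - y j) (2 * n)
  rw [prod_congr rfl hrow, prod_mul_distrib, prod_pow] at key
  rw [key]
  simp only [if_true, prod_const_one, one_mul]
  refine prod_congr rfl fun j _ => prod_congr rfl fun i hi => ?_
  have := mem_range.1 hi
  rw [if_neg (by omega), if_neg (by omega)]
  ring

theorem berlekamp_sum_trinomial {A : Type*} [CommRing A] [IsDomain A] [IsLocalRing A] [CharZero A]
    (h2 : ¬ IsUnit (2 : A)) {n s : ℕ} (hs : Odd s) (hsd : s < 2 * n) (hsn : s ≠ n) (B : A)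
    (y : ℕ → A) (hy : ∏ i ∈ range (2 * n), (X - C (y i)) = X ^ (2 * n) + X ^ (2 * n - s) + C B)
    (hy0 : ∀ i < 2 * n, y i ≠ 0) (x : ℕ → IsLocalRing.ResidueField A)
    (hxy : ∀ i < 2 * n, IsLocalRing.residue A (y i) = x i)
    (hx : ∀ i j, i < j → j < 2 * n → x i ≠ x j) :
    ∑ j ∈ range (2 * n), ∑ i ∈ range j, x i * x j / (x i + x j) ^ 2 = 0 ∨
    ∑ j ∈ range (2 * n), ∑ i ∈ range j, x i * x j / (x i + x j) ^ 2 = 1 := by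
  let φ := IsLocalRing.residue A
  have h20 : (2 : IsLocalRing.ResidueField A) = 0 := by
    rw [← map_ofNat φ 2]
    exact (IsLocalRing.residue_eq_zero_iff _).2 ((IsLocalRing.mem_maximalIdeal _).2 h2)
  have hunit : ∀ i j, i < j → j < 2 * n → IsUnit (y i + y j) := by
    intro i j hij hj
    rw [← IsLocalRing.residue_ne_zero_iff_isUnit, map_add, hxy i (by omega), hxy j hj]
    intro h
    exact hx i j hij hj (by linear_combination h - x j * h20)
  let u : ℕ → ℕ → A := fun i j => y i * y j * Ring.inverse (y i + y j) ^ 2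
  have hinv : ∀ i j, i < j → j < 2 * n → (y i + y j) * Ring.inverse (y i + y j) = 1 :=
    fun i j hij hj => Ring.mul_inverse_cancel _ (hunit i j hij hj)
  have hu : ∀ i j, i < j → j < 2 * n → φ (u i j) = x i * x j / (x i + x j) ^ 2 := by
    intro i j hij hj
    have h := congrArg φ (hinv i j hij hj)
    simp only [map_mul, map_one, map_add, φ, hxy i (hij.trans hj), hxy j hj] at h
    simp only [u, φ, map_mul, map_pow, hxy i (hij.trans hj), hxy j hj]
    rw [eq_div_iff (pow_ne_zero _ (left_ne_zero_of_mul_eq_one h)), mul_assoc, ← mul_pow,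
      mul_comm _ (x i + x j), h]
    simp
  have hβ : ∑ j ∈ range (2 * n), ∑ i ∈ range j, x i * x j / (x i + x j) ^ 2 =
      φ (∑ j ∈ range (2 * n), ∑ i ∈ range j, u i j) := by
    simp only [map_sum]
    exact sum_congr rfl fun j hj => sum_congr rfl fun i hi =>
      (hu i j (mem_range.1 hi) (mem_range.1 hj)).symm
  have hk : Odd (2 * n - s) := Nat.Even.sub_odd hsd.le (even_two_mul n) hs
  obtain ⟨c, hc⟩ := hk
  let σ : ℤ := ∏ j ∈ range (2 * n), ∏ i ∈ range j, (-1)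
  have hσ : σ * σ = 1 := by simp [σ, ← prod_mul_distrib, ← mul_pow]
  let U := ∏ j ∈ range (2 * n), ∏ i ∈ range j, (1 - 4 * u i j)
  have hU : σ * U = ∏ i ∈ range (2 * n), (1 + 2 * (c + n * y i ^ s)) := by
    have hP : ∏ i ∈ range (2 * n), y i ≠ 0 := prod_ne_zero_iff.2 fun i hi => hy0 i (mem_range.1 hi)
    have h1 := prod_sq_add_mul_prod_trinomial ⟨c, hc⟩ B y hy
    have h2 := prod_neg_sq_sub_trinomial hsd B y hy
    have h3 : ∏ j ∈ range (2 * n), ∏ i ∈ range j, (-1 * (y i - y j) ^ 2) =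
        σ * (∏ j ∈ range (2 * n), ∏ i ∈ range j, (y i + y j) ^ 2) * U := by
      simp only [σ, U, Int.cast_prod, ← prod_mul_distrib]
      refine prod_congr rfl fun j hj => prod_congr rfl fun i hi => ?_
      have := hinv i j (mem_range.1 hi) (mem_range.1 hj)
      simp only [u]
      push_cast
      linear_combination (-4 * y i * y j) * ((y i + y j) * Ring.inverse (y i + y j) + 1) * this
    have h4 : ∏ i ∈ range (2 * n), ((2 * n - s : ℕ) + 2 * n * y i ^ s) =
        ∏ i ∈ range (2 * n), (1 + 2 * (c + n * y i ^ s)) := by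
      refine prod_congr rfl fun i _ => ?_
      rw [hc]
      push_cast
      ring
    rw [h3, h4] at h2
    apply mul_left_cancel₀ (pow_ne_zero (2 * n - s) hP)
    have h5 : (∏ i ∈ range (2 * n), y i) ^ (2 * n - s) =
        (∏ i ∈ range (2 * n), y i) * (∏ i ∈ range (2 * n), y i) ^ (2 * n - s - 1) := by
      rw [← pow_succ', Nat.sub_add_cancel (by omega)]
    linear_combination (∏ i ∈ range (2 * n), y i) * h2 - σ * U * h1 -
      (∏ i ∈ range (2 * n), (1 + 2 * (c + n * y i ^ s))) * h5
  obtain ⟨w, hw⟩ := prod_one_add_two_mul_mod_eight (fun i => c + n * y i ^ s) (range (2 * n))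
  obtain ⟨w', hw'⟩ := prod_one_sub_four_mul_mod_eight (fun p : Σ _ : ℕ, ℕ => u p.2 p.1)
    ((range (2 * n)).sigma range)
  rw [prod_sigma, sum_sigma] at hw'
  change U = _ at hw'
  obtain ⟨hp1, hp2⟩ := psum_trinomial hs hsd (by omega) B y hy
  have hm1 : ∑ i ∈ range (2 * n), (c + n * y i ^ s) = ((2 * n * c - n * s : ℤ) : A) := by
    rw [sum_add_distrib, ← mul_sum, hp1]
    simp
    ring
  have hm2 : ∑ i ∈ range (2 * n), (c + n * y i ^ s) ^ 2 =
      ((2 * n * c ^ 2 - 2 * c * n * s + n ^ 2 * s : ℤ) : A) := by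
    simp only [add_sq, mul_pow, ← pow_mul, mul_comm s 2, sum_add_distrib, ← mul_sum, hp1, hp2]
    simp
    ring
  set m1 : ℤ := 2 * n * c - n * s
  set m2 : ℤ := 2 * n * c ^ 2 - 2 * c * n * s + n ^ 2 * s
  set S := ∑ j ∈ range (2 * n), ∑ i ∈ range j, u i j
  rw [hm1, hm2] at hw
  have hσA : (σ * σ : A) = 1 := by exact_mod_cast congrArg (Int.cast (R := A)) hσ
  have hN : 4 * (S - 2 * (w' - σ * w)) =
      ((1 - σ * (1 + 2 * m1 + 2 * (m1 ^ 2 - m2)) : ℤ) : A) := by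
    push_cast
    linear_combination -σ * hU - σ * hw + hw' + U * hσA
  obtain ⟨N, hN'⟩ := four_dvd_of_four_mul_eq h2 hN
  rw [hN'] at hN
  have hS : S = N + 2 * (w' - σ * w) := by
    apply mul_left_cancel₀ (show (4 : A) ≠ 0 by norm_num)
    push_cast at hN
    linear_combination hN
  rw [hβ, hS, map_add, map_mul, map_ofNat, h20, map_intCast, zero_mul, add_zero]
  rcases Int.even_or_odd' N with ⟨m, rfl | rfl⟩
  · left; push_cast; rw [h20]; ring
  · right; push_cast; rw [h20]; ring

theorem injOn_range_of_lt {α : Type*} {y : ℕ → α} {d : ℕ}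
    (hy : ∀ i j, i < j → j < d → y i ≠ y j) : Set.InjOn y (range d) := by
  intro i hi j hj hij
  have hi' := mem_range.1 hi
  have hj' := mem_range.1 hj
  rcases lt_trichotomy i j with h | h | h
  · exact (hy i j h hj' hij).elim
  · exact h
  · exact (hy j i h hi' hij.symm).elim

theorem monic_and_natDegree_trinomial {R : Type*} [CommRing R] [Nontrivial R] {d k : ℕ}
    (hk : k < d) (b : R) :
    (X ^ d + X ^ k + C b).Monic ∧ (X ^ d + X ^ k + C b).natDegree = d := by
  have hlt : (X ^ k + C b).degree < (d : WithBot ℕ) := by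
    refine (degree_add_le _ _).trans_lt (max_lt ?_ ?_)
    · rw [degree_X_pow]
      exact_mod_cast hk
    · exact degree_C_le.trans_lt (by exact_mod_cast Nat.zero_lt_of_lt hk)
  rw [add_assoc]
  refine ⟨monic_X_pow_add hlt, natDegree_eq_of_degree_eq_some ?_⟩
  rw [degree_add_eq_left_of_degree_lt (by rwa [degree_X_pow]), degree_X_pow]

theorem eq_prod_X_sub_C_of_monic {A : Type*} [CommRing A] [IsDomain A] {p : A[X]} (hp : p.Monic)
    (y : ℕ → A) (hroot : ∀ i < p.natDegree, p.eval (y i) = 0)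
    (hy : ∀ i j, i < j → j < p.natDegree → y i ≠ y j) :
    ∏ i ∈ range p.natDegree, (X - C (y i)) = p := by
  have hinj := injOn_range_of_lt hy
  have hdvd : ((range p.natDegree).val.map fun i => X - C (y i)).prod ∣ p := by
    have h := (Multiset.prod_X_sub_C_dvd_iff_le_roots hp.ne_zero
      ((range p.natDegree).val.map y)).2 ((Multiset.le_iff_subset
        ((range p.natDegree).nodup_map_iff_injOn.2 hinj)).2 ?_)
    · rwa [Multiset.map_map] at h
    · intro z hz
      obtain ⟨i, hi, rfl⟩ := Multiset.mem_map.1 hz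
      exact (mem_roots hp.ne_zero).2 (hroot i (mem_range.1 hi))
  refine (eq_of_monic_of_dvd_of_natDegree_le (monic_prod_X_sub_C _ _) hp hdvd ?_).symm
  rw [natDegree_prod_of_monic _ _ fun i _ => monic_X_sub_C _]
  simp

theorem exists_local_domain_monic_splits :
    ∃ (A : Type) (_ : CommRing A) (_ : IsDomain A) (_ : IsLocalRing A),
      CharZero A ∧ ¬ IsUnit (2 : A) ∧ ∀ p : A[X], p.Monic → p.Splits := by
  obtain ⟨V, hV, hloc⟩ := IsLocalRing.exists_factor_valuationRing
    (algebraMap ℤ_[2] (AlgebraicClosure ℚ_[2]))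
  refine ⟨V, inferInstance, inferInstance, inferInstance,
    ⟨fun m n h => Nat.cast_injective (R := AlgebraicClosure ℚ_[2]) ?_⟩, ?_, ?_⟩
  · exact_mod_cast congrArg (algebraMap V (AlgebraicClosure ℚ_[2])) h
  · intro h
    refine PadicInt.p_nonunit (p := 2) ?_
    apply hloc.map_nonunit
    convert h
    simp
    rfl
  · intro p hp
    refine Splits.of_splits_map_of_injective (i := algebraMap V (AlgebraicClosure ℚ_[2]))
      (FaithfulSMul.algebraMap_injective _ _) (IsAlgClosed.splits _) fun a ha => ?_
    have hint : IsIntegral V a := ⟨p, hp, by simpa [eval_map] using (mem_roots'.1 ha).2⟩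
    exact IsIntegrallyClosed.isIntegral_iff.1 hint

theorem dvd_of_irreducible_of_aeval_eq_zero {K Ω : Type*} [Field K] [Field Ω] [Algebra K Ω]
    {g h : K[X]} (hg : Irreducible g) {x : Ω} (hx : aeval x g = 0) (hh : aeval x h = 0) :
    g ∣ h := by
  by_contra hdvd
  obtain ⟨a, b, hab⟩ := hg.coprime_iff_not_dvd.2 hdvd
  have := congrArg (aeval x) hab
  simp [hx, hh] at this

theorem pow_two_pow_natDegree_eq {Ω : Type*} [Field Ω] [Algebra (ZMod 2) Ω] {g : (ZMod 2)[X]}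
    (hg : Irreducible g) {x : Ω} (hx : aeval x g = 0) : x ^ 2 ^ g.natDegree = x := by
  obtain ⟨c, hc⟩ := hg.natDegree_dvd_iff_dvd_X_pow_card_pow_sub_X.1 dvd_rfl
  have := congrArg (aeval x) hc
  simp only [map_mul, hx, zero_mul, map_sub, map_pow, aeval_X, Nat.card_zmod] at this
  exact sub_eq_zero.1 this

theorem pow_two_pow_ne {Ω : Type*} [Field Ω] [Algebra (ZMod 2) Ω] [CharP Ω 2] {g : (ZMod 2)[X]}
    (hg : Irreducible g) {x : Ω} (hx : aeval x g = 0) {i j : ℕ} (hij : i < j)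
    (hj : j < g.natDegree) : x ^ 2 ^ i ≠ x ^ 2 ^ j := by
  intro h
  have hfix : x ^ 2 ^ (j - i) = x := by
    refine iterateFrobenius_inj Ω 2 i ?_
    rw [iterateFrobenius_def, iterateFrobenius_def, ← pow_mul, ← pow_add,
      Nat.sub_add_cancel hij.le, h]
  have hdvd : g ∣ X ^ Nat.card (ZMod 2) ^ (j - i) - X :=
    dvd_of_irreducible_of_aeval_eq_zero hg hx (by simp [hfix])
  have := Nat.le_of_dvd (by omega) (hg.natDegree_dvd_of_dvd_X_pow_card_pow_sub_X hdvd)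
  omega

theorem sum_pow_two_pow_eq_zero {Ω : Type*} [Field Ω] [Algebra (ZMod 2) Ω] [CharP Ω 2]
    {g : (ZMod 2)[X]} (hg : Irreducible g) (hm : g.Monic)
    (hcoeff : g.coeff (g.natDegree - 1) = 0) {x : Ω} (hx : aeval x g = 0) :
    ∑ j ∈ range g.natDegree, x ^ 2 ^ j = 0 := by
  have hdeg := hm.natDegree_map (algebraMap (ZMod 2) Ω)
  have hroot : ∀ i < (g.map (algebraMap (ZMod 2) Ω)).natDegree,
      (g.map (algebraMap (ZMod 2) Ω)).eval (x ^ 2 ^ i) = 0 := by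
    intro i _
    rw [eval_map_algebraMap]
    induction i with
    | zero => simpa using hx
    | succ i ih =>
      rw [pow_succ, pow_mul, ← expand_aeval, ZMod.expand_card, map_pow, ih (by omega)]
      simp
  have key := eq_prod_X_sub_C_of_monic (hm.map (algebraMap (ZMod 2) Ω)) (fun i => x ^ 2 ^ i) hroot
    (fun i j hij hj => pow_two_pow_ne hg hx hij (hdeg ▸ hj))
  have h := prod_X_sub_C_nextCoeff (s := range g.natDegree) (fun i => x ^ 2 ^ i)
  rw [hdeg] at key
  rw [key, nextCoeff_of_natDegree_pos (by rw [hdeg]; exact hg.natDegree_pos), hdeg, coeff_map,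
    hcoeff, map_zero] at h
  exact neg_eq_zero.1 h.symm

theorem irreducible_of_irreducible_comp {K : Type*} [Field K] {p q : K[X]}
    (hq : q.natDegree ≠ 0) (h : Irreducible (p.comp q)) : Irreducible p := by
  have hunit : ∀ a : K[X], IsUnit (a.comp q) → IsUnit a := by
    intro a ha
    have hdeg := natDegree_eq_zero_of_isUnit ha
    rw [natDegree_comp] at hdeg
    have ha0 := (mul_eq_zero.1 hdeg).resolve_right hq
    rw [eq_C_of_natDegree_eq_zero ha0] at ha ⊢
    simpa using ha
  refine ⟨fun hp => h.not_isUnit (hp.map (compRingHom q)), fun a b hab => ?_⟩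
  rcases h.isUnit_or_isUnit (a := a.comp q) (b := b.comp q) (by rw [hab, mul_comp]) with h | h
  · exact Or.inl (hunit a h)
  · exact Or.inr (hunit b h)

theorem pow_two_pow_eq_add_sum {Ω : Type*} [CommRing Ω] [CharP Ω 2] (z : Ω) (m : ℕ) :
    z ^ 2 ^ m = z + ∑ j ∈ range m, (z ^ 2 + z) ^ 2 ^ j := by
  induction m with
  | zero => simp
  | succ m ih =>
    rw [sum_range_succ, ← add_assoc, ← ih, add_pow_char_pow, ← pow_mul, ← pow_succ']
    linear_combination -z ^ 2 ^ m * CharTwo.two_eq_zero (R := Ω)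

theorem coeff_trinomial_comp_self_eq_zero {n : ℕ} (hn : 1 ≤ n) {f : (ZMod 2)[X]}
    (hf : f = X ^ (2 * n) + X ^ n + 1) (hdeg : f.natDegree = 2 * n) :
    (f.comp f).coeff ((2 * n) ^ 2 - 1) = 0 := by
  have hcomp : f.comp f = expand (ZMod 2) 2 (f ^ n) + f ^ n + 1 := by
    rw [ZMod.expand_card, ← pow_mul, mul_comm n 2]
    nth_rw 1 [hf]
    simp
  have hn2 : 1 ≤ n ^ 2 := Nat.one_le_pow _ _ hn
  have hsq : (2 * n) ^ 2 = 4 * n ^ 2 := by ring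
  rw [hcomp, coeff_add, coeff_add, coeff_expand (by norm_num), if_neg (by omega),
    coeff_eq_zero_of_natDegree_lt, coeff_one, if_neg (by omega)]
  · simp
  · rw [natDegree_pow, hdeg, show n * (2 * n) = 2 * n ^ 2 by ring]
    omega

theorem trinomial_frobenius_orbit_ne {A : Type*} [CommRing A] [IsDomain A] [IsLocalRing A]
    [CharZero A] (h2 : ¬ IsUnit (2 : A)) (hsplit : ∀ p : A[X], p.Monic → p.Splits)
    {n s m : ℕ} (hn : 1 ≤ n) (hs : Odd s) (hsd : s < 2 * n) (hsn : s ≠ n)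
    (x : ℕ → IsLocalRing.ResidueField A) [CharP (IsLocalRing.ResidueField A) 2]
    (hx : ∀ i j, i < j → j < 2 * n → x i ≠ x j) (hper : x (2 * n) = x 0)
    (hpow : ∀ i, x (i + 1) = x i ^ 2 ^ (2 * m)) (b : IsLocalRing.ResidueField A) :
    ¬ ∀ i < 2 * n, x i ^ (2 * n) + x i ^ (2 * n - s) + b = 0 := by
  intro hroot
  obtain ⟨B, rfl⟩ := IsLocalRing.residue_surjective b
  set p : A[X] := X ^ (2 * n) + X ^ (2 * n - s) + C B with hp
  have hspos := hs.pos
  obtain ⟨hmonic, hdeg⟩ : p.Monic ∧ p.natDegree = 2 * n :=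
    monic_and_natDegree_trinomial (by omega) B
  have hlift : ∀ i, i < 2 * n → ∃ y, p.eval y = 0 ∧ IsLocalRing.residue A y = x i := by
    intro i hi
    have h : (p.map (IsLocalRing.residue A)).eval (x i) = 0 := by
      simpa [hp] using hroot i hi
    rw [(hsplit p hmonic).eq_prod_roots_of_monic hmonic, eval_map,
      eval₂_multiset_prod, Multiset.map_map, Multiset.prod_eq_zero_iff] at h
    obtain ⟨y, hy, hxy⟩ := Multiset.mem_map.1 h
    refine ⟨y, (mem_roots'.1 hy).2, ?_⟩
    simp only [Function.comp_apply, eval₂_sub, eval₂_X, eval₂_C] at hxy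
    exact (sub_eq_zero.1 hxy).symm
  choose! y hy hxy using hlift
  have hprod := eq_prod_X_sub_C_of_monic hmonic y (fun i hi => hy i (hdeg ▸ hi))
    (fun i j hij hj h => by
      rw [hdeg] at hj
      exact hx i j hij hj (by rw [← hxy i (hij.trans hj), h, hxy j hj]))
  rw [hdeg] at hprod
  have hx0 : ∀ i, x i = 0 → x (i + 1) = 0 := by
    intro i hi
    rw [hpow, hi, zero_pow (by positivity)]
  have hall : ∀ i j, x i = 0 → x (i + j) = 0 := by
    intro i j hi
    induction j with
    | zero => exact hi
    | succ j ih => exact hx0 _ ih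
  have hy0 : ∀ i < 2 * n, y i ≠ 0 := by
    intro i hi h
    have hxi : x i = 0 := by rw [← hxy i hi, h, map_zero]
    have h0 : x 0 = 0 := by
      rw [← hper, ← Nat.add_sub_cancel' hi.le]
      exact hall _ _ hxi
    exact hx 0 1 (by omega) (by omega) (by rw [h0, hx0 0 h0])
  obtain ⟨hne0, hne1⟩ := berlekamp_sum_ne_zero_and_ne_one x (even_two_mul n) (by omega) hx hper hpow
  exact (berlekamp_sum_trinomial h2 hs hsd hsn B y hprod hy0 x hxy hx).elim hne0 hne1

theorem trinomial_third_iterate_not_irreducible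
    (n s : ℕ) (hn : 1 ≤ n) (hs : 0 < s) (hs2 : s < 2 * n)
    (f : Polynomial (ZMod 2))
    (hf : f = X ^ (2 * n) + X ^ (2 * n - s) + 1) :
    ¬ Irreducible (f.comp (f.comp f)) := by
  intro hirr
  rcases Nat.even_or_odd s with hse | hso
  · obtain ⟨c, rfl⟩ := even_iff_two_dvd.1 hse
    have hsq : f = (X ^ n + X ^ (n - c) + 1) ^ 2 := by
      rw [hf, CharTwo.add_sq, CharTwo.add_sq, ← pow_mul, ← pow_mul, Nat.sub_mul]
      simp [mul_comm]
    nth_rw 1 [hsq] at hirr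
    rw [pow_comp] at hirr
    exact not_irreducible_pow (by norm_num) hirr
  obtain ⟨A, _, _, _, _, h2, hsplit⟩ := exists_local_domain_monic_splits
  let Ω := IsLocalRing.ResidueField A
  have h20 : (2 : Ω) = 0 := by
    rw [← map_ofNat (IsLocalRing.residue A) 2]
    exact (IsLocalRing.residue_eq_zero_iff _).2 ((IsLocalRing.mem_maximalIdeal _).2 h2)
  have : CharP Ω 2 := CharTwo.of_one_ne_zero_of_two_eq_zero one_ne_zero h20
  let : Algebra (ZMod 2) Ω := ZMod.algebra Ω 2
  obtain ⟨hmonic, hdeg⟩ : f.Monic ∧ f.natDegree = 2 * n := by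
    rw [hf, ← C_1]
    exact monic_and_natDegree_trinomial (by omega) 1
  have hmonic2 : (f.comp f).Monic := hmonic.comp hmonic (by omega)
  have hmonic3 : (f.comp (f.comp f)).Monic :=
    hmonic.comp hmonic2 (by rw [natDegree_comp, hdeg]; positivity)
  have hirr2 : Irreducible (f.comp f) :=
    irreducible_of_irreducible_comp (by omega : f.natDegree ≠ 0) (by rwa [comp_assoc])
  have hdeg2 : (f.comp f).natDegree = (2 * n) ^ 2 := by rw [natDegree_comp, hdeg, sq]
  have hdeg3 : (f.comp (f.comp f)).natDegree = (2 * n) ^ 2 * (2 * n) := by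
    rw [natDegree_comp, hdeg2, hdeg, mul_comm]
  obtain ⟨x, hx⟩ : ∃ x : Ω, aeval x (f.comp (f.comp f)) = 0 := by
    obtain ⟨G, hG, hGdeg, hGm⟩ := lifts_and_degree_eq_and_monic (f := IsLocalRing.residue A)
      (p := (f.comp (f.comp f)).map (algebraMap (ZMod 2) Ω))
      ((mem_lifts _).2 (map_surjective _ IsLocalRing.residue_surjective _)) (hmonic3.map _)
    obtain ⟨a, ha⟩ := (hsplit G hGm).exists_eval_eq_zero (by
      rw [hGdeg, degree_map]
      exact (degree_pos_of_irreducible hirr).ne')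
    refine ⟨IsLocalRing.residue A a, ?_⟩
    rw [← eval_map_algebraMap, ← hG, eval_map, eval₂_at_apply, ha, map_zero]
  have hα : aeval (aeval x f) (f.comp f) = 0 := by
    rw [← comp_assoc, aeval_comp] at hx
    exact hx
  set α := aeval x f with hαdef
  have hαx : x ^ (2 * n) + x ^ (2 * n - s) + 1 = α := by simp [hαdef, hf]
  have hαfix : α ^ 2 ^ (2 * n) ^ 2 = α := by
    have := pow_two_pow_natDegree_eq hirr2 hα
    rwa [hdeg2] at this
  let ξ : ℕ → Ω := fun i => x ^ 2 ^ ((2 * n) ^ 2 * i)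
  have hsucc : ∀ i, ξ (i + 1) = ξ i ^ 2 ^ (2 * n) ^ 2 := by
    intro i
    simp only [ξ]
    rw [← pow_mul, ← pow_add, mul_add, mul_one]
  have hξ : ∀ i j, i < j → j < 2 * n → ξ i ≠ ξ j := by
    intro i j hij hj
    have hpos : 0 < (2 * n) ^ 2 := by positivity
    refine pow_two_pow_ne hirr hx (Nat.mul_lt_mul_of_pos_left hij hpos) ?_
    rw [hdeg3]
    exact Nat.mul_lt_mul_of_pos_left hj hpos
  by_cases hsn : s = n
  · subst hsn
    have hks : 2 * s - s = s := by omega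
    rw [hks] at hf hαx
    have hT := sum_pow_two_pow_eq_zero hirr2 hmonic2
      (by rw [hdeg2]; exact coeff_trinomial_comp_self_eq_zero hn hf hdeg) hα
    rw [hdeg2] at hT
    have hz : (x ^ s) ^ 2 ^ (2 * s) ^ 2 = x ^ s := by
      have h1 : (x ^ s) ^ 2 + x ^ s = α + 1 := by
        rw [← hαx, ← pow_mul, mul_comm s 2]
        linear_combination -h20
      rw [pow_two_pow_eq_add_sum, h1, sum_congr rfl fun j _ => add_pow_char_pow α 1 2 j,
        sum_add_distrib, hT]
      simp [h20]
    have hroot : ∀ i, ξ i ^ s = x ^ s := by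
      intro i
      induction i with
      | zero => simp [ξ]
      | succ i ih => rw [hsucc, ← pow_mul, mul_comm, pow_mul, ih, hz]
    classical
    have hcard : ((range (2 * s)).image ξ).card = 2 * s := by
      rw [card_image_of_injOn (injOn_range_of_lt hξ), card_range]
    refine X_pow_sub_C_ne_zero hn (x ^ s) (eq_zero_of_natDegree_lt_card_of_eval_eq_zero' _
      ((range (2 * s)).image ξ) ?_ ?_)
    · intro z hz
      obtain ⟨i, _, rfl⟩ := mem_image.1 hz
      simp [hroot]
    · rw [hcard, natDegree_X_pow_sub_C]
      omega
  · refine trinomial_frobenius_orbit_ne h2 hsplit (m := 2 * n ^ 2) hn hso hs2 hsn ξ hξ ?_ ?_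
      (1 + α) ?_
    · have := pow_two_pow_natDegree_eq hirr hx
      rw [hdeg3] at this
      simpa [ξ] using this
    · intro i
      rw [hsucc, show 2 * (2 * n ^ 2) = (2 * n) ^ 2 by ring]
    · intro i _
      have hi : ξ i ^ (2 * n) + ξ i ^ (2 * n - s) + 1 = α := by
        induction i with
        | zero => simpa [ξ] using hαx
        | succ i ih =>
          have h := congrArg (· ^ 2 ^ (2 * n) ^ 2) (ih (by omega))
          simp only [hαfix, add_pow_char_pow, one_pow] at h
          rw [← h, hsucc, pow_right_comm _ _ (2 * n), pow_right_comm _ _ (2 * n - s)]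
      linear_combination hi + α * h20
end

section
/- Let f be a polynomial of even degree over F_2 that is a trinomial, i.e., f has exactly three nonzero coefficients. Then f is not stable over F_2. -/
open Polynomial

section Symmetric

theorem exists_aeval_eq_map_of_isSymmetric {A : Type*} [CommRing A] {n : ℕ} (H : A[X])
    {Q : MvPolynomial (Fin n) ℤ} (hQ : Q.IsSymmetric) :
    ∃ a : A, ∀ {B : Type} [CommRing B] (θ : A →+* B) (r : Fin n → B),
      H.map θ = ∏ i, (X - C (r i)) → MvPolynomial.aeval r Q = θ a := by
  obtain ⟨p, hp⟩ := (MvPolynomial.esymmAlgHom_fin_bijective ℤ n).2 ⟨Q, hQ⟩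
  replace hp := congrArg Subtype.val hp
  rw [MvPolynomial.esymmAlgHom_apply] at hp
  refine ⟨MvPolynomial.aeval (fun i : Fin n => (-1) ^ (i.1 + 1) * H.coeff (n - (i.1 + 1))) p, ?_⟩
  intro B _ θ r h
  have key (i : Fin n) : MvPolynomial.aeval r (MvPolynomial.esymm (Fin n) ℤ (i.1 + 1)) =
      θ ((-1) ^ (i.1 + 1) * H.coeff (n - (i.1 + 1))) := by
    rw [MvPolynomial.aeval_esymm_eq_multiset_esymm, map_mul, map_pow, map_neg, map_one,
      ← coeff_map, h]
    have := Multiset.prod_X_sub_C_coeff (Finset.univ.val.map r) (k := n - (i.1 + 1)) (by simp)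
    rw [Multiset.map_map] at this
    change (∏ i, (X - C (r i))).coeff _ = _ at this
    rw [this]
    have e : n - (n - (i.1 + 1)) = i.1 + 1 := by omega
    simp only [Multiset.card_map, Finset.card_val, Finset.card_univ, Fintype.card_fin, e]
    rw [← mul_assoc, ← mul_pow]; simp
  have hcomp : (MvPolynomial.aeval r).comp
      (MvPolynomial.aeval fun i : Fin n => MvPolynomial.esymm (Fin n) ℤ (i.1 + 1)) =
      θ.toIntAlgHom.comp (MvPolynomial.aeval
        fun i : Fin n => (-1) ^ (i.1 + 1) * H.coeff (n - (i.1 + 1))) :=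
    MvPolynomial.algHom_ext fun i => by simpa using key i
  rw [← show _ = Q from hp]
  exact DFunLike.congr_fun hcomp p

variable (n : ℕ)

/-- The product of the differences of the variables. -/
noncomputable def diffProd : MvPolynomial (Fin n) ℤ :=
  ∏ i, ∏ j ∈ Finset.Ioi i, (MvPolynomial.X j - MvPolynomial.X i)

/-- The product of the sums of pairs of distinct variables. -/
noncomputable def sumProd : MvPolynomial (Fin n) ℤ :=
  ∏ i, ∏ j ∈ Finset.Ioi i, (MvPolynomial.X j + MvPolynomial.X i)

theorem exists_diffProd_eq : ∃ T, diffProd n = sumProd n - 2 * T := by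
  suffices h : (2 : MvPolynomial (Fin n) ℤ) ∣ sumProd n - diffProd n by
    obtain ⟨T, hT⟩ := h
    exact ⟨T, by rw [← hT]; ring⟩
  rw [← Ideal.mem_span_singleton, ← Ideal.Quotient.mk_eq_mk_iff_sub_mem]
  simp only [sumProd, diffProd, map_prod]
  refine Finset.prod_congr rfl fun i _ => Finset.prod_congr rfl fun j _ => ?_
  rw [Ideal.Quotient.mk_eq_mk_iff_sub_mem, Ideal.mem_span_singleton]
  exact ⟨MvPolynomial.X i, by ring⟩

variable {n}

theorem prod_sub_comp_perm {R : Type*} [CommRing R] (v : Fin n → R) (σ : Equiv.Perm (Fin n)) :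
    ∏ i, ∏ j ∈ Finset.Ioi i, (v (σ j) - v (σ i)) =
      (Equiv.Perm.sign σ : ℤ) * ∏ i, ∏ j ∈ Finset.Ioi i, (v j - v i) := by
  have := Matrix.det_permute σ (Matrix.vandermonde v)
  rw [Matrix.det_vandermonde] at this
  rw [← this, ← Matrix.det_vandermonde (fun i => v (σ i))]
  rfl

theorem rename_diffProd (σ : Equiv.Perm (Fin n)) :
    MvPolynomial.rename σ (diffProd n) = (Equiv.Perm.sign σ : ℤ) * diffProd n := by
  simp only [diffProd, map_prod, map_sub, MvPolynomial.rename_X]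
  exact prod_sub_comp_perm MvPolynomial.X σ

theorem diffProd_ne_zero : diffProd n ≠ 0 := by
  rw [diffProd, ← Matrix.det_vandermonde, Matrix.det_vandermonde_ne_zero_iff]
  exact MvPolynomial.X_injective

theorem isSymmetric_sumProd : (sumProd n).IsSymmetric := by
  intro σ
  have h (v : Fin n → MvPolynomial (Fin n) ℤ) :
      (∏ i, ∏ j ∈ Finset.Ioi i, (v j + v i)) * ∏ i, ∏ j ∈ Finset.Ioi i, (v j - v i) =
        ∏ i, ∏ j ∈ Finset.Ioi i, (v j ^ 2 - v i ^ 2) := by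
    simp only [← Finset.prod_mul_distrib, ← sq_sub_sq]
  have h1 := h (fun i => MvPolynomial.X (σ i))
  rw [prod_sub_comp_perm MvPolynomial.X σ,
    prod_sub_comp_perm (fun i => (MvPolynomial.X i : MvPolynomial (Fin n) ℤ) ^ 2) σ, ← h] at h1
  have hs : ((Equiv.Perm.sign σ : ℤ) : MvPolynomial (Fin n) ℤ) ≠ 0 := by simp
  simp only [sumProd, map_prod, map_add, MvPolynomial.rename_X]
  refine mul_right_cancel₀ (mul_ne_zero hs (diffProd_ne_zero (n := n))) ?_
  rw [diffProd, h1]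
  ring

theorem isSymmetric_of_diffProd_eq {T : MvPolynomial (Fin n) ℤ}
    (hT : diffProd n = sumProd n - 2 * T) : (sumProd n * T - T ^ 2).IsSymmetric := by
  intro σ
  have h1 := rename_diffProd σ
  have hP := isSymmetric_sumProd (n := n) σ
  rw [hT] at h1
  simp only [map_sub, map_mul, map_pow, hP, map_ofNat] at h1 ⊢
  have h4 : (4 : MvPolynomial (Fin n) ℤ) ≠ 0 := by norm_num
  refine mul_left_cancel₀ h4 ?_
  have h2 := congrArg (· ^ 2) h1
  have hs : (((Equiv.Perm.sign σ : ℤ) : MvPolynomial (Fin n) ℤ)) ^ 2 = 1 := by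
    rcases Int.units_eq_one_or (Equiv.Perm.sign σ) with h | h <;> simp [h]
  simp only [mul_pow, hs] at h2
  linear_combination -h2

theorem rename_of_diffProd_eq {T : MvPolynomial (Fin n) ℤ}
    (hT : diffProd n = sumProd n - 2 * T) {σ : Equiv.Perm (Fin n)}
    (hσ : Equiv.Perm.sign σ = -1) : MvPolynomial.rename σ T = sumProd n - T := by
  have h1 := rename_diffProd σ
  have hP := isSymmetric_sumProd (n := n) σ
  rw [hT, hσ] at h1
  simp only [map_sub, map_mul, hP, map_ofNat] at h1
  have h2 : (2 : MvPolynomial (Fin n) ℤ) ≠ 0 := by norm_num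
  refine mul_left_cancel₀ h2 ?_
  push_cast at h1
  linear_combination -h1

end Symmetric

section Conjugates

variable {F K : Type*} [Field F] [Fintype F] [Field K] [Algebra F K] [Finite K]

theorem pow_card_pow_finrank (x : K) : x ^ Fintype.card F ^ Module.finrank F K = x := by
  have := DFunLike.congr_fun (pow_orderOf_eq_one (FiniteField.frobeniusAlgHom F K)) x
  rw [FiniteField.orderOf_frobeniusAlgHom, AlgHom.coe_pow, FiniteField.coe_frobeniusAlgHom,
    pow_iterate] at this
  exact this

theorem pow_card_pow_injective {x : K} (hx : Algebra.adjoin F {x} = ⊤) :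
    Function.Injective fun i : Fin (Module.finrank F K) => x ^ Fintype.card F ^ i.1 := by
  intro i j hij
  apply (FiniteField.bijective_frobeniusAlgHom_pow F K).1
  refine AlgHom.ext_of_adjoin_eq_top hx fun y hy => ?_
  rw [Set.mem_singleton_iff] at hy
  subst hy
  simpa [AlgHom.coe_pow, FiniteField.coe_frobeniusAlgHom, pow_iterate] using hij

end Conjugates

theorem prod_X_sub_C_eq_of_roots {K : Type*} [Field K] {n : ℕ} {h : K[X]} (hm : h.Monic)
    (hn : h.natDegree = n) {r : Fin n → K} (hr : Function.Injective r)
    (h0 : ∀ i, h.eval (r i) = 0) : h = ∏ i, (X - C (r i)) := by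
  have hP : (∏ i, (X - C (r i))).Monic := monic_prod_of_monic _ _ fun i _ => monic_X_sub_C _
  refine eq_of_monic_of_dvd_of_natDegree_le hP hm ?_ ?_
  · exact Finset.prod_dvd_of_coprime (fun i _ j _ hij => pairwise_coprime_X_sub_C hr hij)
      fun i _ => dvd_iff_isRoot.2 (h0 i)
  · rw [natDegree_prod_of_monic _ _ fun i _ => monic_X_sub_C _]
    simp [hn]

/-- An irreducible monic polynomial over a finite field factors over its stem field into linear
factors indexed by the Frobenius orbit of a root. -/
theorem exists_frobenius_orbit {F : Type} [Field F] [Fintype F] {h : F[X]} (hm : h.Monic)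
    (hirr : Irreducible h) {n : ℕ} (hn : h.natDegree = n) :
    ∃ (K : Type) (_ : Field K) (_ : Algebra F K) (r : Fin n → K), Function.Injective r ∧
      h.map (algebraMap F K) = ∏ i, (X - C (r i)) ∧
      ∀ i, r i ^ Fintype.card F = r (finRotate n i) := by
  have := Fact.mk hirr
  have hfin : Module.finrank F (AdjoinRoot h) = n := by
    rw [(AdjoinRoot.powerBasis hirr.ne_zero).finrank, AdjoinRoot.powerBasis_dim, hn]
  have : Module.Finite F (AdjoinRoot h) := (AdjoinRoot.powerBasis hirr.ne_zero).finite
  have : Finite (AdjoinRoot h) := Module.finite_of_finite F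
  set x := AdjoinRoot.root h
  have hx : Algebra.adjoin F {x} = ⊤ := AdjoinRoot.adjoinRoot_eq_top
  have hinj := pow_card_pow_injective hx
  have hpow := pow_card_pow_finrank (F := F) x
  rw [hfin] at hinj hpow
  refine ⟨AdjoinRoot h, inferInstance, inferInstance, fun i => x ^ Fintype.card F ^ i.1, hinj,
    prod_X_sub_C_eq_of_roots (hm.map _) (by rw [natDegree_map, hn]) hinj fun i => ?_, fun i => ?_⟩
  · have : x ^ Fintype.card F ^ i.1 = (FiniteField.frobeniusAlgHom F (AdjoinRoot h) ^ i.1) x := by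
      simp [AlgHom.coe_pow, FiniteField.coe_frobeniusAlgHom, pow_iterate]
    rw [this, eval_map_algebraMap, aeval_algHom_apply]
    simp [x]
  · obtain _ | n := n
    · exact i.elim0
    simp only [← pow_mul, ← pow_succ]
    by_cases hi : i = Fin.last n
    · subst hi
      simp [hpow]
    · rw [coe_finRotate_of_ne_last hi]

section Trinomial

variable {L : Type*} [Field L] {n m : ℕ} {c : L} {r : Fin n → L}

theorem prod_sub_sq_eq_prod_derivative {h : L[X]} (hr : h = ∏ i, (X - C (r i))) :
    ∃ e : ℕ, (∏ i, ∏ j ∈ Finset.Ioi i, (r j - r i)) ^ 2 =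
      (-1) ^ e * ∏ i, (derivative h).eval (r i) := by
  have h1 (i : Fin n) : (derivative h).eval (r i) = ∏ j ∈ {i}ᶜ, (r i - r j) := by
    rw [hr, derivative_prod_finset, eval_finsetSum, Finset.sum_eq_single i]
    · simp [eval_prod, Finset.compl_singleton]
    · intro j _ hj
      rw [eval_mul, eval_prod,
        Finset.prod_eq_zero (Finset.mem_erase.2 ⟨hj.symm, Finset.mem_univ i⟩) (by simp), zero_mul]
    · simp
  have h2 := Finset.prod_prod_Ioi_mul_eq_prod_prod_off_diag fun i j : Fin n => r j - r i
  refine ⟨∑ i : Fin n, (Finset.Ioi i).card, ?_⟩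
  simp only [h1]
  rw [← h2, ← Finset.prod_pow_eq_pow_sum, ← Finset.prod_mul_distrib, ← Finset.prod_pow]
  refine Finset.prod_congr rfl fun i _ => ?_
  rw [← Finset.prod_const, ← Finset.prod_mul_distrib, ← Finset.prod_pow]
  exact Finset.prod_congr rfl fun j _ => by ring

theorem prod_sub_sq_of_trinomial [CharZero L] (hn : Even n) (hm : Odd m) (hmn : m < n)
    (hcop : m.Coprime n) (hc : c ≠ 0) (hinj : Function.Injective r)
    (hr : X ^ n + X ^ m + C c = ∏ i, (X - C (r i))) :
    ∃ e : ℕ, (∏ i, ∏ j ∈ Finset.Ioi i, (r j - r i)) ^ 2 =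
      (-1) ^ e * (c ^ (m - 1) *
        ((-(m : L)) ^ m * ((n : L) - m) ^ (n - m) + n ^ n * c ^ (n - m))) := by
  obtain ⟨e, he⟩ := prod_sub_sq_eq_prod_derivative hr
  refine ⟨e, ?_⟩
  rw [he]
  congr 1
  have hodd : Odd (n - m) := Nat.Even.sub_odd hmn.le hn hm
  have hpow : n = m + (n - m) := by omega
  have hroot (i : Fin n) : r i ^ m * (r i ^ (n - m) + 1) = -c := by
    have h0 : (X ^ n + X ^ m + C c).eval (r i) = 0 := by
      rw [hr, eval_prod, Finset.prod_eq_zero (Finset.mem_univ i) (by simp)]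
    simp only [eval_add, eval_pow, eval_X, eval_C] at h0
    have : r i ^ n = r i ^ m * r i ^ (n - m) := by rw [← pow_add, ← hpow]
    linear_combination h0 - this
  have hr0 (i : Fin n) : r i ≠ 0 := by
    intro h
    have := hroot i
    rw [h, zero_pow hm.pos.ne', zero_mul] at this
    exact hc (neg_eq_zero.1 this.symm)
  have hprod : ∏ i, r i = c := by
    have h0 := congrArg (eval 0) hr
    simp only [eval_add, eval_pow, eval_X, eval_C, eval_prod, eval_sub, zero_sub,
      Finset.prod_neg, zero_pow hm.pos.ne', zero_pow (by omega : n ≠ 0)] at h0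
    simpa [hn.neg_one_pow] using h0.symm
  have hyinj : Function.Injective fun i => r i ^ (n - m) := by
    intro i j hij
    simp only at hij
    have h1 : r i ^ (n - m) + 1 ≠ 0 := by
      intro h
      have := hroot i
      rw [h, mul_zero] at this
      exact hc (neg_eq_zero.1 this.symm)
    have h2 : r i ^ m = r j ^ m := by
      have h3 := (hroot i).trans (hroot j).symm
      rw [← hij] at h3
      exact mul_right_cancel₀ h1 h3
    have hcop' : m.Coprime (n - m) := (Nat.coprime_sub_self_right hmn.le).2 hcop
    have h3 : (r i / r j) ^ m.gcd (n - m) = 1 := by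
      rw [pow_gcd_eq_one]
      exact ⟨by rw [div_pow, h2, div_self (pow_ne_zero _ (hr0 j))],
        by rw [div_pow, hij, div_self (pow_ne_zero _ (hr0 j))]⟩
    rw [hcop', pow_one, div_eq_one_iff_eq (hr0 j)] at h3
    exact hinj h3
  have hA : (X ^ m * (X + C 1) ^ (n - m) : L[X]).Monic :=
    (monic_X_pow m).mul ((monic_X_add_C 1).pow _)
  have hAdeg : (X ^ m * (X + C 1) ^ (n - m) : L[X]).natDegree = n := by
    rw [(monic_X_pow m).natDegree_mul ((monic_X_add_C 1).pow _), natDegree_X_pow,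
      (monic_X_add_C (1 : L)).natDegree_pow, natDegree_X_add_C]
    omega
  have hG := prod_X_sub_C_eq_of_roots (n := n) (h := X ^ m * (X + C 1) ^ (n - m) + C (c ^ (n - m)))
    (hA.add_of_left (degree_C_le.trans_lt
      (natDegree_pos_iff_degree_pos.1 (by omega))))
    (by rw [natDegree_add_C, hAdeg]) hyinj fun i => by
      simp only [eval_add, eval_mul, eval_pow, eval_X, eval_C]
      rw [← pow_mul, mul_comm (n - m), pow_mul, ← mul_pow, hroot, hodd.neg_pow]
      ring
  have hn0 : (n : L) ≠ 0 := by simp; omega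
  have hy : ∏ i, ((m : L) + n * r i ^ (n - m)) =
      (-(m : L)) ^ m * ((n : L) - m) ^ (n - m) + n ^ n * c ^ (n - m) := by
    have h0 := congrArg (fun p => (n : L) ^ n * eval (-(m : L) / n) p) hG
    simp only [eval_add, eval_mul, eval_pow, eval_X, eval_C, eval_prod, eval_sub] at h0
    have h1 : (n : L) ^ n * ∏ i, (-(m : L) / n - r i ^ (n - m)) =
        ∏ i, ((m : L) + n * r i ^ (n - m)) := by
      have : (n : L) ^ n = ∏ _i : Fin n, (n : L) := by simp
      have hneg : ∏ i, -((m : L) + n * r i ^ (n - m)) = ∏ i, ((m : L) + n * r i ^ (n - m)) := by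
        rw [Finset.prod_neg]
        simp [hn.neg_one_pow]
      rw [this, ← Finset.prod_mul_distrib, ← hneg]
      refine Finset.prod_congr rfl fun i _ => ?_
      field_simp
      ring
    rw [← h1, ← h0, mul_add]
    congr 1
    have h2 : (n : L) ^ n = n ^ m * n ^ (n - m) := by rw [← pow_add, ← hpow]
    rw [h2, mul_mul_mul_comm, ← mul_pow, ← mul_pow]
    congr 2 <;> field_simp
    ring
  have hd (i : Fin n) : (derivative (X ^ n + X ^ m + C c)).eval (r i) =
      r i ^ (m - 1) * (m + n * r i ^ (n - m)) := by
    have : r i ^ (n - 1) = r i ^ (m - 1) * r i ^ (n - m) := by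
      rw [← pow_add]
      congr 1
      have := hm.pos
      omega
    simp [this, derivative_X_pow]
    ring
  simp only [hd]
  rw [Finset.prod_mul_distrib, Finset.prod_pow, hprod, hy]

end Trinomial

theorem exists_eq_prod_X_sub_C {L : Type*} [Field L] [IsAlgClosed L] {h : L[X]} (hm : h.Monic)
    {n : ℕ} (hn : h.natDegree = n) : ∃ r : Fin n → L, h = ∏ i, (X - C (r i)) := by
  have hs := (IsAlgClosed.splits h).eq_prod_roots_of_monic hm
  have hcard : h.roots.toList.length = n := by
    rw [Multiset.length_toList, ← (IsAlgClosed.splits h).natDegree_eq_card_roots, hn]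
  subst hcard
  refine ⟨h.roots.toList.get, ?_⟩
  conv_lhs => rw [hs, ← Multiset.coe_toList h.roots]
  rw [Multiset.map_coe, Multiset.prod_coe, ← List.prod_ofFn]
  change _ = (List.ofFn ((fun x => X - C x) ∘ h.roots.toList.get)).prod
  rw [← List.map_ofFn, List.ofFn_get]

theorem exists_sq_add_eq_of_sq_modEq {a p s v : ℤ[X]} (ha : a.Monic) {u : ℤ} (hu : Odd u)
    (h : p ^ 2 - 4 * s = C u * a ^ 2 + 16 * v) :
    ∃ (k : ℤ) (w z : ℤ[X]), p = a + 2 * w ∧ s = C k * a ^ 2 + a * w + w ^ 2 + 2 * z := by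
  obtain ⟨l, rfl⟩ := hu
  have hp : (2 : ℤ[X]) ∣ p - a := by
    have h2 : (2 : ℤ[X]) ∣ (p - a) ^ 2 := by
      refine ⟨2 * s + C l * a ^ 2 + 8 * v + a ^ 2 - p * a, ?_⟩
      simp only [C_add, C_mul, C_1, map_ofNat] at h
      linear_combination h
    have hprime : Prime (2 : ℤ[X]) := by
      have := Polynomial.prime_C_iff.2 Int.prime_two
      simpa using this
    exact hprime.dvd_of_dvd_pow h2
  obtain ⟨w, hw⟩ := hp
  have hp : p = a + 2 * w := by linear_combination hw
  subst hp
  have h4 : 4 * s = C (-2 * l) * a ^ 2 + 4 * (a * w + w ^ 2 - 4 * v) := by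
    simp only [C_add, C_mul, C_1, map_ofNat, C_neg] at h ⊢
    linear_combination -h
  have hl : (2 : ℤ) ∣ l := by
    have h5 : (C 4 : ℤ[X]) ∣ C (-2 * l) * a ^ 2 := by
      refine ⟨s - (a * w + w ^ 2 - 4 * v), ?_⟩
      simp only [map_ofNat]
      linear_combination -h4
    rw [C_dvd_iff_dvd_coeff] at h5
    have h6 := h5 (a ^ 2).natDegree
    rw [coeff_C_mul, (ha.pow 2).coeff_natDegree] at h6
    omega
  obtain ⟨k, rfl⟩ := hl
  refine ⟨-k, w, -2 * v, rfl, ?_⟩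
  have h0 : (4 : ℤ[X]) ≠ 0 := by norm_num
  refine mul_left_cancel₀ h0 ?_
  simp only [C_mul, C_neg, map_ofNat] at h4 ⊢
  linear_combination h4

theorem aeval_diffProd {B : Type*} [CommRing B] {n : ℕ} (r : Fin n → B) :
    MvPolynomial.aeval r (diffProd n) = ∏ i, ∏ j ∈ Finset.Ioi i, (r j - r i) := by
  simp [diffProd]

theorem natDegree_trinomial {R : Type*} [CommRing R] [Nontrivial R] {n m : ℕ} (hmn : m < n)
    (c : R) : (X ^ n + X ^ m + C c : R[X]).natDegree = n := by
  rw [natDegree_add_C, natDegree_add_eq_left_of_natDegree_lt] <;> simp [hmn]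

theorem monic_trinomial {R : Type*} [CommRing R] [Nontrivial R] {n m : ℕ} (hmn : m < n)
    (c : R) : (X ^ n + X ^ m + C c : R[X]).Monic := by
  rw [Monic, leadingCoeff, natDegree_trinomial hmn]
  have hn0 : n ≠ 0 := by omega
  simp [coeff_X_pow, coeff_C, hmn.ne', hn0]

/-- In characteristic two, Berlekamp's discriminant of a trinomial does not depend on its constant
term, up to an element of the form `x ^ 2 + x`. -/
theorem exists_sumProd_eq {n m : ℕ} (hn : Even n) (hm : Odd m) (hmn : m < n)
    (hcop : m.Coprime n) (hn4 : 4 ≤ n) {T : MvPolynomial (Fin n) ℤ}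
    (hT : diffProd n = sumProd n - 2 * T) {K : Type} [Field K] [CharP K 2] {c : K} {r : Fin n → K}
    (hinj : Function.Injective r) (hr : X ^ n + X ^ m + C c = ∏ i, (X - C (r i))) :
    ∃ (k : ℤ) (w : ℤ[X]), MvPolynomial.aeval r (sumProd n) = c ^ ((m - 1) / 2) ∧
      MvPolynomial.aeval r (sumProd n * T - T ^ 2) =
        k * (c ^ ((m - 1) / 2)) ^ 2 + c ^ ((m - 1) / 2) * aeval c w + aeval c w ^ 2 := by
  have h2 : (2 : K) = 0 := CharTwo.two_eq_zero
  let H : ℤ[X][X] := X ^ n + X ^ m + C X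
  obtain ⟨p, hp⟩ := exists_aeval_eq_map_of_isSymmetric H (isSymmetric_sumProd (n := n))
  obtain ⟨s, hs⟩ := exists_aeval_eq_map_of_isSymmetric H (isSymmetric_of_diffProd_eq hT)
  have hdisc {B : Type} [CommRing B] (θ : ℤ[X] →+* B) (r : Fin n → B)
      (h : H.map θ = ∏ i, (X - C (r i))) :
      (∏ i, ∏ j ∈ Finset.Ioi i, (r j - r i)) ^ 2 = θ (p ^ 2 - 4 * s) := by
    rw [← aeval_diffProd, map_sub, map_mul, map_pow, map_ofNat, ← hp θ r h, ← hs θ r h, hT]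
    simp only [map_sub, map_mul, map_pow, map_ofNat]
    ring
  have hHK : H.map (aeval c).toRingHom = ∏ i, (X - C (r i)) := by
    rw [← hr]
    simp [H]
  let L := AlgebraicClosure (FractionRing ℤ[X])
  have hθ : Function.Injective (algebraMap ℤ[X] L) := by
    rw [IsScalarTower.algebraMap_eq ℤ[X] (FractionRing ℤ[X]) L]
    exact (algebraMap (FractionRing ℤ[X]) L).injective.comp (IsFractionRing.injective _ _)
  have : CharZero L := ⟨fun a b hab => by
    rw [← map_natCast (algebraMap ℤ[X] L), ← map_natCast (algebraMap ℤ[X] L)] at hab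
    exact_mod_cast hθ hab⟩
  have hHL : H.map (algebraMap ℤ[X] L) = X ^ n + X ^ m + C (algebraMap ℤ[X] L X) := by simp [H]
  obtain ⟨q, hq⟩ := exists_eq_prod_X_sub_C (monic_trinomial hmn (algebraMap ℤ[X] L X))
    (natDegree_trinomial hmn _)
  have hDL := hdisc _ q (hHL.trans hq)
  have hD0 : p ^ 2 - 4 * s ≠ 0 := by
    intro h0
    have h := hdisc _ r hHK
    rw [h0, map_zero, ← Matrix.det_vandermonde, sq_eq_zero_iff] at h
    exact Matrix.det_vandermonde_ne_zero_iff.2 hinj h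
  have hqinj : Function.Injective q := by
    rw [← Matrix.det_vandermonde_ne_zero_iff, Matrix.det_vandermonde,
      ← pow_ne_zero_iff two_ne_zero, hDL]
    exact (map_ne_zero_iff _ hθ).2 hD0
  obtain ⟨e, he⟩ := prod_sub_sq_of_trinomial hn hm hmn hcop
    ((map_ne_zero_iff _ hθ).2 X_ne_zero) hqinj hq
  have hodd : Odd (n - m) := Nat.Even.sub_odd hmn.le hn hm
  obtain ⟨b, rfl⟩ := hn
  have hpX : p ^ 2 - 4 * s =
      C ((-1) ^ e * ((-(m : ℤ)) ^ m * (((b + b : ℕ) : ℤ) - m) ^ (b + b - m))) *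
        (X ^ ((m - 1) / 2)) ^ 2 + 16 * ((-1) ^ e * X ^ (m - 1) *
          ((b : ℤ[X]) ^ 4 * ((b + b : ℕ) : ℤ[X]) ^ (b + b - 4) * X ^ (b + b - m))) := by
    apply hθ
    rw [← hDL, he]
    have h1 : (m - 1) / 2 * 2 = m - 1 := by obtain ⟨l, rfl⟩ := hm; omega
    have h3 : ((b + b : ℕ) : L) ^ (b + b) =
        16 * (b : L) ^ 4 * ((b + b : ℕ) : L) ^ (b + b - 4) := by
      have : ((b + b : ℕ) : L) ^ (b + b) =
          ((b + b : ℕ) : L) ^ 4 * ((b + b : ℕ) : L) ^ (b + b - 4) := by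
        rw [← pow_add, Nat.add_sub_cancel' hn4]
      rw [this]
      push_cast
      ring
    have h16 : algebraMap ℤ[X] L 16 = 16 := map_ofNat _ 16
    rw [h3, ← pow_mul, h1]
    simp [h16]
    ring
  obtain ⟨k, w, z, rfl, rfl⟩ := exists_sq_add_eq_of_sq_modEq (monic_X_pow _) (by
    refine (Odd.pow (by decide)).mul ((Odd.pow ?_).mul (Odd.pow ?_))
    · rw [Int.odd_iff]; rw [Nat.odd_iff] at hm; omega
    · rw [Int.odd_iff]; rw [Nat.odd_iff] at hm; omega) hpX
  have h0 : aeval c (2 : ℤ[X]) = 0 := by rw [map_ofNat, h2]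
  refine ⟨k, w, ?_, ?_⟩
  · rw [hp _ r hHK]
    simp [h0]
  · rw [hs _ r hHK]
    simp [h0]

/-- A Stickelberger type parity argument. -/
theorem not_irreducible_trinomial_of_coprime {F : Type} [Field F] [Fintype F] [CharP F 2] {d : ℕ}
    (hF : Fintype.card F = 4 ^ d) {n m : ℕ} (hn : Even n) (hm : Odd m) (hmn : m < n)
    (hcop : m.Coprime n) (hn4 : 4 ≤ n) (c : F) : ¬ Irreducible (X ^ n + X ^ m + C c) := by
  intro hirr
  obtain ⟨K, _, _, r, hinj, hr, hfrob⟩ := exists_frobenius_orbit (monic_trinomial hmn c) hirr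
    (natDegree_trinomial hmn c)
  have : CharP K 2 := charP_of_injective_algebraMap (algebraMap F K).injective 2
  have h2 : (2 : K) = 0 := CharTwo.two_eq_zero
  have hc : c ≠ 0 := by
    rintro rfl
    have hX : X ∣ X ^ n + X ^ m + C (0 : F) := by
      rw [X_dvd_iff]
      have hn0 : 0 ≠ n := by omega
      simp [coeff_X_pow, hm.pos.ne, hn0]
    have := natDegree_trinomial hmn (0 : F)
    rw [← natDegree_eq_of_degree_eq (degree_eq_degree_of_associated
      (irreducible_X.associated_of_dvd hirr hX)), natDegree_X] at this
    omega
  obtain ⟨T, hT⟩ := exists_diffProd_eq n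
  obtain ⟨k, w, hP, hS⟩ := exists_sumProd_eq hn hm hmn hcop hn4 hT hinj
    (c := algebraMap F K c) (by rw [← hr]; simp)
  set a := algebraMap F K c ^ ((m - 1) / 2) with ha
  have ha0 : a ≠ 0 := pow_ne_zero _ ((map_ne_zero_iff _ (algebraMap F K).injective).2 hc)
  set t := MvPolynomial.aeval r T
  simp only [map_sub, map_mul, map_pow, hP] at hS
  set y : K := aeval (algebraMap F K c) w with hy
  -- Frobenius acts on the root of the Artin-Schreier equation as an odd permutation does.
  let φ := FiniteField.frobeniusAlgHom F K
  have htq : φ t = a - t := by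
    have h1 : φ t = MvPolynomial.aeval (fun i => φ (r i)) T :=
      MvPolynomial.comp_aeval_apply (φ := φ.toRingHom.toIntAlgHom) r T
    have h3 : (fun i => φ (r i)) = r ∘ finRotate n := funext hfrob
    rw [h1, h3, ← MvPolynomial.aeval_rename, rename_of_diffProd_eq hT, map_sub, hP]
    rw [sign_finRotate, Odd.neg_one_pow]
    exact Nat.Even.sub_odd (by omega) hn odd_one
  have haq : φ a = a := by rw [ha, ← map_pow, AlgHom.commutes]
  have hyq : φ y = y := by
    rw [hy, aeval_algebraMap_apply, AlgHom.commutes]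
  set τ := (t + y) / a with hτ
  have hτφ : φ τ = τ + 1 := by
    rw [hτ, map_div₀, map_add, htq, haq, hyq]
    field_simp
    linear_combination -t * h2
  have hτ2 : τ ^ 2 = τ + k := by
    rw [hτ]
    field_simp
    linear_combination -hS - (k * a ^ 2 - t * y + y * a) * h2
  have hk : (k : K) ^ 2 = k := by
    rcases Int.even_or_odd' k with ⟨l, rfl | rfl⟩ <;> simp [h2]
  have hτ4 : τ ^ 4 = τ := by
    linear_combination (τ ^ 2 + τ + k + 1) * hτ2 + hk + (τ * k + k) * h2
  have hτq (d : ℕ) : τ ^ 4 ^ d = τ := by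
    induction d with
    | zero => simp
    | succ d ih => rw [pow_succ, pow_mul, ih, hτ4]
  have h1 : φ τ = τ := by
    change τ ^ Fintype.card F = τ
    rw [hF, hτq]
  rw [hτφ] at h1
  simp at h1

/-- A root of an irreducible composition `f.comp g` generates an extension of degree `g.natDegree`
over the stem field of `f`. -/
theorem irreducible_map_sub_C_root {K : Type*} [Field K] {f g : K[X]} (hf : f.Monic) (hg : g.Monic)
    (hg0 : g.natDegree ≠ 0) (hirr : Irreducible f) (h : Irreducible (f.comp g)) :
    Irreducible (g.map (algebraMap K (AdjoinRoot f)) - C (AdjoinRoot.root f)) := by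
  have := Fact.mk hirr
  have : FiniteDimensional K (AdjoinRoot f) := (AdjoinRoot.powerBasis hirr.ne_zero).finite
  set G := g.map (algebraMap K (AdjoinRoot f)) - C (AdjoinRoot.root f) with hG
  have hGdeg : G.natDegree = g.natDegree := by rw [hG, natDegree_sub_C, natDegree_map]
  have hGm : G.Monic := by
    refine (hg.map _).sub_of_left (degree_C_le.trans_lt ?_)
    rw [← natDegree_pos_iff_degree_pos, natDegree_map]
    omega
  let L := AlgebraicClosure (AdjoinRoot f)
  obtain ⟨x, hx⟩ := IsAlgClosed.exists_aeval_eq_zero L G (by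
    intro h0
    have := natDegree_eq_zero_iff_degree_le_zero.2 h0.le
    omega)
  have hxint : IsIntegral (AdjoinRoot f) x := ⟨G, hGm, hx⟩
  have hgx : aeval x g = algebraMap (AdjoinRoot f) L (AdjoinRoot.root f) := by
    rw [hG, map_sub, aeval_map_algebraMap, aeval_C, sub_eq_zero] at hx
    exact hx
  have hmin : minpoly K x = f.comp g := by
    refine (minpoly.eq_of_irreducible_of_monic h ?_ (hf.comp hg hg0)).symm
    rw [aeval_comp, hgx, aeval_algebraMap_apply, AdjoinRoot.aeval_eq, AdjoinRoot.mk_self, map_zero]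
  have hle : g.natDegree ≤ (minpoly (AdjoinRoot f) x).natDegree := by
    have hfin : Module.finrank K (AdjoinRoot f) = f.natDegree := by
      rw [(AdjoinRoot.powerBasis hirr.ne_zero).finrank, AdjoinRoot.powerBasis_dim]
    let E := IntermediateField.adjoin (AdjoinRoot f) {x}
    have : FiniteDimensional (AdjoinRoot f) E := IntermediateField.adjoin.finiteDimensional hxint
    have : FiniteDimensional K E := FiniteDimensional.trans K (AdjoinRoot f) E
    have h1 := minpoly.natDegree_le (A := K) (IntermediateField.AdjoinSimple.gen (AdjoinRoot f) x)
    have : IsScalarTower K E L := IsScalarTower.of_algebraMap_eq fun a => by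
      rw [IsScalarTower.algebraMap_apply K (AdjoinRoot f) L,
        IsScalarTower.algebraMap_apply K (AdjoinRoot f) E]
      rfl
    have h2 : minpoly K (IntermediateField.AdjoinSimple.gen (AdjoinRoot f) x) = minpoly K x :=
      (minpoly.algebraMap_eq (algebraMap E L).injective _).symm
    rw [h2, hmin, natDegree_comp, ← Module.finrank_mul_finrank K (AdjoinRoot f) E, hfin,
      IntermediateField.adjoin.finrank hxint] at h1
    exact Nat.le_of_mul_le_mul_left h1 hirr.natDegree_pos
  rw [eq_of_monic_of_dvd_of_natDegree_le (minpoly.monic hxint) hGm (minpoly.dvd _ _ hx)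
    (by rw [hGdeg]; exact hle)]
  exact minpoly.irreducible hxint

/-- A quadratic Artin-Schreier polynomial over a finite field splits if its constant term has
trace zero. -/
theorem not_irreducible_of_trace_eq_zero {F : Type} [Field F] [Fintype F] [Algebra (ZMod 2) F]
    {c : F} (hc : Algebra.trace (ZMod 2) F c = 0) : ¬ Irreducible (X ^ 2 + X ^ 1 + C c) := by
  intro hirr
  obtain ⟨K, _, _, r, hinj, hr, hfrob⟩ := exists_frobenius_orbit (monic_trinomial one_lt_two c)
    hirr (natDegree_trinomial one_lt_two c)
  have : CharP F 2 := charP_of_injective_algebraMap (algebraMap (ZMod 2) F).injective 2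
  have : CharP K 2 := charP_of_injective_algebraMap (algebraMap F K).injective 2
  have h2 : (2 : K) = 0 := CharTwo.two_eq_zero
  have hroot : r 0 ^ 2 = r 0 + algebraMap F K c := by
    have h := congrArg (eval (r 0)) hr
    rw [eval_prod, Finset.prod_eq_zero (Finset.mem_univ 0) (by simp)] at h
    simp at h
    linear_combination h - (r 0 + algebraMap F K c) * h2
  have hpow (i : ℕ) : r 0 ^ 2 ^ i = r 0 + ∑ j ∈ Finset.range i, algebraMap F K c ^ 2 ^ j := by
    induction i with
    | zero => simp
    | succ i ih =>
      rw [pow_succ', pow_mul, hroot, add_pow_char_pow, ih, Finset.sum_range_succ]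
      ring
  have hcard := Module.card_eq_pow_finrank (K := ZMod 2) (V := F)
  have htr := FiniteField.algebraMap_trace_eq_sum_pow (ZMod 2) F c
  rw [hc, map_zero] at htr
  have hfix := hfrob 0
  simp only [ZMod.card, Nat.card_eq_fintype_card] at hcard htr
  rw [hcard, hpow] at hfix
  simp only [← map_pow, ← map_sum, ← htr, map_zero, add_zero] at hfix
  exact absurd (hinj hfix) (by decide)

theorem not_irreducible_comp_comp_quadratic {f : (ZMod 2)[X]} (hf : f = X ^ 2 + X ^ 1 + C 1) :
    ¬ Irreducible (f.comp (f.comp f)) := by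
  have h2 : (2 : (ZMod 2)[X]) = 0 := CharTwo.two_eq_zero
  have h : f.comp (f.comp f) =
      (X ^ 4 + (X ^ 3 + C 1)) * (X ^ 4 + (X ^ 3 + X ^ 2 + X + C 1)) := by
    subst hf
    simp only [add_comp, pow_comp, X_comp, C_1, one_comp]
    linear_combination (6 + 10 * X + 18 * X ^ 2 + 18 * X ^ 3 + 16 * X ^ 4 + 10 * X ^ 5 +
      5 * X ^ 6 + X ^ 7) * h2
  intro hirr
  rw [h] at hirr
  rcases hirr.isUnit_or_isUnit rfl with h | h
  · have h := natDegree_eq_zero_of_isUnit h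
    have : (X ^ 4 + (X ^ 3 + C 1) : (ZMod 2)[X]).natDegree = 4 := by compute_degree!
    omega
  · have h := natDegree_eq_zero_of_isUnit h
    have : (X ^ 4 + (X ^ 3 + X ^ 2 + X + C 1) : (ZMod 2)[X]).natDegree = 4 := by compute_degree!
    omega

/-- An irreducible trinomial of even degree over `ZMod 2` has middle exponent odd and constant
term one. -/
theorem exists_eq_of_card_support_eq_three {f : (ZMod 2)[X]} (htri : f.support.card = 3)
    (heven : Even f.natDegree) (hirr : Irreducible f) :
    ∃ n m : ℕ, m < n ∧ Even n ∧ Odd m ∧ f = X ^ n + X ^ m + C 1 := by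
  obtain ⟨k, m, n, hkm, hmn, x, y, z, hx, hy, hz, hf⟩ := card_support_eq_three.1 htri
  have hone : ∀ a : ZMod 2, a ≠ 0 → a = 1 := by decide
  rw [hone x hx, hone y hy, hone z hz, C_1, one_mul, one_mul, one_mul] at hf
  have hn : f.natDegree = n := by
    rw [hf, natDegree_add_eq_right_of_natDegree_lt, natDegree_X_pow]
    rw [natDegree_add_eq_right_of_natDegree_lt] <;> simp [hkm, hmn]
  rw [hn] at heven
  have hk : k = 0 := by
    by_contra hk
    have hX : X ∣ f := by
      have h0 (l : ℕ) (hl : l ≠ 0) : (X : (ZMod 2)[X]) ∣ X ^ l := dvd_pow_self X hl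
      rw [hf]
      exact ((h0 k hk).add (h0 m (by omega))).add (h0 n (by omega))
    have h1 := natDegree_eq_of_degree_eq (degree_eq_degree_of_associated
      (irreducible_X.associated_of_dvd hirr hX))
    rw [hn, natDegree_X] at h1
    omega
  subst hk
  refine ⟨n, m, hmn, heven, ?_, by rw [hf, C_1]; ring⟩
  by_contra hm
  obtain ⟨a, rfl⟩ := Nat.not_odd_iff_even.1 hm
  obtain ⟨b, rfl⟩ := heven
  have hsq : f = (1 + X ^ a + X ^ b) ^ 2 := by
    rw [hf, add_pow_char, add_pow_char]
    ring
  rw [hsq] at hirr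
  exact not_irreducible_pow (by decide) hirr

theorem trace_root_eq_zero {n m : ℕ} (hmn : m < n) (hmn' : m ≠ n - 1) (hn2 : 2 ≤ n)
    (hirr : Irreducible (X ^ n + X ^ m + C 1 : (ZMod 2)[X])) :
    Algebra.trace (ZMod 2) (AdjoinRoot (X ^ n + X ^ m + C 1 : (ZMod 2)[X]))
      (AdjoinRoot.root (X ^ n + X ^ m + C 1 : (ZMod 2)[X])) = 0 := by
  have := Fact.mk hirr
  have h := (AdjoinRoot.powerBasis hirr.ne_zero).trace_gen_eq_nextCoeff_minpoly
  rw [AdjoinRoot.powerBasis_gen, AdjoinRoot.minpoly_root hirr.ne_zero,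
    (monic_trinomial hmn (1 : ZMod 2)).leadingCoeff, inv_one, C_1, mul_one] at h
  rw [← C_1, nextCoeff_of_natDegree_pos (by rw [natDegree_trinomial hmn]; omega),
    natDegree_trinomial hmn] at h
  rw [h]
  have h1 : n - 1 ≠ n := by omega
  have h2 : n - 1 ≠ 0 := by omega
  simp only [coeff_add, coeff_X_pow, coeff_C, h1, h2, hmn'.symm, if_false, add_zero, neg_zero]

theorem trinomial_even_degree_not_stable
    (f : Polynomial (ZMod 2))
    (htri : f.support.card = 3)
    (heven : Even f.natDegree) :
    ¬ (∀ k : ℕ, 1 ≤ k → Irreducible ((fun q => f.comp q)^[k] (X : Polynomial (ZMod 2)))) := by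
  intro h
  have h1 : Irreducible f := by simpa using h 1 le_rfl
  have h2 : Irreducible (f.comp f) := by simpa using h 2 (by norm_num)
  have h3 : Irreducible (f.comp (f.comp f)) := by simpa using h 3 (by norm_num)
  clear h
  obtain ⟨n, m, hmn, hn, hm, hf⟩ := exists_eq_of_card_support_eq_three htri heven h1
  clear htri heven
  have hfm : f.Monic := hf ▸ monic_trinomial hmn 1
  have hfn : f.natDegree = n := hf ▸ natDegree_trinomial hmn 1
  have := Fact.mk h1
  let F := AdjoinRoot f
  have : Module.Finite (ZMod 2) F := (AdjoinRoot.powerBasis h1.ne_zero).finite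
  have : Finite F := Module.finite_of_finite (ZMod 2)
  have : Fintype F := Fintype.ofFinite F
  have : CharP F 2 := charP_of_injective_algebraMap (algebraMap (ZMod 2) F).injective 2
  have hfin : Module.finrank (ZMod 2) F = n := by
    rw [(AdjoinRoot.powerBasis h1.ne_zero).finrank, AdjoinRoot.powerBasis_dim, hfn]
  let α : F := AdjoinRoot.root f
  have hg := irreducible_map_sub_C_root hfm hfm (by omega) h1 h2
  have hexp : f.map (algebraMap (ZMod 2) F) - C α = expand F (m.gcd n)
      (X ^ (n / m.gcd n) + X ^ (m / m.gcd n) + C (1 - α)) := by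
    simp only [hf, map_add, map_pow, expand_X, expand_C, ← pow_mul, map_sub, Polynomial.map_add,
      Polynomial.map_pow, map_X, map_one, Polynomial.map_one, Nat.mul_div_cancel' (Nat.gcd_dvd_left m n),
      Nat.mul_div_cancel' (Nat.gcd_dvd_right m n)]
    ring
  have hD := Nat.gcd_pos_of_pos_left n hm.pos
  rw [hexp] at hg
  replace hg := of_irreducible_expand hD.ne' hg
  have hcop : (m / m.gcd n).Coprime (n / m.gcd n) := Nat.coprime_div_gcd_div_gcd hD
  have hmD := Nat.div_mul_cancel (Nat.gcd_dvd_left m n)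
  have hnD := Nat.div_mul_cancel (Nat.gcd_dvd_right m n)
  generalize m.gcd n = D at *
  generalize m / D = M at *
  generalize n / D = N at *
  have hMD : Odd M ∧ Odd D := by rwa [← Nat.odd_mul, hmD]
  have hN : Even N := by
    rw [← hnD, Nat.even_mul] at hn
    exact hn.resolve_right (Nat.not_even_iff_odd.2 hMD.2)
  have hMN : M < N := by
    rw [← hmD, ← hnD] at hmn
    exact lt_of_mul_lt_mul_right hmn (Nat.zero_le D)
  by_cases hN4 : 4 ≤ N
  · obtain ⟨d, rfl⟩ := hn
    refine not_irreducible_trinomial_of_coprime (d := d) ?_ hN hMD.1 hMN hcop hN4 _ hg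
    rw [Module.card_eq_pow_finrank (K := ZMod 2) (V := F), hfin, ZMod.card, ← two_mul, pow_mul]
    norm_num
  · have hM := hMD.1.pos
    have hN2 : N = 2 := by
      obtain ⟨b, rfl⟩ := hN
      omega
    have hM1 : M = 1 := by omega
    subst hN2 hM1
    by_cases hm1 : m = 1
    · exact not_irreducible_comp_comp_quadratic (by rw [hf]; congr <;> omega) h3
    · refine not_irreducible_of_trace_eq_zero ?_ hg
      rw [map_sub]
      have ht : Algebra.trace (ZMod 2) F α = 0 := by
        subst hf
        exact trace_root_eq_zero hmn (by omega) (by omega) h1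
      have h1t := Algebra.trace_algebraMap_of_basis (Module.finBasis (ZMod 2) F) 1
      rw [map_one] at h1t
      rw [ht, h1t]
      simp only [Fintype.card_fin, hfin]
      obtain ⟨b, rfl⟩ := hn
      simp [← two_mul, show (2 : ZMod 2) = 0 from rfl]
end

section
/- Let n > 1 and let s be an odd integer with 0 < s < 2n. Suppose f(x) = x^(2n) + x^(2n−s) + 1 is irreducible over F_2. Then the second iterate f ∘ f is reducible over F_2. -/
open Polynomial IntermediateField

universe u

theorem prod_range_pairs {M : Type*} [CommMonoid M] (a : ℕ → ℕ → M) (N : ℕ) :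
    ∏ i ∈ Finset.range N, ∏ j ∈ Finset.range N, a i j =
      (∏ i ∈ Finset.range N, a i i) *
        ∏ j ∈ Finset.range N, ∏ i ∈ Finset.range j, a i j * a j i := by
  induction N with
  | zero => simp
  | succ N ih =>
    simp only [Finset.prod_range_succ _ N, Finset.prod_mul_distrib] at ih ⊢
    rw [ih]
    ac_rfl

theorem sum_range_pairs_shift {L : Type*} [Field L] [CharP L 2] {N : ℕ} (hN : Even N) (hpos : 0 < N)
    (r : ℕ → L) (hper : r N = r 0) (hne : ∀ i, 0 < i → i < N → r i ≠ r 0) :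
    ∑ j ∈ Finset.range N, ∑ i ∈ Finset.range j, r (i + 1) / (r (i + 1) + r (j + 1)) =
      ∑ j ∈ Finset.range N, ∑ i ∈ Finset.range j, r i / (r i + r j) + 1 := by
  have key (j : ℕ) : ∑ i ∈ Finset.range j, r (i + 1) / (r (i + 1) + r (j + 1)) =
      ∑ i ∈ Finset.range (j + 1), r i / (r i + r (j + 1)) - r 0 / (r 0 + r (j + 1)) := by
    rw [Finset.sum_range_succ']
    ring
  have hsum : ∑ j ∈ Finset.range N, ∑ i ∈ Finset.range (j + 1), r i / (r i + r (j + 1)) =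
      ∑ j ∈ Finset.range N, ∑ i ∈ Finset.range j, r i / (r i + r j) +
        ∑ i ∈ Finset.range N, r i / (r i + r N) := by
    rw [← Finset.sum_range_succ (fun j => ∑ i ∈ Finset.range j, r i / (r i + r j)) N,
      Finset.sum_range_succ' (fun j => ∑ i ∈ Finset.range j, r i / (r i + r j)) N]
    simp
  simp_rw [key]
  rw [Finset.sum_sub_distrib, hsum, add_sub_assoc]
  congr 1
  obtain ⟨m, rfl⟩ := Nat.exists_eq_succ_of_ne_zero hpos.ne'
  rw [Finset.sum_range_succ', Finset.sum_range_succ, hper, CharTwo.add_self_eq_zero, div_zero,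
    add_zero, add_zero, ← Finset.sum_sub_distrib]
  have hone : ∀ i ∈ Finset.range m,
      r (i + 1) / (r (i + 1) + r 0) - r 0 / (r 0 + r (i + 1)) = 1 := by
    intro i hi
    have h := hne (i + 1) (by omega) (by simpa using hi)
    have h' : r (i + 1) + r 0 ≠ 0 := by rwa [Ne, CharTwo.add_eq_zero]
    rw [add_comm (r 0), ← sub_div, CharTwo.sub_eq_add, div_self h']
  rw [Finset.sum_congr rfl hone]
  have hm : Odd m := by
    rcases Nat.even_or_odd m with h | h
    · exact absurd hN (by simpa using h.add_one)
    · exact h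
  obtain ⟨t, rfl⟩ := hm
  simp [CharTwo.two_eq_zero]

theorem exists_prod_X_add_one_add_eq {ι R : Type*} [CommRing R] (S : Finset ι) (β : ι → R) :
    ∃ T : R[X], ∏ i ∈ S, (X + 1 + X ^ 2 * C (β i)) =
      (X + 1) ^ S.card + X ^ 2 * C (∑ i ∈ S, β i) + X ^ 3 * T := by
  classical
  induction S using Finset.induction_on with
  | empty => exact ⟨0, by simp⟩
  | insert a S ha ih =>
    obtain ⟨T, hT⟩ := ih
    obtain ⟨U, hU⟩ : (X : R[X]) ∣ (X + 1) ^ S.card - 1 := by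
      have h := sub_dvd_pow_sub_pow (X + 1 : R[X]) 1 S.card
      rwa [one_pow, add_sub_cancel_right] at h
    rw [Finset.prod_insert ha, hT, Finset.card_insert_of_notMem ha, Finset.sum_insert ha, C_add]
    refine ⟨C (∑ i ∈ S, β i) + (X + 1) * T + C (β a) * U +
      X * C (β a) * C (∑ i ∈ S, β i) + X ^ 2 * C (β a) * T, ?_⟩
    linear_combination X ^ 2 * C (β a) * hU

theorem prod_X_sub_C_eq_of_injOn {L : Type*} [Field L] {N : ℕ} {g : L[X]} (hg : g.Monic)
    (hdeg : g.natDegree = N) (r : ℕ → L) (hinj : Set.InjOn r (Finset.range N))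
    (hroot : ∀ i < N, g.eval (r i) = 0) :
    ∏ i ∈ Finset.range N, (X - C (r i)) = g := by
  have hm : (∏ i ∈ Finset.range N, (X - C (r i))).Monic := monic_prod_X_sub_C _ _
  have hd : (∏ i ∈ Finset.range N, (X - C (r i))).natDegree = N := by
    simp
  refine eq_of_degree_le_of_eval_index_eq (Finset.range N) hinj ?_ ?_ ?_ fun i hi => ?_
  · rw [degree_eq_natDegree hm.ne_zero, hd, Finset.card_range]
  · rw [degree_eq_natDegree hm.ne_zero, degree_eq_natDegree hg.ne_zero, hd, hdeg]
  · rw [hm.leadingCoeff, hg.leadingCoeff]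
  · rw [hroot i (by simpa using hi), eval_prod]
    exact Finset.prod_eq_zero hi (by simp)

theorem prod_add_mul_C {L : Type*} [Field L] {k s : ℕ} (u : ℕ → L) (c : L)
    (h : ∏ i ∈ Finset.range (k + s), (X + C (u i)) = X ^ k * (X + 1) ^ s + C c)
    (P Q : L[X]) (hQ : Q ≠ 0) :
    ∏ i ∈ Finset.range (k + s), (P + Q * C (u i)) =
      P ^ k * (P + Q) ^ s + C c * Q ^ (k + s) := by
  apply IsFractionRing.injective L[X] (RatFunc L)
  set φ := algebraMap L[X] (RatFunc L)
  have hQ' : φ Q ≠ 0 := by simpa [φ] using hQ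
  have h' := congrArg (eval₂ (φ.comp C) (φ P / φ Q)) h
  simp only [eval₂_finsetProd, eval₂_add, eval₂_mul, eval₂_pow, eval₂_X, eval₂_C,
    eval₂_one, RingHom.comp_apply] at h'
  have hfac (i : ℕ) : φ (P + Q * C (u i)) = φ Q * (φ P / φ Q + φ (C (u i))) := by
    rw [map_add, map_mul, mul_add, mul_div_cancel₀ _ hQ']
  rw [map_prod, Finset.prod_congr rfl fun i _ => hfac i, Finset.prod_mul_distrib, h']
  simp only [Finset.prod_const, Finset.card_range, map_add, map_mul, map_pow]
  rw [mul_add, pow_add, mul_mul_mul_comm, ← mul_pow, ← mul_pow, mul_add, mul_one,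
    mul_div_cancel₀ _ hQ']
  ring

/-- The Berlekamp discriminant of `X ^ (k + s) + X ^ k + b`, with `k` and `s` odd and `r` its
sequence of roots, lies in the prime field. -/
theorem isIdempotentElem_berlekamp_discriminant {L : Type*} [Field L] [CharP L 2] {k s : ℕ}
    (hk : Odd k) (hs : Odd s) (hks : 2 < k + s) {b : L} (hb : b ≠ 0) (r : ℕ → L)
    (hr : ∏ i ∈ Finset.range (k + s), (X - C (r i)) = X ^ (k + s) + X ^ k + C b)
    (hinj : Set.InjOn (fun i => r i ^ s) (Finset.range (k + s))) :
    IsIdempotentElem (∑ j ∈ Finset.range (k + s), ∑ i ∈ Finset.range j,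
      r i * r j / (r i + r j) ^ 2) := by
  set N := k + s with hN
  have hNe : Even N := hk.add_odd hs
  have hr' : ∏ i ∈ Finset.range N, (X + C (r i)) = X ^ N + X ^ k + C b := by
    simpa only [CharTwo.sub_eq_add] using hr
  have hlin : (X + 1 : L[X]).Monic := monic_X_add_C 1
  have hlind : (X + 1 : L[X]).natDegree = 1 := natDegree_X_add_C 1
  have hk0 : k ≠ 0 := hk.pos.ne'
  have hN0 : N ≠ 0 := by omega
  have hprod : ∏ i ∈ Finset.range N, r i = b := by
    have := congrArg (eval 0) hr'
    simpa [eval_prod, hk0, hN0] using this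
  have hroot : ∀ i ∈ Finset.range N, r i ^ N + r i ^ k + b = 0 := by
    intro i hi
    have := congrArg (eval (r i)) hr
    rw [eval_prod, Finset.prod_eq_zero hi (by simp)] at this
    simpa using this.symm
  have hu : ∏ i ∈ Finset.range N, (X + C (r i ^ s)) = X ^ k * (X + 1) ^ s + C (b ^ s) := by
    have hm1 : (X ^ k * (X + 1) ^ s : L[X]).Monic :=
      (monic_X_pow k).mul (hlin.pow s)
    have hd1 : (X ^ k * (X + 1) ^ s : L[X]).natDegree = N := by
      rw [(monic_X_pow k).natDegree_mul (hlin.pow s), natDegree_X_pow,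
        hlin.natDegree_pow, hlind, mul_one]
    simp only [← CharTwo.sub_eq_add (X : L[X]) (C _)]
    refine prod_X_sub_C_eq_of_injOn (hm1.add_of_left ?_) ?_ (fun i => r i ^ s) hinj ?_
    · rw [degree_eq_natDegree hm1.ne_zero, hd1]
      exact degree_C_le.trans_lt (by exact_mod_cast Nat.pos_of_ne_zero hN0)
    · rw [natDegree_add_C, hd1]
    · intro i hi
      have h := hroot i (by simpa using hi)
      have h1 : r i ^ k * (r i ^ s + 1) = b := by
        rw [mul_add, ← pow_add, mul_one, ← hN]
        exact CharTwo.add_eq_zero.1 h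
      simp only [eval_add, eval_mul, eval_pow, eval_X, eval_one, eval_C]
      rw [← h1, ← pow_mul, mul_pow, ← pow_mul, mul_comm k s, CharTwo.add_self_eq_zero]
  set A : L[X] := ∑ i ∈ Finset.range k, (X + 1) ^ i with hA
  set B : L[X] := ∑ i ∈ Finset.range N, (X + 1) ^ i with hB
  have hAX : A * X = (X + 1) ^ k + 1 := by
    rw [← CharTwo.sub_eq_add, ← geom_sum_mul, add_sub_cancel_right]
  have hBX : B * X = (X + 1) ^ N + 1 := by
    rw [← CharTwo.sub_eq_add, ← geom_sum_mul, add_sub_cancel_right]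
  have hA0 : A.eval 0 = 1 := by
    simp [hA, eval_finsetSum, CharTwo.natCast_eq_ite, hk]
  have hB0 : B.eval 0 = 0 := by
    simp [hB, eval_finsetSum, CharTwo.natCast_eq_ite, hNe]
  have hBne : B ≠ 0 := by
    intro h0
    rw [h0, zero_mul] at hBX
    have := congrArg natDegree (CharTwo.add_eq_zero.1 hBX.symm)
    rw [hlin.natDegree_pow, hlind, natDegree_one] at this
    omega
  have hrow (i : ℕ) (hi : i ∈ Finset.range N) :
      ∏ j ∈ Finset.range N, ((X + 1) * C (r i) + C (r j)) =
        X * (C (r i ^ k) * (A + B * C (r i ^ s))) := by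
    have h := congrArg (fun p => p.comp ((X + 1) * C (r i))) hr'
    simp only [prod_comp, add_comp, X_comp, C_comp, pow_comp] at h
    rw [h]
    have h2 : C (r i) ^ N + C (r i) ^ k + C b = 0 := by
      simpa using congrArg C (hroot i hi)
    have h3 : X * (C (r i ^ k) * (A + B * C (r i ^ s))) =
        C (r i) ^ k * (A * X) + C (r i) ^ N * (B * X) := by
      rw [hN, pow_add, C_pow, C_pow]
      ring
    rw [h3, hAX, hBX, mul_pow, mul_pow]
    linear_combination h2 - CharTwo.add_self_eq_zero (C (r i) ^ N + C (r i) ^ k)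
  have hrne : ∀ j ∈ Finset.range N, ∀ i ∈ Finset.range j, r i + r j ≠ 0 := by
    intro j hj i hi h0
    simp only [Finset.mem_range] at hi hj
    have := hinj (x₁ := i) (x₂ := j) (by simp; omega) (by simpa using hj)
      (congrArg (· ^ s) (CharTwo.add_eq_zero.1 h0))
    omega
  have hpair (j : ℕ) (hj : j ∈ Finset.range N) (i : ℕ) (hi : i ∈ Finset.range j) :
      ((X + 1) * C (r i) + C (r j)) * ((X + 1) * C (r j) + C (r i)) =
        C ((r i + r j) ^ 2) * (X + 1 + X ^ 2 * C (r i * r j / (r i + r j) ^ 2)) := by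
    have h0 := hrne j hj i hi
    have : C ((r i + r j) ^ 2) * C (r i * r j / (r i + r j) ^ 2) = C (r i) * C (r j) := by
      rw [← C_mul, mul_div_cancel₀ _ (pow_ne_zero 2 h0), C_mul]
    simp only [C_pow, C_add] at this ⊢
    linear_combination -X ^ 2 * this
  have hdiag : ∏ i ∈ Finset.range N, ((X + 1) * C (r i) + C (r i)) = X ^ N * C b := by
    have hX : X ^ N = ∏ _i ∈ Finset.range N, (X : L[X]) := by simp
    rw [← hprod, map_prod, hX, ← Finset.prod_mul_distrib]
    refine Finset.prod_congr rfl fun i _ => ?_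
    linear_combination CharTwo.add_self_eq_zero (C (r i))
  set D : L := ∏ j ∈ Finset.range N, ∏ i ∈ Finset.range j, (r i + r j) ^ 2
  set S : L[X] := ∏ j ∈ Finset.range N, ∏ i ∈ Finset.range j,
    (X + 1 + X ^ 2 * C (r i * r j / (r i + r j) ^ 2))
  have hoff : ∏ j ∈ Finset.range N, ∏ i ∈ Finset.range j,
      ((X + 1) * C (r i) + C (r j)) * ((X + 1) * C (r j) + C (r i)) = C D * S := by
    rw [Finset.prod_congr rfl fun j hj => Finset.prod_congr rfl (hpair j hj)]
    simp only [Finset.prod_mul_distrib, D, S, map_prod]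
  have hmain : C (b * D) * S = C (b ^ k) * (A ^ k * (A + B) ^ s + C (b ^ s) * B ^ N) := by
    apply mul_left_cancel₀ (pow_ne_zero N (X_ne_zero (R := L)))
    have h1 := prod_range_pairs (fun i j => (X + 1) * C (r i) + C (r j)) N
    rw [hdiag, hoff, Finset.prod_congr rfl hrow, Finset.prod_mul_distrib, Finset.prod_mul_distrib,
      Finset.prod_const, Finset.card_range, ← map_prod, Finset.prod_pow, hprod,
      prod_add_mul_C _ _ hu A B hBne] at h1
    rw [C_mul]
    linear_combination -h1
  obtain ⟨T, hT⟩ : ∃ T, S = (X + 1) ^ (∑ j ∈ Finset.range N, j) + X ^ 2 * C (∑ j ∈ Finset.range N,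
      ∑ i ∈ Finset.range j, r i * r j / (r i + r j) ^ 2) + X ^ 3 * T := by
    have h := exists_prod_X_add_one_add_eq ((Finset.range N).sigma fun j => Finset.range j)
      (fun p => r p.2 * r p.1 / (r p.2 + r p.1) ^ 2)
    simpa only [Finset.prod_sigma, Finset.sum_sigma, Finset.card_sigma, Finset.card_range] using h
  have hbD : b * D = b ^ k := by
    have h := congrArg (eval 0) hmain
    simpa [hT, hA0, hB0, hN0] using h
  rw [hbD] at hmain
  have hS := mul_left_cancel₀ (C_ne_zero.2 (pow_ne_zero k hb)) hmain
  obtain ⟨B', hB'⟩ : X ∣ B := X_dvd_iff.2 (by rwa [coeff_zero_eq_eval_zero])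
  obtain ⟨M, hM⟩ := Nat.exists_eq_add_of_le (show 3 ≤ N from hks)
  have hBN : B ^ N = X ^ 3 * (B' ^ 3 * B ^ M) := by
    rw [hM, pow_add, hB']
    ring
  set Q : L[X] := A ^ k * (A + B) ^ s - (X + 1) ^ (∑ j ∈ Finset.range N, j)
  have hQ : Q = X ^ 2 * C (∑ j ∈ Finset.range N,
      ∑ i ∈ Finset.range j, r i * r j / (r i + r j) ^ 2) +
      X ^ 3 * (T - C (b ^ s) * (B' ^ 3 * B ^ M)) := by
    rw [hBN, hT] at hS
    linear_combination -hS
  have hQcoeff : Q.coeff 2 = ∑ j ∈ Finset.range N,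
      ∑ i ∈ Finset.range j, r i * r j / (r i + r j) ^ 2 := by
    rw [hQ]
    simp [coeff_X_pow_mul']
  have hQfrob : Q.map (frobenius L 2) = Q := by
    simp [Q, hA, hB, Polynomial.map_sum]
  rw [← hQcoeff]
  have h := congrArg (fun p => p.coeff 2) hQfrob
  simp only [coeff_map, frobenius_def, sq] at h
  exact h

/-- A root `x` of an irreducible `g`, in some extension, has a Frobenius orbit of exact length
`g.natDegree`. -/
theorem exists_frobenius_orbit_s2 {K : Type u} [Field K] [Finite K] {g : K[X]}
    (hg : Irreducible g) :
    ∃ (L : Type u) (_ : Field L) (_ : Algebra K L) (x : L), aeval x g = 0 ∧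
      x ^ Nat.card K ^ g.natDegree = x ∧
      ∀ i, 0 < i → i < g.natDegree → x ^ Nat.card K ^ i ≠ x := by
  have : Fact (Irreducible g) := ⟨hg⟩
  have : Fintype K := Fintype.ofFinite K
  have hfin : Module.finrank K (AdjoinRoot g) = g.natDegree := by
    rw [(AdjoinRoot.powerBasis hg.ne_zero).finrank, AdjoinRoot.powerBasis_dim]
  have : Module.Finite K (AdjoinRoot g) := (AdjoinRoot.powerBasis hg.ne_zero).finite
  have : Finite (AdjoinRoot g) := Module.finite_of_finite K
  have hord := FiniteField.orderOf_frobeniusAlgHom K (AdjoinRoot g)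
  have hpow (i : ℕ) (x : AdjoinRoot g) :
      (FiniteField.frobeniusAlgHom K (AdjoinRoot g) ^ i) x = x ^ Nat.card K ^ i := by
    rw [AlgHom.coe_pow, FiniteField.coe_frobeniusAlgHom, pow_iterate, Nat.card_eq_fintype_card]
  refine ⟨AdjoinRoot g, inferInstance, inferInstance, AdjoinRoot.root g, ?_, ?_, ?_⟩
  · rw [AdjoinRoot.aeval_eq, AdjoinRoot.mk_self]
  · rw [← hpow, ← hfin, ← hord, pow_orderOf_eq_one, AlgHom.one_apply]
  · intro i hi hi' h
    have hone : FiniteField.frobeniusAlgHom K (AdjoinRoot g) ^ i = 1 :=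
      AdjoinRoot.algHom_ext (by rw [hpow, h, AlgHom.one_apply])
    have := Nat.le_of_dvd hi (orderOf_dvd_of_pow_eq_one hone)
    omega

theorem pow_pow_injOn_of_periodic {M : Type*} [Field M] {q N : ℕ} {x : M}
    (hx : x ^ q ^ N = x) (hne : ∀ i, 0 < i → i < N → x ^ q ^ i ≠ x) :
    Set.InjOn (fun i => x ^ q ^ i) (Finset.range N) := by
  have key : ∀ i j, i < j → j < N → x ^ q ^ i ≠ x ^ q ^ j := by
    intro i j hij hj h
    refine hne (N - j + i) (by omega) (by omega) ?_
    have h' := congrArg (· ^ q ^ (N - j)) h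
    simp only [← pow_mul, ← pow_add] at h'
    rw [show j + (N - j) = N by omega, hx, add_comm] at h'
    exact h'
  intro i hi j hj h
  simp only [Finset.coe_range, Set.mem_Iio] at hi hj
  rcases lt_trichotomy i j with hij | hij | hij
  · exact absurd h (key i j hij hj)
  · exact hij
  · exact absurd h.symm (key j i hij hi)

theorem not_irreducible_trinomial_of_coprime_s2 {K : Type*} [Field K] [Finite K] [CharP K 2]
    {a : ℕ} (hcard : Nat.card K = 4 ^ a) {k s : ℕ} (hk : Odd k) (hs : Odd s) (hks : 2 < k + s)
    (hcop : k.Coprime s) (b : K) :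
    ¬ Irreducible (X ^ (k + s) + X ^ k + C b) := by
  intro hirr
  have hlt : (X ^ k + C b : K[X]).natDegree < k + s := by
    rw [natDegree_add_C, natDegree_X_pow]
    exact Nat.lt_add_of_pos_right hs.pos
  have hdeg : (X ^ (k + s) + X ^ k + C b : K[X]).natDegree = k + s := by
    rw [add_assoc, natDegree_add_eq_left_of_natDegree_lt, natDegree_X_pow]
    rwa [natDegree_X_pow]
  have hmonic : (X ^ (k + s) + X ^ k + C b : K[X]).Monic := by
    rw [add_assoc]
    exact monic_X_pow_add ((degree_lt_iff_coeff_zero _ _).2 fun m hm =>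
      coeff_eq_zero_of_natDegree_lt (hlt.trans_le hm))
  have hk0 := hk.pos.ne'
  have hb : b ≠ 0 := by
    rintro rfl
    have hroot : (X ^ (k + s) + X ^ k + C 0 : K[X]).IsRoot 0 := by
      simp [hk0]
    have := degree_eq_one_of_irreducible_of_root hirr hroot
    rw [degree_eq_natDegree hirr.ne_zero, hdeg] at this
    have : k + s = 1 := by exact_mod_cast this
    omega
  obtain ⟨L, _, _, x, hx0, hxN, hxne⟩ := exists_frobenius_orbit_s2 hirr
  rw [hdeg] at hxN hxne
  have : CharP L 2 := charP_of_injective_algebraMap (algebraMap K L).injective 2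
  have : Fintype K := Fintype.ofFinite K
  set q := Nat.card K
  have hqpos : 0 < q := Nat.card_pos
  have hq2 : q = 2 ^ (2 * a) := by rw [hcard, pow_mul]; norm_num
  set c : L := algebraMap K L b
  have hc : c ≠ 0 := by simpa [c] using hb
  have hcq (i : ℕ) : c ^ q ^ i = c := by
    rw [← map_pow, show q = Fintype.card K from Nat.card_eq_fintype_card, FiniteField.pow_card_pow]
  have hx : x ^ (k + s) + x ^ k + c = 0 := by simpa using hx0
  have hxk : x ^ k * (x ^ s + 1) = c := by
    rw [mul_add, ← pow_add, mul_one]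
    exact CharTwo.add_eq_zero.1 hx
  have hxne0 : x ≠ 0 := by
    rintro rfl
    exact hc (by simpa [hk0] using hxk.symm)
  have hs1 : x ^ s + 1 ≠ 0 := right_ne_zero_of_mul (hxk ▸ hc)
  have hadd (i : ℕ) (y z : L) : (y + z) ^ q ^ i = y ^ q ^ i + z ^ q ^ i := by
    rw [hq2, ← pow_mul, add_pow_char_pow]
  have hroots : ∏ i ∈ Finset.range (k + s), (X - C (x ^ q ^ i)) =
      X ^ (k + s) + X ^ k + C c := by
    have hmap : (X ^ (k + s) + X ^ k + C b : K[X]).map (algebraMap K L) =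
      X ^ (k + s) + X ^ k + C c := by simp [c]
    rw [← hmap]
    refine prod_X_sub_C_eq_of_injOn (hmonic.map _) ?_ _ (pow_pow_injOn_of_periodic hxN hxne) ?_
    · rw [natDegree_map, hdeg]
    · intro i _
      rw [hmap]
      simp only [eval_add, eval_pow, eval_X, eval_C]
      rw [← hcq i, pow_right_comm, pow_right_comm x _ k, ← hadd, ← hadd, hx,
        zero_pow (pow_pos hqpos i).ne']
  have hinj : Set.InjOn (fun i => (x ^ q ^ i) ^ s) (Finset.range (k + s)) := by
    simp only [pow_right_comm x _ s]
    refine pow_pow_injOn_of_periodic (by rw [pow_right_comm, hxN]) fun i hi hi' h => ?_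
    refine hxne i hi hi' ?_
    have hk' : (x ^ k) ^ q ^ i = x ^ k := by
      apply mul_right_cancel₀ hs1
      nth_rewrite 1 [← h]
      rw [← one_pow (q ^ i), ← hadd, ← mul_pow, one_pow, hxk, hcq]
    have hz (m : ℕ) (hm : (x ^ m) ^ q ^ i = x ^ m) : (x ^ q ^ i / x) ^ m = 1 := by
      rw [div_pow, pow_right_comm, hm, div_self (pow_ne_zero m hxne0)]
    have hone : x ^ q ^ i / x = 1 := by
      rw [← orderOf_eq_one_iff, ← Nat.dvd_one, ← hcop]
      exact Nat.dvd_gcd (orderOf_dvd_of_pow_eq_one (hz k hk')) (orderOf_dvd_of_pow_eq_one (hz s h))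
    exact (div_eq_one_iff_eq hxne0).1 hone
  have hβ := isIdempotentElem_berlekamp_discriminant hk hs hks hc _ hroots hinj
  have hinjx := pow_pow_injOn_of_periodic hxN hxne
  have hne : ∀ j ∈ Finset.range (k + s), ∀ i ∈ Finset.range j,
      x ^ q ^ i + x ^ q ^ j ≠ 0 := by
    intro j hj i hi h0
    simp only [Finset.mem_range] at hi hj
    have := hinjx (x₁ := i) (x₂ := j) (by simp; omega) (by simpa using hj)
      (CharTwo.add_eq_zero.1 h0)
    omega
  set β := ∑ j ∈ Finset.range (k + s), ∑ i ∈ Finset.range j,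
    x ^ q ^ i * x ^ q ^ j / (x ^ q ^ i + x ^ q ^ j) ^ 2
  set γ := ∑ j ∈ Finset.range (k + s), ∑ i ∈ Finset.range j,
    x ^ q ^ i / (x ^ q ^ i + x ^ q ^ j) with hγ
  have hγβ : γ ^ 2 = γ + β := by
    simp only [γ, β, CharTwo.sum_sq, ← Finset.sum_add_distrib]
    refine Finset.sum_congr rfl fun j hj => Finset.sum_congr rfl fun i hi => ?_
    have h0 := hne j hj i hi
    field_simp
    linear_combination -CharTwo.add_self_eq_zero (x ^ q ^ j)
  have hγ4 : γ ^ 4 = γ := by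
    rw [show 4 = 2 * 2 from rfl, pow_mul, hγβ, CharTwo.add_sq, hγβ, sq, hβ.eq, add_assoc,
      CharTwo.add_self_eq_zero, add_zero]
  have hγq : γ ^ q = γ := by
    rw [hcard]
    exact (congrFun (pow_iterate 4 a) γ).symm.trans (Function.iterate_fixed hγ4 a)
  have hshift := sum_range_pairs_shift (hk.add_odd hs) (by omega) (fun i => x ^ q ^ i)
    (by simpa using hxN) (fun i hi hi' => by simpa using hxne i hi hi')
  have hγq' : γ ^ q = γ + 1 := by
    rw [← hshift, hγ, show q = 2 ^ (2 * a) from hq2, ← iterateFrobenius_def, map_sum]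
    simp only [map_sum, map_div₀, map_add, iterateFrobenius_def, ← pow_mul, ← pow_succ, ← hq2]
  rw [hγq] at hγq'
  simp at hγq'

theorem not_irreducible_X_sq_add_X_add_C {K : Type*} [Field K] [Finite K] [CharP K 2] {m : ℕ}
    (hcard : Nat.card K = 2 ^ m) {b : K} (hb : ∑ i ∈ Finset.range m, b ^ 2 ^ i = 0) :
    ¬ Irreducible (X ^ 2 + X + C b) := by
  intro hirr
  have hdeg : (X ^ 2 + X + C b : K[X]).natDegree = 2 := by compute_degree!
  obtain ⟨L, _, _, x, hx0, -, hxne⟩ := exists_frobenius_orbit_s2 hirr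
  have : CharP L 2 := charP_of_injective_algebraMap (algebraMap K L).injective 2
  refine hxne 1 one_pos (by omega) ?_
  have hx : x ^ 2 = x + algebraMap K L b := by
    have h : x ^ 2 + x + algebraMap K L b = 0 := by simpa using hx0
    rw [add_assoc] at h
    exact CharTwo.add_eq_zero.1 h
  have key (i : ℕ) : x ^ 2 ^ i = x + algebraMap K L (∑ j ∈ Finset.range i, b ^ 2 ^ j) := by
    induction i with
    | zero => simp
    | succ i ih =>
      rw [pow_succ 2, mul_comm, pow_mul, hx, add_pow_char_pow, ih, Finset.sum_range_succ,
        map_add, map_pow, add_assoc]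
  rw [pow_one, hcard, key, hb, map_zero, add_zero]

/-- A converse to Capelli's lemma. -/
theorem irreducible_sub_C_of_irreducible_comp {F : Type u} [Field F] {f g : F[X]}
    (hf : f.Monic) (hg : g.Monic) (hirr : Irreducible f)
    (hcomp : Irreducible (f.comp g)) :
    ∃ (E : Type u) (_ : Field E) (_ : Algebra F E) (x : E), minpoly F x = f ∧
      Irreducible (g.map (algebraMap F F⟮x⟯) - C (AdjoinSimple.gen F x)) := by
  have : Fact (Irreducible (f.comp g)) := ⟨hcomp⟩
  have hg0 : g.natDegree ≠ 0 := by
    intro h0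
    rw [eq_C_of_natDegree_eq_zero h0, comp_C] at hcomp
    exact not_irreducible_C _ hcomp
  let E := AdjoinRoot (f.comp g)
  let ρ : E := AdjoinRoot.root (f.comp g)
  have hfin : Module.finrank F E = f.natDegree * g.natDegree := by
    rw [(AdjoinRoot.powerBasis hcomp.ne_zero).finrank, AdjoinRoot.powerBasis_dim, natDegree_comp]
  have : Module.Finite F E := (AdjoinRoot.powerBasis hcomp.ne_zero).finite
  have hρ : aeval ρ (f.comp g) = 0 := by
    rw [AdjoinRoot.aeval_eq, AdjoinRoot.mk_self]
  have hα : minpoly F (aeval ρ g) = f :=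
    (minpoly.eq_of_irreducible_of_monic hirr (by rwa [aeval_comp] at hρ) hf).symm
  have hint : IsIntegral F (aeval ρ g) := Algebra.IsIntegral.isIntegral _
  refine ⟨E, inferInstance, inferInstance, aeval ρ g, hα, ?_⟩
  set h := g.map (algebraMap F F⟮aeval ρ g⟯) - C (AdjoinSimple.gen F (aeval ρ g)) with hh
  have htop : F⟮aeval ρ g⟯⟮ρ⟯ = ⊤ :=
    adjoin_eq_top_of_adjoin_eq_top F (adjoin_root_eq_top (f.comp g))
  have hρint : IsIntegral F⟮aeval ρ g⟯ ρ := Algebra.IsIntegral.isIntegral _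
  have hdeg : (minpoly F⟮aeval ρ g⟯ ρ).natDegree = g.natDegree := by
    rw [← adjoin.finrank hρint, htop, finrank_top']
    apply Nat.eq_of_mul_eq_mul_left
      (natDegree_pos_iff_degree_pos.2 (degree_pos_of_irreducible hirr))
    rw [← hfin, ← Module.finrank_mul_finrank F F⟮aeval ρ g⟯ E, adjoin.finrank hint, hα]
  have hlt : (C (AdjoinSimple.gen F (aeval ρ g))).degree <
      (g.map (algebraMap F F⟮aeval ρ g⟯)).degree := by
    rw [degree_map, degree_eq_natDegree hg.ne_zero]
    exact degree_C_le.trans_lt (by exact_mod_cast Nat.pos_of_ne_zero hg0)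
  have hm : h.Monic := (hg.map _).sub_of_left hlt
  have hhdeg : h.natDegree = g.natDegree := by
    rw [hh, natDegree_sub_C, natDegree_map]
  have hroot : aeval ρ h = 0 := by
    simp [hh]
  rw [eq_of_monic_of_dvd_of_natDegree_le (minpoly.monic hρint) hm
    (minpoly.dvd _ _ hroot) (by rw [hdeg, hhdeg])]
  exact minpoly.irreducible hρint

theorem irreducible_trinomial_second_iterate_reducible
    (n s : ℕ) (hn : 1 < n) (hodd : Odd s) (hs : 0 < s) (hs2 : s < 2 * n)
    (f : Polynomial (ZMod 2))
    (hf : f = X ^ (2 * n) + X ^ (2 * n - s) + 1)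
    (hirr : Irreducible f) :
    ¬ Irreducible (f.comp f) := by
  intro hcomp
  obtain ⟨k, hk⟩ : ∃ k, 2 * n = k + s := ⟨2 * n - s, by omega⟩
  have hkodd : Odd k := by
    rcases hodd with ⟨t, rfl⟩
    exact ⟨n - t - 1, by omega⟩
  rw [hk, Nat.add_sub_cancel] at hf
  have hlt : (X ^ k + 1 : (ZMod 2)[X]).natDegree < k + s := by
    rw [← C_1, natDegree_add_C, natDegree_X_pow]
    omega
  have hdeg : f.natDegree = k + s := by
    rw [hf, add_assoc, natDegree_add_eq_left_of_natDegree_lt, natDegree_X_pow]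
    rwa [natDegree_X_pow]
  have hmonic : f.Monic := by
    rw [hf, add_assoc]
    exact monic_X_pow_add ((degree_lt_iff_coeff_zero _ _).2 fun m hm =>
      coeff_eq_zero_of_natDegree_lt (hlt.trans_le hm))
  obtain ⟨E, _, _, x, hx, hirrK⟩ := irreducible_sub_C_of_irreducible_comp hmonic hmonic hirr hcomp
  have hint : IsIntegral (ZMod 2) x := by
    rw [← minpoly.ne_zero_iff, hx]
    exact hirr.ne_zero
  have hfin : Module.finrank (ZMod 2) (ZMod 2)⟮x⟯ = k + s := by
    rw [adjoin.finrank hint, hx, hdeg]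
  have : Module.Finite (ZMod 2) (ZMod 2)⟮x⟯ := adjoin.finiteDimensional hint
  have : Finite (ZMod 2)⟮x⟯ := Module.finite_of_finite (ZMod 2)
  have : CharP (ZMod 2)⟮x⟯ 2 :=
    charP_of_injective_algebraMap (algebraMap (ZMod 2) (ZMod 2)⟮x⟯).injective 2
  have hcard : Nat.card (ZMod 2)⟮x⟯ = 2 ^ (k + s) := by
    rw [Module.natCard_eq_pow_finrank (K := ZMod 2), Nat.card_zmod, hfin]
  set α := AdjoinSimple.gen (ZMod 2) x with hα
  obtain ⟨e, k', s', he, hcop, rfl, rfl⟩ := Nat.exists_coprime' (Nat.gcd_pos_of_pos_right k hs)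
  have hexp : f.map (algebraMap (ZMod 2) (ZMod 2)⟮x⟯) - C α =
      expand _ e (X ^ (k' + s') + X ^ k' + C (1 + α)) := by
    rw [hf]
    simp [CharTwo.sub_eq_add, ← pow_mul, add_mul, mul_comm e, add_assoc]
  rw [hexp] at hirrK
  have hirr' := of_irreducible_expand he.ne' hirrK
  have hk' : Odd k' := Nat.Odd.of_mul_left hkodd
  have hs' : Odd s' := Nat.Odd.of_mul_left hodd
  by_cases h2 : 2 < k' + s'
  · refine not_irreducible_trinomial_of_coprime_s2 (a := n) ?_ hk' hs' h2 hcop (1 + α) hirr'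
    rw [hcard, ← hk, pow_mul]
    norm_num
  · have hk1 : k' = 1 := by have := hk'.pos; have := hs'.pos; omega
    have hs1 : s' = 1 := by have := hk'.pos; have := hs'.pos; omega
    subst hk1 hs1
    refine not_irreducible_X_sq_add_X_add_C hcard (b := 1 + α) ?_ (by simpa using hirr')
    have htr : Algebra.trace (ZMod 2) (ZMod 2)⟮x⟯ α = 0 := by
      rw [hα, trace_adjoinSimpleGen hint, hx, nextCoeff_of_natDegree_pos (by omega), hdeg, hf]
      rw [coeff_add, coeff_add, coeff_X_pow, coeff_X_pow, coeff_one, if_neg (by omega),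
        if_neg (by omega), if_neg (by omega), add_zero, add_zero, neg_zero]
    have hsum := FiniteField.algebraMap_trace_eq_sum_pow (ZMod 2) (ZMod 2)⟮x⟯ α
    rw [htr, map_zero, hfin, Nat.card_zmod] at hsum
    simp only [add_pow_char_pow, one_pow, Finset.sum_add_distrib, ← hsum]
    simp [CharTwo.add_self_eq_zero]
end

section
/- Let n, m ≥ 1, let s be an odd integer with 0 < s < 2n, and let f(x) = x^(2n) + x^(2n−s) + 1 and g(x) = x^(2m) + a_(2m−1)x^(2m−1) + ... + a_1 x + a_0 be polynomials with integer coefficients such that g(1) is odd. Furthermore suppose that a_(2m−1) is even whenever n = s. Then Res(g(f(x)), f'(x)) ≡ 1 (mod 8), where f'(x) = 2n·x^(2n−1) + (2n−s)·x^(2n−s−1) is the derivative of f. -/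
open Polynomial Finset

namespace Polynomial

theorem sum_divByMonic_roots {K : Type*} [Field K] {h : K[X]} (hm : h.Monic) (hs : h.Splits) :
    derivative h = (h.roots.map fun γ => h /ₘ (X - C γ)).sum := by
  classical
  have hprod : h = (h.roots.map fun x => X - C x).prod := hs.eq_prod_roots_of_monic hm
  conv_lhs => rw [hprod]
  rw [derivative_prod]
  congr 1
  refine Multiset.map_congr rfl fun γ hγ => ?_
  have hmul : h = (X - C γ) * ((h.roots.erase γ).map fun x => X - C x).prod := by
    exact hprod.trans (Multiset.prod_map_erase (f := fun x => X - C x) hγ).symm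
  conv_rhs => rw [hmul, mul_divByMonic_cancel_left _ (monic_X_sub_C γ)]
  simp

/-- Newton's identities for the power sums of the roots of a split monic polynomial. -/
theorem coeff_succ_mul_eq_sum_psum_roots {K : Type*} [Field K] {h : K[X]} (hm : h.Monic)
    (hs : h.Splits) (j : ℕ) :
    h.coeff (j + 1) * (j + 1) =
      ∑ i ∈ Icc (j + 1) h.natDegree, (h.roots.map (· ^ (i - (j + 1)))).sum * h.coeff i := by
  rw [← coeff_derivative, sum_divByMonic_roots hm hs, ← lcoeff_apply, map_multiset_sum,
    Multiset.map_map]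
  simp only [Function.comp_def, lcoeff_apply, coeff_divByMonic_X_sub_C]
  rw [Multiset.sum_map_sum]
  simp [Multiset.sum_map_mul_right]

section Trinomial

variable {K : Type*} [Field K] {s k : ℕ} (c : K)

theorem trinomial_monic_natDegree (hs : 0 < s) (hk : 0 < k) :
    (X ^ (s + k) + X ^ k + C c : K[X]).Monic ∧
      (X ^ (s + k) + X ^ k + C c : K[X]).natDegree = s + k := by
  have hdeg : (X ^ k + C c : K[X]).degree < ((s + k : ℕ) : WithBot ℕ) := by
    rw [degree_X_pow_add_C hk]
    exact_mod_cast (by lia)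
  rw [add_assoc]
  exact ⟨monic_X_pow_add hdeg, natDegree_eq_of_degree_eq_some (by
    rw [degree_add_eq_left_of_degree_lt (by rwa [degree_X_pow]), degree_X_pow])⟩

theorem trinomial_psum_newton (hsplit : (X ^ (s + k) + X ^ k + C c : K[X]).Splits)
    (hs : 0 < s) (hk : 0 < k) {t : ℕ} (ht : 0 < t) (htd : t < s + k) :
    (if t = k then (t : K) else 0) =
      ((X ^ (s + k) + X ^ k + C c : K[X]).roots.map (· ^ (s + k - t))).sum +
        if t ≤ k then ((X ^ (s + k) + X ^ k + C c : K[X]).roots.map (· ^ (k - t))).sum else 0 := by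
  obtain ⟨hm, hd⟩ := trinomial_monic_natDegree c hs hk
  obtain ⟨j, rfl⟩ : ∃ j, t = j + 1 := ⟨t - 1, by lia⟩
  have h := coeff_succ_mul_eq_sum_psum_roots hm hsplit j
  rw [hd] at h
  have hc : ∀ i ∈ Icc (j + 1) (s + k), (X ^ (s + k) + X ^ k + C c : K[X]).coeff i =
      (if i = s + k then 1 else 0) + if i = k then 1 else 0 := by
    intro i hi
    have : i ≠ 0 := by have := (mem_Icc.mp hi).1; lia
    simp [coeff_X_pow, coeff_C, this]
  rw [Finset.sum_congr rfl fun i hi => by rw [hc i hi], hc _ (mem_Icc.mpr ⟨le_rfl, htd.le⟩)] at h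
  simp only [mul_add, mul_ite, mul_one, mul_zero, Finset.sum_add_distrib, Finset.sum_ite_eq',
    mem_Icc, htd.le, htd.ne, if_false] at h
  clear hsplit hm hd hc
  push_cast
  split_ifs at h ⊢ <;> first | lia | (subst_vars; simp_all)

theorem trinomial_psum_eq_zero (hsplit : (X ^ (s + k) + X ^ k + C c : K[X]).Splits)
    (hs : 0 < s) (hk : 0 < k) {r : ℕ} (hr : 0 < r) (hrs : r < s) :
    ((X ^ (s + k) + X ^ k + C c : K[X]).roots.map (· ^ r)).sum = 0 := by
  have h := trinomial_psum_newton c hsplit hs hk (t := s + k - r) (by lia) (by lia)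
  rw [if_neg (by lia), if_neg (by lia), show s + k - (s + k - r) = r by lia, add_zero] at h
  exact h.symm

theorem trinomial_psum (hsplit : (X ^ (s + k) + X ^ k + C c : K[X]).Splits)
    (hs : 0 < s) (hk : 0 < k) :
    ((X ^ (s + k) + X ^ k + C c : K[X]).roots.map (· ^ s)).sum = -s := by
  have h := trinomial_psum_newton c hsplit hs hk (t := k) hk (by lia)
  simp only [if_true, le_refl, Nat.add_sub_cancel, Nat.sub_self, pow_zero, Multiset.map_const',
    Multiset.sum_replicate, ← hsplit.natDegree_eq_card_roots,
    (trinomial_monic_natDegree c hs hk).2, nsmul_eq_mul, mul_one] at h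
  push_cast at h
  linear_combination -h

theorem trinomial_psum_add (r : ℕ) :
    ((X ^ (s + k) + X ^ k + C c : K[X]).roots.map (· ^ (s + k + r))).sum +
      ((X ^ (s + k) + X ^ k + C c : K[X]).roots.map (· ^ (k + r))).sum +
      c * ((X ^ (s + k) + X ^ k + C c : K[X]).roots.map (· ^ r)).sum = 0 := by
  rw [← Multiset.sum_map_mul_left, ← Multiset.sum_map_add, ← Multiset.sum_map_add]
  refine Multiset.sum_eq_zero fun x hx => ?_
  obtain ⟨γ, hγ, rfl⟩ := Multiset.mem_map.mp hx
  have := (mem_roots'.mp hγ).2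
  simp only [IsRoot.def, eval_add, eval_pow, eval_X, eval_C] at this
  linear_combination γ ^ r * this

theorem trinomial_psum_two_mul (hsplit : (X ^ (s + k) + X ^ k + C c : K[X]).Splits)
    (hs : 0 < s) (hk : 0 < k) :
    ((X ^ (s + k) + X ^ k + C c : K[X]).roots.map (· ^ (2 * s))).sum =
      if s = k then s - 2 * s * c else (s : K) := by
  have hp := trinomial_psum c hsplit hs hk
  rcases lt_trichotomy s k with h | rfl | h
  · have h1 := trinomial_psum_newton c hsplit hs hk (t := k - s) (by lia) (by lia)
    rw [if_neg (by lia), if_pos (by lia), show s + k - (k - s) = 2 * s by lia,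
      show k - (k - s) = s by lia, hp] at h1
    rw [if_neg h.ne]
    linear_combination -h1
  · have h1 := trinomial_psum_add (s := s) (k := s) c 0
    simp only [add_zero, hp, pow_zero, Multiset.map_const',
      Multiset.sum_replicate, ← hsplit.natDegree_eq_card_roots,
      (trinomial_monic_natDegree c hs hk).2, nsmul_eq_mul, mul_one] at h1
    rw [if_pos rfl, two_mul s]
    push_cast at h1
    linear_combination h1
  · have h1 := trinomial_psum_add (s := s) (k := k) c (s - k)
    rw [show s + k + (s - k) = 2 * s by lia, show k + (s - k) = s by lia, hp,
      trinomial_psum_eq_zero c hsplit hs hk (r := s - k) (by lia) (by lia)] at h1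
    rw [if_neg h.ne']
    linear_combination h1

end Trinomial

theorem coeff_prod_C_add_C_mul_X {R ι : Type*} [CommRing R] (S : Finset ι) (a : R) (b : ι → R) :
    (∏ i ∈ S, (C a + C (b i) * X)).coeff 0 = a ^ #S ∧
    a * (∏ i ∈ S, (C a + C (b i) * X)).coeff 1 = a ^ #S * ∑ i ∈ S, b i ∧
    2 * a ^ 2 * (∏ i ∈ S, (C a + C (b i) * X)).coeff 2 =
      a ^ #S * ((∑ i ∈ S, b i) ^ 2 - ∑ i ∈ S, b i ^ 2) := by
  classical
  induction S using Finset.induction with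
  | empty => simp [coeff_one]
  | insert i S hi ih =>
    obtain ⟨h0, h1, h2⟩ := ih
    simp only [prod_insert hi, sum_insert hi, card_insert_of_notMem hi, add_mul, coeff_add,
      mul_assoc, coeff_C_mul, coeff_X_mul_zero, coeff_X_mul, mul_zero, add_zero, h0]
    refine ⟨by ring, by linear_combination a * h1, ?_⟩
    linear_combination a * h2 + 2 * b i * a * h1

/-- The polynomial `∏ (a + βᵢˢ T)` over the roots of an integer polynomial has integer
coefficients. -/
theorem exists_map_eq_prod_C_add_pow {N : ℕ} {G : ℤ[X]} {β : Fin N → ℂ}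
    (hG : G.map (Int.castRingHom ℂ) = ∏ i, (X - C (β i))) (a : ℤ) (s : ℕ) :
    ∃ D : ℤ[X], D.map (Int.castRingHom ℂ) = ∏ i, (C (a : ℂ) + C (β i ^ s) * X) := by
  let φ : ℤ[X] →+* ℂ[X] := mapRingHom (Int.castRingHom ℂ)
  let L : ℤ[X][X] := C (C a) + C X * X ^ s
  refine ⟨resultant (G.map C) L N s, ?_⟩
  have h1 : (G.map C).map φ = ∏ i, (X - C (C (β i))) := by
    rw [map_map, show φ.comp C = C.comp (Int.castRingHom ℂ) by ext; simp [φ], ← map_map, hG,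
      Polynomial.map_prod]
    simp
  have h2 : L.map φ = C (C (a : ℂ)) + C X * X ^ s := by simp [L, φ]
  have hL : (L.map φ).natDegree ≤ s := by
    rw [h2]; compute_degree
  have hdeg : (∏ i, (X - C (C (β i))) : ℂ[X][X]).natDegree = N := by
    simp [natDegree_prod_of_monic _ _ fun i _ => monic_X_sub_C (C (β i))]
  have h3 := resultant_prod_left univ (fun i => (X - C (C (β i)) : ℂ[X][X])) (L.map φ) s
    (by simp) hL
  rw [hdeg, ← h1] at h3
  change φ _ = _
  rw [← resultant_map_map, h3]
  refine Finset.prod_congr rfl fun i _ => ?_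
  rw [natDegree_X_sub_C, resultant_X_sub_C_left _ _ _ hL, h2]
  simp only [eval_add, eval_mul, eval_pow, eval_C, eval_X, C_pow, X_mul]

theorem roots_comp_of_monic {K : Type*} [Field K] {p q : K[X]} (hm : p.Monic) (hs : p.Splits)
    (hq : ∀ y, q - C y ≠ 0) : (p.comp q).roots = p.roots.bind fun y => (q - C y).roots := by
  conv_lhs => rw [hs.eq_prod_roots_of_monic hm]
  rw [multiset_prod_comp, Multiset.map_map, roots_multiset_prod, Multiset.bind_map]
  · simp
  · rw [Multiset.mem_map]
    rintro ⟨y, -, hy⟩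
    exact hq y (by simpa using hy)

section CompTrinomial

variable {K : Type*} [Field K] [IsAlgClosed K] {p : K[X]} {s k : ℕ}

theorem sum_map_pow_roots_comp_trinomial (hm : p.Monic) (hs : 0 < s) (hk : 0 < k) (r : ℕ) :
    ((p.comp (X ^ (s + k) + X ^ k + 1)).roots.map (· ^ r)).sum =
      (p.roots.map fun y =>
        ((X ^ (s + k) + X ^ k + C (1 - y) : K[X]).roots.map (· ^ r)).sum).sum := by
  have hsub (y : K) : (X ^ (s + k) + X ^ k + 1 - C y : K[X]) = X ^ (s + k) + X ^ k + C (1 - y) := by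
    simp [add_sub_assoc]
  rw [roots_comp_of_monic hm (IsAlgClosed.splits p) fun y => by
    rw [hsub]; exact (trinomial_monic_natDegree _ hs hk).1.ne_zero]
  simp only [Multiset.map_bind, Multiset.sum_bind, hsub]

theorem psum_comp_trinomial (hm : p.Monic) (hs : 0 < s) (hk : 0 < k) :
    ((p.comp (X ^ (s + k) + X ^ k + 1)).roots.map (· ^ s)).sum = -(p.natDegree * s) := by
  rw [sum_map_pow_roots_comp_trinomial hm hs hk]
  simp only [trinomial_psum _ (IsAlgClosed.splits _) hs hk]
  simp [(IsAlgClosed.splits p).natDegree_eq_card_roots]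

theorem psum_two_mul_comp_trinomial (hm : p.Monic) (hs : 0 < s) (hk : 0 < k) :
    ((p.comp (X ^ (s + k) + X ^ k + 1)).roots.map (· ^ (2 * s))).sum =
      if s = k then -(p.natDegree * s) - 2 * s * p.nextCoeff else p.natDegree * (s : K) := by
  rw [sum_map_pow_roots_comp_trinomial hm hs hk]
  simp only [trinomial_psum_two_mul _ (IsAlgClosed.splits _) hs hk]
  split_ifs
  · rw [(IsAlgClosed.splits p).nextCoeff_eq_neg_sum_roots_of_monic hm,
      (IsAlgClosed.splits p).natDegree_eq_card_roots]
    simp only [mul_sub, mul_one, Multiset.sum_map_sub, Multiset.map_const',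
      Multiset.sum_replicate, nsmul_eq_mul]
    rw [Multiset.sum_map_mul_left, Multiset.map_id']
    ring
  · simp [(IsAlgClosed.splits p).natDegree_eq_card_roots]

end CompTrinomial

theorem eval_eq_add_cube_mul {R : Type*} [CommRing R] (D : R[X]) (x : R) :
    ∃ q, D.eval x = D.coeff 0 + x * D.coeff 1 + x ^ 2 * D.coeff 2 + x ^ 3 * q := by
  refine ⟨D.divX.divX.divX.eval x, ?_⟩
  have h (P : R[X]) : P.eval x = P.coeff 0 + x * P.divX.eval x := by
    conv_lhs => rw [← X_mul_divX_add P, eval_add, eval_mul, eval_X, eval_C, add_comm]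
  rw [h D, h D.divX, h D.divX.divX]
  simp only [coeff_divX]
  ring

end Polynomial

theorem Int.eight_dvd_odd_pow_even_sub_one {x : ℤ} (hx : Odd x) {e : ℕ} (he : Even e) :
    8 ∣ x ^ e - 1 := by
  obtain ⟨r, rfl⟩ := he.two_dvd
  rw [pow_mul]
  exact (Int.eight_dvd_sq_sub_one_of_odd hx).trans (by simpa using sub_dvd_pow_sub_pow (x ^ 2) 1 r)


theorem Int.eight_dvd_of_quadratic_expansion {k x E₂ p₁ E q d₀ d₁ d₂ : ℤ} {N : ℕ} (hN : Even N)
    (hk : Odd k) (hx : 2 ∣ x) (h₀ : d₀ = k ^ N) (h₁ : k * d₁ = k ^ N * p₁)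
    (h₂ : k ^ 2 * d₂ = k ^ N * E₂) (hE : E = d₀ + x * d₁ + x ^ 2 * d₂ + x ^ 3 * q)
    (h : 8 ∣ x * k * p₁ + x ^ 2 * E₂) : 8 ∣ E - 1 := by
  obtain ⟨u, hu⟩ := Int.eight_dvd_odd_pow_even_sub_one hk hN
  obtain ⟨v, hv⟩ := Int.eight_dvd_odd_pow_even_sub_one hk even_two
  obtain ⟨w, hw⟩ := h
  obtain ⟨y, rfl⟩ := hx
  have hkE : k ^ 2 * E = k ^ N * (k ^ 2 + 8 * w) + 8 * (k ^ 2 * y ^ 3 * q) := by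
    linear_combination k ^ 2 * hE + k ^ 2 * h₀ + 2 * y * k * h₁ + 4 * y ^ 2 * h₂ + k ^ N * hw
  refine ⟨u * (k ^ 2 + 8 * w) + v + w + k ^ 2 * y ^ 3 * q - v * E, ?_⟩
  linear_combination hkE + (k ^ 2 + 8 * w) * hu + hv - E * hv

theorem Int.eight_dvd_trinomial_expansion {n m s k a : ℤ} (hsk : s + k = 2 * n) (hk : Odd k)
    (ha : s = k → Even a) :
    ∃ E₂, 2 * E₂ = (-(2 * m * s)) ^ 2 -
        (if s = k then -(2 * m * s) - 2 * s * a else 2 * m * s) ∧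
      8 ∣ 2 * n * k * (-(2 * m * s)) + (2 * n) ^ 2 * E₂ := by
  split_ifs with h
  · obtain ⟨b, rfl⟩ := ha h
    obtain rfl : s = n := by lia
    subst h
    exact ⟨2 * m ^ 2 * s ^ 2 + m * s + s * (b + b), by ring,
      s ^ 2 * (m ^ 2 * s ^ 2 + s * b), by ring⟩
  · obtain ⟨c, hc⟩ : 2 ∣ n * (k + n) := by
      obtain ⟨l, rfl⟩ := hk
      obtain ⟨e, he⟩ := (Int.even_mul_succ_self n).two_dvd
      exact ⟨e + n * l, by linear_combination he⟩
    exact ⟨2 * m ^ 2 * s ^ 2 - m * s, by ring, n ^ 2 * m ^ 2 * s ^ 2 - c * m * s,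
      by linear_combination -4 * m * s * hc⟩

/-- Since `g ∘ f` is monic of degree `4nm` and its resultant with `f'` is
`Res(g∘f, f') = ∏_i f'(β_i)` where the `β_i` are the roots of `g ∘ f` in `ℂ`
(counted with multiplicity), the congruence `Res(g(f(x)), f'(x)) ≡ 1 (mod 8)`
is expressed via any enumeration of those roots. -/
theorem resultant_comp_trinomial_mod_eight
    (n m s : ℕ) (hn : 1 ≤ n) (hm : 1 ≤ m)
    (hodd : Odd s) (hs : 0 < s) (hs2 : s < 2 * n)
    (a : Fin (2 * m) → ℤ)
    (f g : Polynomial ℤ)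
    (hf : f = X ^ (2 * n) + X ^ (2 * n - s) + 1)
    (hg : g = X ^ (2 * m) + ∑ i : Fin (2 * m), C (a i) * X ^ (i : ℕ))
    (hg1 : Odd (g.eval 1))
    (hlead : n = s → Even (a ⟨2 * m - 1, by omega⟩))
    (β : Fin (4 * n * m) → ℂ)
    (hroots : (g.comp f).map (Int.castRingHom ℂ) = ∏ i, (X - C (β i))) :
    ∃ k : ℤ, ∏ i, Polynomial.eval (β i) ((derivative f).map (Int.castRingHom ℂ))
      = 1 + 8 * (k : ℂ) := by
  obtain ⟨k, hk⟩ : ∃ k, s + k = 2 * n := ⟨2 * n - s, by lia⟩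
  have hk0 : 0 < k := by lia
  have hkodd : Odd (k : ℤ) := by
    rw [Int.odd_coe_nat]
    by_contra h
    have := hodd.add_even (Nat.not_odd_iff_even.mp h)
    rw [hk] at this
    exact Nat.not_odd_iff_even.mpr (even_two_mul n) this
  rw [← hk, Nat.add_sub_cancel_left] at hf
  have hdeg := degree_sum_fin_lt a
  have hgm : g.Monic := hg ▸ monic_X_pow_add hdeg
  have hgd : g.natDegree = 2 * m := by
    rw [hg]
    exact natDegree_eq_of_degree_eq_some (by
      rw [degree_add_eq_left_of_degree_lt (by rwa [degree_X_pow]), degree_X_pow])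
  have hgn : g.nextCoeff = a ⟨2 * m - 1, by lia⟩ := by
    rw [nextCoeff_of_natDegree_pos (by lia), hgd, hg]
    have : 2 * m - 1 ≠ 2 * m := by lia
    simp only [coeff_add, coeff_X_pow, this, if_false, zero_add, finsetSum_coeff, coeff_C_mul]
    rw [Finset.sum_eq_single ⟨2 * m - 1, by lia⟩]
    · simp
    · intro i _ hi
      rw [if_neg (fun h => hi (Fin.ext h.symm)), mul_zero]
    · simp
  have hinj : Function.Injective (Int.castRingHom ℂ) := Int.cast_injective
  have hβ : ((g.map (Int.castRingHom ℂ)).comp (X ^ (s + k) + X ^ k + 1)).roots =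
      univ.val.map β := by
    have : f.map (Int.castRingHom ℂ) = X ^ (s + k) + X ^ k + 1 := by simp [hf]
    rw [← this, ← map_comp, hroots]
    exact (congrArg roots (by rw [Multiset.map_map]; rfl)).trans
      (roots_multiset_prod_X_sub_C (univ.val.map β))
  have hp₁ := psum_comp_trinomial (hgm.map (Int.castRingHom ℂ)) hs hk0
  have hp₂ := psum_two_mul_comp_trinomial (hgm.map (Int.castRingHom ℂ)) hs hk0
  rw [hβ, Multiset.map_map, hgm.natDegree_map, hgd] at hp₁ hp₂
  rw [nextCoeff_map hinj, hgn] at hp₂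
  change ∑ i, β i ^ s = _ at hp₁
  change ∑ i, β i ^ (2 * s) = _ at hp₂
  obtain ⟨D, hD⟩ := exists_map_eq_prod_C_add_pow hroots k s
  obtain ⟨h₀, h₁, h₂⟩ := coeff_prod_C_add_C_mul_X univ (k : ℂ) fun i => β i ^ s
  simp only [← pow_mul, mul_comm s 2, hp₁, hp₂, card_fin] at h₀ h₁ h₂
  simp only [Int.cast_natCast] at hD
  rw [← hD] at h₀ h₁ h₂
  simp only [coeff_map, eq_intCast] at h₀ h₁ h₂
  obtain ⟨E₂, hE₂, h8⟩ := Int.eight_dvd_trinomial_expansion (n := n) (m := m) (s := s) (k := k)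
    (a := a ⟨2 * m - 1, by lia⟩) (by exact_mod_cast hk) hkodd (fun h => hlead (by lia))
  obtain ⟨q, hq⟩ := eval_eq_add_cube_mul D (2 * n)
  have hN : Even (4 * n * m) := ⟨2 * n * m, by ring⟩
  have hDE : (8 : ℤ) ∣ D.eval (2 * n : ℤ) - 1 := by
    refine Int.eight_dvd_of_quadratic_expansion hN hkodd (dvd_mul_right 2 (n : ℤ)) ?_ ?_ ?_ hq h8
    · exact_mod_cast h₀
    · have : ((k * D.coeff 1 : ℤ) : ℂ) = ((k ^ (4 * n * m) * -(2 * m * s) : ℤ) : ℂ) := by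
        push_cast at h₁ ⊢
        exact h₁
      exact_mod_cast this
    · have : ((2 * k ^ 2 * D.coeff 2 : ℤ) : ℂ) = ((k ^ (4 * n * m) * (2 * E₂) : ℤ) : ℂ) := by
        rw [hE₂]
        push_cast [Int.cast_ite] at h₂ ⊢
        simpa using h₂
      have := Int.cast_injective this
      linarith
  have hG0 : ∏ i, β i = (g.eval 1 : ℤ) := by
    have h := congrArg (eval 0) hroots
    have hf0 : f.eval 0 = 1 := by simp [hf, hk0.ne', hs.ne']
    have h0 : eval 0 ((g.comp f).map (Int.castRingHom ℂ)) = (g.eval 1 : ℤ) := by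
      rw [eval_zero_map, eval_comp, hf0]; simp
    rw [h0, eval_prod] at h
    simpa [Finset.prod_neg, hN.neg_one_pow] using h.symm
  have hfac (i) : eval (β i) ((derivative f).map (Int.castRingHom ℂ)) =
      β i ^ (k - 1) * (k + β i ^ s * (2 * n)) := by
    have h2n : ((s : ℂ) + k) = 2 * n := by exact_mod_cast hk
    obtain ⟨l, rfl⟩ : ∃ l, k = l + 1 := ⟨k - 1, by lia⟩
    rw [hf, ← add_assoc s l 1]
    push_cast at h2n
    simp
    linear_combination β i ^ (s + l) * h2n
  have hprod : ∏ i, ((k : ℂ) + β i ^ s * (2 * n)) = (D.eval (2 * n : ℤ) : ℤ) := by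
    have h := congrArg (eval (2 * n : ℂ)) hD
    rw [eval_prod] at h
    have h' := eval_intCast_map (Int.castRingHom ℂ) D (2 * n)
    push_cast at h'
    simp only [eval_add, eval_mul, eval_C, eval_X] at h
    rw [← h, h', eq_intCast]
  have hkev : Even (k - 1) := by
    have := Int.odd_coe_nat k |>.mp hkodd
    exact Nat.Odd.sub_odd this odd_one
  obtain ⟨u, hu⟩ := Int.eight_dvd_odd_pow_even_sub_one hg1 hkev
  obtain ⟨v, hv⟩ := hDE
  refine ⟨u + v + 8 * u * v, ?_⟩
  simp only [hfac, Finset.prod_mul_distrib, Finset.prod_pow, hG0, hprod]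
  have : g.eval 1 ^ (k - 1) * D.eval (2 * n : ℤ) = 1 + 8 * (u + v + 8 * u * v) := by
    rw [sub_eq_iff_eq_add.mp hu, sub_eq_iff_eq_add.mp hv]
    ring
  exact_mod_cast this
end

section
/- Let n, m ≥ 1, let s be an odd integer with 0 < s < 2n, and let f(x) = x^(2n) + x^(2n−s) + 1 and g(x) = x^(2m) + a_(2m−1)x^(2m−1) + ... + a_1 x + a_0 be polynomials with integer coefficients such that g(1) is odd. Furthermore suppose that a_(2m−1) is even whenever n = s. Then Disc(g(f(x))) ≡ Disc(g(x))^(2n) (mod 8). -/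
open Polynomial Finset

theorem roots_prod_univ_X_sub_C {R ι : Type*} [CommRing R] [IsDomain R] [Fintype ι] (x : ι → R) :
    (∏ i, (X - C (x i))).roots = univ.val.map x := by
  rw [← roots_multiset_prod_X_sub_C (univ.val.map x), Multiset.map_map]
  rfl

theorem exists_fin_prod_X_sub_C_eq {p : ℂ[X]} (hp : p.Monic) {N : ℕ} (hN : p.natDegree = N) :
    ∃ x : Fin N → ℂ, p = ∏ i, (X - C (x i)) := by
  have hs := IsAlgClosed.splits p
  have hl : p.roots.toList.length = N := by
    rw [Multiset.length_toList, ← hs.natDegree_eq_card_roots, hN]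
  subst hl
  refine ⟨p.roots.toList.get, ?_⟩
  have hr : univ.val.map p.roots.toList.get = p.roots := by
    rw [Fin.univ_val_map, List.ofFn_get, Multiset.coe_toList]
  conv_lhs => rw [hs.eq_prod_roots_of_monic hp, ← hr, Multiset.map_map]
  rfl

/-- The values of an integer polynomial at the roots of a monic integer polynomial multiply to an
integer. -/
theorem exists_int_eq_prod_eval_roots {ι : Type*} [Fintype ι] {p : ℤ[X]} (hp : p.Monic)
    {x : ι → ℂ} (hx : p.map (Int.castRingHom ℂ) = ∏ i, (X - C (x i))) (q : ℤ[X]) :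
    ∃ z : ℤ, ∏ i, (q.map (Int.castRingHom ℂ)).eval (x i) = z := by
  refine ⟨resultant p q p.natDegree q.natDegree, ?_⟩
  have h := resultant_eq_prod_eval (p.map (Int.castRingHom ℂ)) (q.map (Int.castRingHom ℂ))
    q.natDegree natDegree_map_le (IsAlgClosed.splits _)
  rw [hp.natDegree_map, resultant_map_map, (hp.map _).leadingCoeff, one_pow, one_mul, hx,
    roots_prod_univ_X_sub_C] at h
  simpa using h.symm

theorem prod_prod_Ioi_sub_sq_eq_prod_eval_derivative {R : Type*} [CommRing R] {N : ℕ}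
    (x : Fin N → R) :
    ∏ i, ∏ j ∈ Ioi i, (x i - x j) ^ 2 =
      (-1) ^ (N * (N - 1) / 2) * ∏ i, (derivative (∏ j, (X - C (x j)))).eval (x i) := by
  have hd (i : Fin N) : (derivative (∏ j, (X - C (x j)))).eval (x i) =
      ∏ j ∈ {i}ᶜ, (x i - x j) := by
    rw [derivative_prod_finset, eval_finsetSum, Finset.sum_eq_single i]
    · simp [eval_prod, Finset.compl_singleton]
    · intro j _ hj
      simp only [derivative_sub, derivative_X, derivative_C, sub_zero, mul_one, eval_prod]
      exact Finset.prod_eq_zero (i := i) (by simp [hj.symm]) (by simp)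
    · simp
  have hsign : ∏ i : Fin N, ∏ _j ∈ Ioi i, (-1 : R) = (-1) ^ (N * (N - 1) / 2) := by
    simp only [Finset.prod_const, Finset.prod_pow_eq_pow_sum, Fin.card_Ioi]
    rw [Fin.sum_univ_eq_sum_range (fun i => N - 1 - i) N, Finset.sum_range_reflect (fun i => i) N,
      Finset.sum_range_id]
  rw [← hsign, Finset.prod_congr rfl fun i _ => hd i,
    ← prod_prod_Ioi_mul_eq_prod_prod_off_diag (fun i j => x j - x i)]
  simp only [← Finset.prod_mul_distrib]
  exact Finset.prod_congr rfl fun i _ => Finset.prod_congr rfl fun j _ => by ring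

theorem newton_sum_trinomial {R : Type*} [CommRing R] {N s : ℕ} (hs : 0 < s) (hsN : s < N)
    (b : R) (x : Fin N → R) (hx : ∏ i, (X - C (x i)) = X ^ N + X ^ (N - s) + C b)
    {k : ℕ} (hk : 0 < k) :
    (∑ i, x i ^ k) + (if s < k then ∑ i, x i ^ (k - s) else 0) +
        (if N < k then b * ∑ i, x i ^ (k - N) else 0) =
      -((if k = s then (k : R) else 0) + if k = N then k * b else 0) := by
  set e : ℕ → R := fun j => (-1) ^ j * MvPolynomial.aeval x (MvPolynomial.esymm (Fin N) ℤ j)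
  have he (j : ℕ) : e j =
      (if j = 0 then 1 else 0) + (if j = s then 1 else 0) + (if j = N then b else 0) := by
    simp only [e, MvPolynomial.aeval_esymm_eq_multiset_esymm]
    rcases le_or_gt j N with hj | hj
    · have h := Multiset.prod_X_sub_C_coeff (univ.val.map x) (k := N - j) (by simp)
      rw [Multiset.map_map] at h
      simp only [Multiset.card_map, card_val, card_univ, Fintype.card_fin,
        Nat.sub_sub_self hj] at h
      rw [← h]
      change (∏ i, (X - C (x i))).coeff (N - j) = _
      rw [hx]
      simp only [coeff_add, coeff_X_pow, coeff_C]
      simp only [show N - j = N ↔ j = 0 by omega, show N - j = N - s ↔ j = s by omega,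
        show N - j = 0 ↔ j = N by omega]
    · rw [Multiset.esymm, Multiset.powersetCard_eq_empty]
      · simp [show j ≠ 0 by omega, show j ≠ s by omega, show j ≠ N by omega]
      · simpa using hj
  have h := congrArg (fun P => (-1) ^ k * MvPolynomial.aeval x P)
    (MvPolynomial.mul_esymm_eq_sum (Fin N) ℤ k)
  simp only [map_mul, map_sum, map_pow, map_neg, map_one, map_natCast] at h
  have h1 : (k : R) * e k = -∑ a ∈ antidiagonal k with a.1 < k, e a.1 * ∑ i, x i ^ a.2 := by
    have hp (r : ℕ) : MvPolynomial.aeval x (MvPolynomial.psum (Fin N) ℤ r) = ∑ i, x i ^ r := by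
      simp [MvPolynomial.psum]
    simp only [hp, pow_succ, ← mul_assoc, ← mul_pow] at h
    simp only [e]
    simp only [mul_neg_one, neg_mul, one_mul, neg_neg, one_pow] at h
    linear_combination h
  rw [Finset.sum_filter, Finset.Nat.sum_antidiagonal_eq_sum_range_succ_mk, sum_range_succ,
    if_neg (lt_irrefl k), add_zero,
    Finset.sum_congr rfl fun j hj => if_pos (Finset.mem_range.mp hj)] at h1
  simp only [he, add_mul, ite_mul, one_mul, zero_mul, sum_add_distrib, Finset.sum_ite_eq',
    Finset.mem_range, if_pos hk, Nat.sub_zero] at h1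
  rw [← neg_eq_iff_eq_neg.mpr h1, if_neg hk.ne']
  split_ifs <;> ring

theorem sum_pow_roots_trinomial {R : Type*} [CommRing R] {N s : ℕ} (hs : 0 < s) (hsN : s < N)
    (b : R) (x : Fin N → R) (hx : ∏ i, (X - C (x i)) = X ^ N + X ^ (N - s) + C b) :
    ∑ i, x i ^ s = -(s : R) := by
  have h := newton_sum_trinomial hs hsN b x hx hs
  simpa [hsN.ne, hsN.le.not_gt] using h

theorem sum_pow_two_mul_roots_trinomial {R : Type*} [CommRing R] {N s : ℕ} (hs : 0 < s)
    (hsN : s < N) (b : R) (x : Fin N → R)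
    (hx : ∏ i, (X - C (x i)) = X ^ N + X ^ (N - s) + C b) :
    ∑ i, x i ^ (2 * s) = s - if 2 * s = N then N * b else 0 := by
  have h := newton_sum_trinomial hs hsN b x hx (k := 2 * s) (by omega)
  have h0 : (if N < 2 * s then b * ∑ i, x i ^ (2 * s - N) else 0) = 0 := by
    split_ifs with hN
    · have h' := newton_sum_trinomial hs hsN b x hx (k := 2 * s - N) (by omega)
      rw [if_neg (by omega), if_neg (by omega), if_neg (by omega), if_neg (by omega)] at h'
      simp only [add_zero, neg_zero] at h'
      rw [h', mul_zero]
    · rfl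
  rw [h0, if_pos (by omega), if_neg (by omega : ¬ 2 * s = s), show 2 * s - s = s by omega,
    sum_pow_roots_trinomial hs hsN b x hx] at h
  have h2 : (if 2 * s = N then ((2 * s : ℕ) : R) * b else 0) = if 2 * s = N then N * b else 0 := by
    split_ifs with hN
    · rw [hN]
    · rfl
  rw [h2] at h
  linear_combination h

/-- In characteristic dividing `8`, a product of terms `k + 2 d y j` is determined by the first two
power sums of the `y j`. -/
theorem prod_add_two_mul_of_eight_eq_zero {R ι : Type*} [CommRing R] (h8 : (8 : R) = 0)
    {k : R} (hk : k ^ 2 = 1) (d : R) (y : ι → R) (S : Finset ι) :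
    ∏ j ∈ S, (k + 2 * d * y j) = k ^ #S * (1 + 2 * d * k * (∑ j ∈ S, y j) +
      2 * d ^ 2 * ((∑ j ∈ S, y j) ^ 2 - ∑ j ∈ S, y j ^ 2)) := by
  classical
  suffices h : (∃ e : R, (∑ j ∈ S, y j) ^ 2 - ∑ j ∈ S, y j ^ 2 = 2 * e) ∧
      ∏ j ∈ S, (k + 2 * d * y j) = k ^ #S * (1 + 2 * d * k * (∑ j ∈ S, y j) +
      2 * d ^ 2 * ((∑ j ∈ S, y j) ^ 2 - ∑ j ∈ S, y j ^ 2)) from h.2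
  induction S using Finset.induction_on with
  | empty => exact ⟨⟨0, by simp⟩, by simp⟩
  | insert a S ha ih =>
    obtain ⟨⟨e, he⟩, ih⟩ := ih
    rw [prod_insert ha, sum_insert ha, sum_insert ha, card_insert_of_notMem ha, ih]
    set p := ∑ j ∈ S, y j
    set q := ∑ j ∈ S, y j ^ 2
    refine ⟨⟨e + y a * p, by linear_combination he⟩, ?_⟩
    have hq : q = p ^ 2 - 2 * e := by linear_combination -he
    rw [hq, pow_succ]
    linear_combination (k ^ #S * d ^ 3 * e * y a) * h8 - (k ^ #S * 2 * d * y a) * hk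

theorem int_dvd_of_integralClosure_dvd {a z : ℤ} (ha : a ≠ 0)
    (h : (a : integralClosure ℤ ℂ) ∣ z) : a ∣ z := by
  obtain ⟨t, ht⟩ := h
  have ht' : (z : ℂ) = a * (t : ℂ) := by exact_mod_cast congrArg Subtype.val ht
  have ha' : (a : ℂ) ≠ 0 := by exact_mod_cast ha
  obtain ⟨k, hk⟩ := (IsIntegral.exists_int_iff_exists_rat t.2).mp
    ⟨(z : ℚ) / a, by push_cast; rw [ht']; field_simp⟩
  exact ⟨k, by rw [hk] at ht'; exact_mod_cast ht'⟩


/-- The roots of `g ∘ f` are the roots of the polynomials `f - γ i`, where `γ` enumerates the roots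
of `g`. -/
theorem exists_roots_comp {f g : ℂ[X]} (hf : f.Monic) {N M : ℕ} (hN : f.natDegree = N)
    (hN0 : 0 < N) {L : ℕ} {β : Fin L → ℂ} {γ : Fin M → ℂ}
    (hβ : g.comp f = ∏ i, (X - C (β i))) (hγ : g = ∏ i, (X - C (γ i))) :
    ∃ x : Fin M → Fin N → ℂ, (∀ i, ∏ l, (X - C (x i l)) = f - C (γ i)) ∧
      univ.val.map β = univ.val.map fun p : Fin M × Fin N => x p.1 p.2 := by
  have hlt (c : ℂ) : (C c).degree < f.degree :=
    degree_C_le.trans_lt (natDegree_pos_iff_degree_pos.mp (hN ▸ hN0))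
  choose x hx using fun i => exists_fin_prod_X_sub_C_eq (hf.sub_of_left (hlt (γ i)))
    (N := N) (by rw [natDegree_sub_C, hN])
  refine ⟨x, fun i => (hx i).symm, ?_⟩
  rw [← roots_prod_univ_X_sub_C, ← roots_prod_univ_X_sub_C, ← hβ, Fintype.prod_prod_type]
  simp only [← hx]
  rw [hγ]
  simp [Polynomial.prod_comp]

/-- If `g ∘ f` and `g` split with roots `β` and `γ`, the discriminant of `g ∘ f` is a power of that
of `g` times the product of the values of the derivative of `f` at `β j`. -/
theorem prod_prod_Ioi_sub_sq_comp {f g : ℂ[X]} (hf : f.Monic) {N M : ℕ} (hN : f.natDegree = N)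
    (hN0 : 0 < N) {L : ℕ} (hNe : Even N) (hL : Even (L * (L - 1) / 2))
    {β : Fin L → ℂ} {γ : Fin M → ℂ} (hβ : g.comp f = ∏ i, (X - C (β i)))
    (hγ : g = ∏ i, (X - C (γ i))) :
    ∏ i, ∏ j ∈ Ioi i, (β i - β j) ^ 2 =
      (∏ i, ∏ j ∈ Ioi i, (γ i - γ j) ^ 2) ^ N * ∏ j, (derivative f).eval (β j) := by
  obtain ⟨x, hx, hβx⟩ := exists_roots_comp hf hN hN0 hβ hγ
  have hxe (i : Fin M) (l : Fin N) : f.eval (x i l) = γ i := by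
    have h := congrArg (eval (x i l)) (hx i)
    rw [eval_prod, Finset.prod_eq_zero (mem_univ l) (by simp)] at h
    simpa [sub_eq_zero] using h.symm
  have hprod : ∏ j, (derivative g).eval (f.eval (β j)) =
      (∏ i, (derivative g).eval (γ i)) ^ N := by
    have h := congrArg (fun t => (t.map fun z => (derivative g).eval (f.eval z)).prod) hβx
    simp only [Multiset.map_map] at h
    change ∏ j, (derivative g).eval (f.eval (β j)) =
      ∏ p : Fin M × Fin N, (derivative g).eval (f.eval (x p.1 p.2)) at h
    simpa [h, Fintype.prod_prod_type, hxe] using Finset.prod_pow univ N _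
  rw [prod_prod_Ioi_sub_sq_eq_prod_eval_derivative, prod_prod_Ioi_sub_sq_eq_prod_eval_derivative,
    ← hβ, ← hγ, derivative_comp, hL.neg_one_pow, one_mul, mul_pow, ← pow_mul,
    (hNe.mul_left _).neg_one_pow, one_mul, ← hprod, mul_comm, ← Finset.prod_mul_distrib]
  simp [eval_comp, mul_comm]

theorem eight_dvd_prod_sub_one {n M s : ℕ} (hs : Odd s) (hsn : s < 2 * n) (L : ℕ) (hL : Even L)
    {β : Fin L → ℂ} (hβ : ∀ j, IsIntegral ℤ (β j)) {e w : ℤ}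
    (hp : ∑ j, β j ^ s = -(2 * M * s)) (hq : ∑ j, β j ^ (2 * s) = 2 * M * s - 4 * n * e)
    (hw : ∏ j, (((2 * n - s : ℕ) : ℂ) + 2 * n * β j ^ s) = w) : 8 ∣ w - 1 := by
  have hk : Odd (2 * n - s) := Nat.Even.sub_odd hsn.le (even_two_mul n) hs
  set k := 2 * n - s
  have hkZ : Odd (k : ℤ) := by exact_mod_cast hk
  have hk8 : 8 ∣ (k : ℤ) ^ 2 - 1 := Int.eight_dvd_sq_sub_one_of_odd hkZ
  apply int_dvd_of_integralClosure_dvd (by norm_num)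
  set O := integralClosure ℤ ℂ
  let y : Fin L → O := fun j => ⟨β j, hβ j⟩
  have hpO : ∑ j, y j ^ s = -(2 * M * s) := by
    apply Subtype.ext; push_cast; exact hp
  have hqO : ∑ j, y j ^ (2 * s) = 2 * M * s - 4 * n * e := by
    apply Subtype.ext; push_cast; exact hq
  have hwO : ∏ j, ((k : O) + 2 * n * y j ^ s) = w := by
    apply Subtype.ext; push_cast; exact hw
  let I : Ideal O := Ideal.span {8}
  let φ := Ideal.Quotient.mk I
  have h8 : (8 : O ⧸ I) = 0 := by
    rw [← map_ofNat φ 8]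
    exact Ideal.Quotient.eq_zero_iff_mem.mpr (Ideal.mem_span_singleton_self (8 : O))
  have hcast (a : ℤ) (ha : 8 ∣ a) : (a : O ⧸ I) = 0 := by
    obtain ⟨c, rfl⟩ := ha
    push_cast
    rw [h8, zero_mul]
  have hk2 : ((k : O ⧸ I)) ^ 2 = 1 := by
    have := hcast _ hk8
    push_cast at this
    exact sub_eq_zero.mp this
  have hP := congrArg φ hpO
  have hQ := congrArg φ hqO
  have hW := congrArg φ hwO
  simp only [map_sum, map_prod, map_pow, map_add, map_mul, map_neg, map_sub, map_natCast,
    map_intCast, map_ofNat, mul_comm 2 s, pow_mul] at hP hQ hW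
  have key := prod_add_two_mul_of_eight_eq_zero h8 hk2 (n : O ⧸ I) (fun j => φ (y j) ^ s) univ
  obtain ⟨l, rfl⟩ := hL
  have hpar : 8 ∣ (4 * n * M * s * (k + n) : ℤ) := by
    have h2 : (2 : ℤ) ∣ n * (k + n) := by
      rcases Int.even_or_odd (n : ℤ) with h | h
      · exact h.two_dvd.mul_right _
      · exact (hkZ.add_odd h).two_dvd.mul_left _
    obtain ⟨c, hc⟩ := h2
    exact ⟨M * s * c, by linear_combination 4 * M * s * hc⟩
  have hpar' := hcast _ hpar
  push_cast at hpar'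
  rw [hW, hP, hQ, card_univ, Fintype.card_fin, ← two_mul, pow_mul, hk2, one_pow, one_mul] at key
  have : (Int.cast 8 : O) = 8 := by norm_cast
  rw [this, ← Ideal.mem_span_singleton, ← Ideal.Quotient.eq_zero_iff_mem]
  push_cast
  rw [map_sub, map_intCast, map_one, key]
  linear_combination -hpar' + (n ^ 2 * M ^ 2 * s ^ 2 + n ^ 3 * e) * h8

/-- `Disc(g(f(x))) ≡ Disc(g(x))^(2n) (mod 8)`, where for a monic integer polynomial
the discriminant is `∏_{i<j} (x_i - x_j)^2` over an enumeration of its complex roots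
(with multiplicity). -/
theorem disc_comp_trinomial_mod_eight
    (n m s : ℕ) (hn : 1 ≤ n) (hm : 1 ≤ m)
    (hodd : Odd s) (hs : 0 < s) (hs2 : s < 2 * n)
    (a : Fin (2 * m) → ℤ)
    (f g : Polynomial ℤ)
    (hf : f = X ^ (2 * n) + X ^ (2 * n - s) + 1)
    (hg : g = X ^ (2 * m) + ∑ i : Fin (2 * m), C (a i) * X ^ (i : ℕ))
    (hg1 : Odd (g.eval 1))
    (hlead : n = s → Even (a ⟨2 * m - 1, by omega⟩))
    (β : Fin (4 * n * m) → ℂ) (γ : Fin (2 * m) → ℂ)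
    (hβ : (g.comp f).map (Int.castRingHom ℂ) = ∏ i, (X - C (β i)))
    (hγ : g.map (Int.castRingHom ℂ) = ∏ i, (X - C (γ i))) :
    ∃ k : ℤ,
      (∏ i, ∏ j ∈ Finset.Ioi i, (β i - β j) ^ 2)
        = (∏ i, ∏ j ∈ Finset.Ioi i, (γ i - γ j) ^ 2) ^ (2 * n) + 8 * (k : ℂ) := by
  have hn0 : 0 < 2 * n := by omega
  have hm0 : 0 < 2 * m := by omega
  set φ := Int.castRingHom ℂ
  have hfm : f.map φ = X ^ (2 * n) + X ^ (2 * n - s) + 1 := by simp [hf]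
  have hfdeg : f.natDegree = 2 * n := by
    rw [hf]; compute_degree!
    all_goals omega
  have hfmonic : f.Monic := by
    rw [hf]; monicity!
    all_goals first | omega | (split_ifs <;> omega)
  have hsumdeg : (∑ i : Fin (2 * m), C (a i) * X ^ (i : ℕ)).degree < ((2 * m : ℕ) : WithBot ℕ) := by
    rw [degree_lt_iff_coeff_zero]
    intro k hk
    rw [finsetSum_coeff]
    refine Finset.sum_eq_zero fun i _ => ?_
    rw [coeff_C_mul_X_pow, if_neg (by omega)]
  have hgmonic : g.Monic := hg ▸ monic_X_pow_add hsumdeg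
  have hFmonic : (g.comp f).Monic := hgmonic.comp hfmonic (by omega)
  have hfmdeg : (f.map φ).natDegree = 2 * n := by rw [hfmonic.natDegree_map, hfdeg]
  have hβ' : (g.map φ).comp (f.map φ) = ∏ i, (X - C (β i)) := by rw [← map_comp, hβ]
  have hγsum : ∑ i, γ i = -(a ⟨2 * m - 1, by omega⟩ : ℂ) := by
    have h := prod_X_sub_C_coeff_card_pred univ γ (by simpa using hm0)
    rw [← hγ, card_univ, Fintype.card_fin, coeff_map, hg, coeff_add, coeff_X_pow,
      if_neg (by omega), finsetSum_coeff, Finset.sum_eq_single ⟨2 * m - 1, by omega⟩] at h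
    · simp [φ] at h
      rw [h, neg_neg]
    · intro i _ hi
      rw [coeff_C_mul_X_pow, if_neg fun h' => hi (Fin.ext h'.symm)]
    · simp
  obtain ⟨x, hx, hβx⟩ := exists_roots_comp (hfmonic.map φ) hfmdeg hn0 hβ' hγ
  have hsum (r : ℕ) : ∑ j, β j ^ r = ∑ i, ∑ l, x i l ^ r := by
    have h := congrArg (fun t => (t.map fun z => z ^ r).sum) hβx
    simp only [Multiset.map_map] at h
    change ∑ j, β j ^ r = ∑ p : Fin (2 * m) × Fin (2 * n), x p.1 p.2 ^ r at h
    rw [h, Fintype.sum_prod_type]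
  have hx' (i : Fin (2 * m)) :
      ∏ l, (X - C (x i l)) = X ^ (2 * n) + X ^ (2 * n - s) + C (1 - γ i) := by
    rw [hx, hfm, C_sub, C_1]; ring
  have hp : ∑ j, β j ^ s = -(2 * m * s) := by
    rw [hsum, Finset.sum_congr rfl fun i _ => sum_pow_roots_trinomial hs hs2 _ _ (hx' i)]
    simp
  obtain ⟨e, hq⟩ : ∃ e : ℤ, ∑ j, β j ^ (2 * s) = 2 * m * s - 4 * n * (e : ℂ) := by
    rw [hsum, Finset.sum_congr rfl fun i _ => sum_pow_two_mul_roots_trinomial hs hs2 _ _ (hx' i)]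
    by_cases hns : n = s
    · obtain ⟨c, hc⟩ := hlead hns
      rw [hc] at hγsum
      refine ⟨m + c, ?_⟩
      simp only [if_pos (congrArg (2 * ·) hns.symm), Finset.sum_sub_distrib, ← Finset.mul_sum, hγsum]
      simp
      ring
    · refine ⟨0, ?_⟩
      simp [show ¬ s = n from fun h => hns h.symm]
  have hβint (j) : IsIntegral ℤ (β j) := by
    refine ⟨g.comp f, hFmonic, ?_⟩
    change eval₂ φ (β j) (g.comp f) = 0
    rw [eval₂_eq_eval_map, hβ, eval_prod]
    exact Finset.prod_eq_zero (mem_univ j) (by simp)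
  obtain ⟨w, hw⟩ := exists_int_eq_prod_eval_roots hFmonic hβ
    (C ((2 * n - s : ℕ) : ℤ) + C (2 * n : ℤ) * X ^ s)
  have hw8 : 8 ∣ w - 1 := eight_dvd_prod_sub_one (M := m) hodd hs2 (4 * n * m) (by grind) hβint
    hp hq (by rw [← hw]; simp)
  have hβprod : ∏ j, β j = ((g.eval 1 : ℤ) : ℂ) := by
    have h := congrArg (eval 0) hβ
    rw [eval_prod, ← map_zero φ, eval_map_apply, eval_comp, hf] at h
    simp only [eval_add, eval_pow, eval_X, eval_one, zero_pow hn0.ne',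
      zero_pow (show 2 * n - s ≠ 0 by omega), zero_add, map_zero, eval_sub, eval_C, zero_sub,
      Finset.prod_neg, card_univ, Fintype.card_fin] at h
    rw [(show Even (4 * n * m) by grind).neg_one_pow, one_mul] at h
    exact h.symm
  have hder : ∏ j, (derivative (f.map φ)).eval (β j) =
      ((g.eval 1 : ℤ) : ℂ) ^ (2 * n - s - 1) * w := by
    rw [← hw, ← hβprod, ← Finset.prod_pow, ← Finset.prod_mul_distrib]
    refine Finset.prod_congr rfl fun j _ => ?_
    rw [hfm]
    simp only [derivative_add, derivative_X_pow, derivative_one, eval_add, eval_mul, eval_C,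
      eval_pow, eval_X, eval_zero, Polynomial.map_add, Polynomial.map_mul, Polynomial.map_pow,
      map_C, map_X, map_natCast, map_mul, eval_natCast]
    rw [show 2 * n - 1 = 2 * n - s - 1 + s by omega, pow_add]
    simp
    ring
  have hg8 : 8 ∣ (g.eval 1) ^ (2 * n - s - 1) - 1 := by
    obtain ⟨t, ht⟩ : Even (2 * n - s - 1) := by grind
    rw [ht, ← two_mul, pow_mul]
    exact (Int.eight_dvd_sq_sub_one_of_odd hg1).trans (sub_one_dvd_pow_sub_one _ _)
  obtain ⟨G, hG⟩ := exists_int_eq_prod_eval_roots hgmonic hγ (derivative g)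
  obtain ⟨u, hu⟩ := hw8
  obtain ⟨v, hv⟩ := hg8
  have hL : Even (4 * n * m * (4 * n * m - 1) / 2) := by
    rw [show 4 * n * m * (4 * n * m - 1) = 2 * (n * m * (4 * n * m - 1)) * 2 by ring,
      Nat.mul_div_cancel _ two_pos]
    exact even_two_mul _
  have hGpow : (∏ i, ∏ j ∈ Ioi i, (γ i - γ j) ^ 2) ^ (2 * n) = (G : ℂ) ^ (2 * n) := by
    rw [prod_prod_Ioi_sub_sq_eq_prod_eval_derivative, ← hγ, mul_pow, ← pow_mul,
      ((even_two_mul n).mul_left _).neg_one_pow, one_mul, derivative_map, hG]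
  rw [prod_prod_Ioi_sub_sq_comp (hfmonic.map φ) hfmdeg hn0 (even_two_mul n) hL hβ' hγ, hGpow, hder]
  refine ⟨G ^ (2 * n) * (u + v * w), ?_⟩
  have hu' : (w : ℂ) - 1 = 8 * u := by exact_mod_cast hu
  have hv' : ((g.eval 1 : ℤ) : ℂ) ^ (2 * n - s - 1) - 1 = 8 * v := by exact_mod_cast hv
  push_cast
  linear_combination (G : ℂ) ^ (2 * n) * (hu' + w * hv')
end

section
/- Let K be a field and let u(x), v(x) ∈ K[x] be of degrees m ≥ 2 and n ≥ 1ically with leading coefficients a and b, respectively. Suppose the derivative u'(x) is nonzero of degree l. Then Res(u(v(x)), u'(v(x))) = [(−1)^(m(m−1)/2) · a^(l+2−m) · b^(ml)]^n · Disc(u(x))^n, where a^(l+2−m) denotes the (possibly negative) integer power of the nonzero element a in K. -/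
open Polynomial Finset

theorem Finset.prod_prod_erase_sub {R : Type*} [CommRing R] {m : ℕ} (γ : Fin m → R) :
    ∏ i, ∏ j ∈ univ.erase i, (γ i - γ j)
      = (-1) ^ (m * (m - 1) / 2) * ∏ i, ∏ j ∈ Ioi i, (γ i - γ j) ^ 2 := by
  have hsign : ∏ i : Fin m, ∏ _j ∈ Ioi i, (-1 : R) = (-1) ^ (m * (m - 1) / 2) := by
    simp only [prod_const, Fin.card_Ioi, prod_pow_eq_pow_sum]
    rw [Fin.sum_univ_eq_sum_range (fun i => m - 1 - i), sum_range_reflect (fun i => i),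
      sum_range_id]
  have hsplit (i : Fin m) : univ.erase i = Iio i ∪ Ioi i := by
    ext j
    simp [lt_or_lt_iff_ne]
  have hdisj (i : Fin m) : Disjoint (Iio i) (Ioi i) := by
    rw [disjoint_left]
    intro j h h'
    simp only [mem_Iio, mem_Ioi] at h h'
    exact lt_asymm h h'
  simp_rw [hsplit, prod_union (hdisj _), prod_mul_distrib]
  rw [prod_comm' (t' := univ) (s' := fun j => Ioi j) (by simp), ← hsign, ← prod_mul_distrib,
    ← prod_mul_distrib]
  refine prod_congr rfl fun i _ => ?_
  rw [← prod_mul_distrib, ← prod_mul_distrib]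
  refine prod_congr rfl fun j _ => ?_
  ring

theorem Polynomial.prod_eval_derivative_of_eq_prod {F : Type*} [Field F] {m : ℕ} {U : F[X]}
    {a : F} {γ : Fin m → F} (hU : U = C a * ∏ i, (X - C (γ i))) :
    ∏ i, (derivative U).eval (γ i)
      = a ^ m * ((-1) ^ (m * (m - 1) / 2) * ∏ i, ∏ j ∈ Ioi i, (γ i - γ j) ^ 2) := by
  rw [← Finset.prod_prod_erase_sub]
  have h (i : Fin m) :
      (derivative U).eval (γ i) = a * ∏ j ∈ univ.erase i, (γ i - γ j) := by
    have := Lagrange.eval_nodal_derivative_eval_node_eq (v := γ) (mem_univ i)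
    rw [Lagrange.eval_nodal] at this
    rw [← this, hU, derivative_C_mul, eval_C_mul, Lagrange.nodal]
  simp [h, prod_mul_distrib]

theorem Polynomial.prod_eval_comp_of_eq_prod {F : Type*} [Field F] {m N : ℕ} {U V : F[X]}
    {a c : F} {β : Fin N → F} {γ : Fin m → F} (hc : c ≠ 0)
    (hUV : U.comp V = C c * ∏ i, (X - C (β i))) (hU : U = C a * ∏ i, (X - C (γ i)))
    (G : F[X]) :
    ∏ i, (G.comp V).eval (β i) = (∏ j, G.eval (γ j)) ^ V.natDegree := by
  have hβ0 : C c * ∏ i, (X - C (β i)) ≠ 0 :=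
    mul_ne_zero (C_ne_zero.2 hc) (prod_ne_zero_iff.2 fun i _ => X_sub_C_ne_zero _)
  have hcomp : C a * ∏ j, (V - C (γ j)) = C c * ∏ i, (X - C (β i)) := by
    rw [← hUV, hU]
    simp [prod_comp]
  have ha : a ≠ 0 := by
    rintro rfl
    simp [← hcomp] at hβ0
  have hprod : ∏ j, (V - C (γ j)) ≠ 0 := right_ne_zero_of_mul (hcomp ▸ hβ0)
  have hroots : univ.val.map β = univ.val.bind fun j => (V - C (γ j)).roots := by
    rw [← roots_prod _ _ hprod, ← roots_C_mul _ ha, hcomp, roots_C_mul _ hc,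
      roots_prod _ _ (right_ne_zero_of_mul hβ0)]
    simp_rw [roots_X_sub_C, Multiset.bind_singleton]
  have hcard (j : Fin m) : (V - C (γ j)).roots.card = V.natDegree := by
    rw [← natDegree_sub_C (a := γ j)]
    refine (Splits.natDegree_eq_card_roots (Splits.of_dvd ?_ hβ0 ?_)).symm
    · exact (Splits.C _).mul (Splits.prod fun i _ => Splits.X_sub_C _)
    · rw [← hcomp]
      exact (dvd_prod_of_mem _ (mem_univ j)).mul_left _
  calc ∏ i, (G.comp V).eval (β i)
      = ((univ.val.map β).map fun x => (G.comp V).eval x).prod := by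
        rw [Multiset.map_map]; rfl
    _ = ∏ j, ((V - C (γ j)).roots.map fun x => (G.comp V).eval x).prod := by
        rw [hroots, Multiset.map_bind, Multiset.prod_bind]; rfl
    _ = ∏ j, G.eval (γ j) ^ V.natDegree := by
        refine prod_congr rfl fun j _ => ?_
        rw [← hcard j, ← Multiset.prod_replicate, ← Multiset.map_const']
        congr 1
        refine Multiset.map_congr rfl fun x hx => ?_
        have := isRoot_of_mem_roots hx
        rw [IsRoot, eval_sub, eval_C, sub_eq_zero] at this
        rw [eval_comp, this]
    _ = _ := prod_pow _ _ _

/-- `Res(u(v(x)), u'(v(x))) = [(-1)^(m(m-1)/2) a^(l+2-m) b^(ml)]^n · Disc(u)^n`.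
Here, over a field extension `L` of `K` in which `u ∘ v` (and hence `u`) splits,
`Res(F, G) = A^(deg G) ∏_i G(x_i)` where `A` is the leading coefficient of `F`
and the `x_i` enumerate the roots of `F` with multiplicity, and
`Disc(u) = a^(2m-2) ∏_{i<j} (γ_i - γ_j)^2` over an enumeration `γ` of the roots
of `u` with multiplicity. -/
theorem resultant_comp_derivative_comp
    (K L : Type*) [Field K] [Field L] [Algebra K L]
    (u v : Polynomial K) (m n l : ℕ)
    (hm : 2 ≤ m) (hn : 1 ≤ n)
    (hum : u.natDegree = m) (hvn : v.natDegree = n)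
    (a b : K) (ha : a = u.leadingCoeff) (hb : b = v.leadingCoeff)
    (hu' : derivative u ≠ 0) (hl : (derivative u).natDegree = l)
    (β : Fin (m * n) → L) (γ : Fin m → L)
    (hβ : (u.comp v).map (algebraMap K L)
      = C (algebraMap K L (a * b ^ m)) * ∏ i, (X - C (β i)))
    (hγ : u.map (algebraMap K L) = C (algebraMap K L a) * ∏ i, (X - C (γ i))) :
    (algebraMap K L (a * b ^ m)) ^ (l * n)
        * ∏ i, Polynomial.eval (β i) (((derivative u).comp v).map (algebraMap K L))
      = ((-1) ^ (m * (m - 1) / 2) * (algebraMap K L a) ^ ((l : ℤ) + 2 - (m : ℤ))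
            * (algebraMap K L b) ^ (m * l)) ^ n
        * ((algebraMap K L a) ^ (2 * m - 2)
            * ∏ i, ∏ j ∈ Finset.Ioi i, (γ i - γ j) ^ 2) ^ n := by
  have hu0 : u ≠ 0 := by
    rintro rfl
    simp at hu'
  have hv0 : v ≠ 0 := by
    rintro rfl
    simp at hvn
    omega
  have ha0 : algebraMap K L a ≠ 0 := by simpa [ha] using hu0
  have hb0 : algebraMap K L b ≠ 0 := by simpa [hb] using hv0
  have hVdeg : (v.map (algebraMap K L)).natDegree = n := by rw [natDegree_map, hvn]
  rw [map_comp] at hβ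
  have hcomp := prod_eval_comp_of_eq_prod
    (by rw [map_mul, map_pow]; exact mul_ne_zero ha0 (pow_ne_zero _ hb0)) hβ hγ
    (derivative (u.map (algebraMap K L)))
  rw [prod_eval_derivative_of_eq_prod hγ, hVdeg, derivative_map] at hcomp
  have hpow : (algebraMap K L a) ^ ((l : ℤ) + 2 - (m : ℤ)) * (algebraMap K L a) ^ (2 * m - 2)
      = (algebraMap K L a) ^ (l + m) := by
    rw [← zpow_natCast, ← zpow_natCast, ← zpow_add₀ ha0]
    congr 1
    push_cast [show 2 ≤ 2 * m by omega]
    ring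
  rw [map_comp, hcomp, pow_mul, ← mul_pow, ← mul_pow]
  congr 1
  rw [map_mul, map_pow]
  linear_combination (-(-1) ^ (m * (m - 1) / 2) * (algebraMap K L b) ^ (m * l)
    * ∏ i, ∏ j ∈ Finset.Ioi i, (γ i - γ j) ^ 2) * hpow
end

section
/- Let p > 2 be a prime, t ≥ 1, and q = p^t. Let n, m ≥ 1 and s ≥ 0 be integers with p dividing n and 2s+1 < 2n, and let a, b ∈ F_q. Let f(x) = x^(2n) + a·x^(2s+1) + b ∈ F_q[x], and let g(x) ∈ F_q[x] be a monic polynomial of degree 2m. Then g(f(x)) is reducible over F_q. -/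
open Polynomial

theorem coe_finRotate_eq_mod {n : ℕ} (i : Fin n) : (finRotate n i : ℕ) = (i + 1) % n := by
  cases n with
  | zero => exact i.elim0
  | succ n => simp [Fin.val_add]

/-- In even degree the discriminant of an extension of finite fields of odd characteristic is not
a square, because Frobenius permutes the conjugates by an odd cycle. -/
theorem FiniteField.not_isSquare_discr {K L ι : Type*} [Field K] [Fintype K] [Field L] [Finite L]
    [Algebra K L] [Fintype ι] [DecidableEq ι] (hK : ringChar K ≠ 2)
    (heven : Even (Module.finrank K L)) (b : Module.Basis ι K L) :
    ¬ IsSquare (Algebra.discr K b) := by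
  have e₀ : ι ≃ Fin (Module.finrank K L) :=
    Fintype.equivFinOfCardEq (Module.finrank_eq_card_basis b).symm
  rw [← Algebra.discr_reindex K b e₀, ← Module.Basis.coe_reindex]
  generalize b.reindex e₀ = b
  rintro ⟨c, hc⟩
  have hc0 : c ≠ 0 := by
    rintro rfl
    exact Algebra.discr_not_zero_of_basis K b (by simpa using hc)
  let M : Matrix (Fin (Module.finrank K L)) (Fin (Module.finrank K L)) L :=
    .of fun i j ↦ b i ^ Fintype.card K ^ (j : ℕ)
  have hdisc : algebraMap K L c ^ 2 = M.det ^ 2 := by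
    have hM : (algebraMap K L).mapMatrix (Algebra.traceMatrix K b) = M * M.transpose := by
      ext i j
      simp [M, Matrix.mul_apply, Algebra.traceMatrix_apply, Algebra.traceForm_apply,
        FiniteField.algebraMap_trace_eq_sum_pow, mul_pow, Finset.sum_range]
    have hdet := congrArg Matrix.det hM
    rwa [← RingHom.map_det, ← Algebra.discr_def, hc, map_mul, Matrix.det_mul,
      Matrix.det_transpose, ← pow_two, ← pow_two] at hdet
  rw [sq_eq_sq_iff_eq_or_eq_neg] at hdisc
  have hfix : FiniteField.frobeniusAlgHom K L M.det = M.det := by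
    have : M.det = algebraMap K L c ∨ M.det = algebraMap K L (-c) := by
      rcases hdisc with h | h
      · exact .inl h.symm
      · exact .inr (by rw [map_neg, h, neg_neg])
    rcases this with h | h <;> rw [h, AlgHom.commutes]
  have hrot : (FiniteField.frobeniusAlgHom K L).toRingHom.mapMatrix M =
      M.submatrix id (finRotate _) := by
    ext i j
    suffices b i ^ Fintype.card K ^ (j + 1 : ℕ) =
        b i ^ Fintype.card K ^ (finRotate _ j : ℕ) by
      simpa [M, ← pow_mul, pow_succ] using this
    rw [coe_finRotate_eq_mod]
    rcases Nat.lt_or_eq_of_le j.is_lt with hj | hj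
    · rw [Nat.mod_eq_of_lt hj]
    · have := Fintype.ofFinite L
      rw [← Nat.succ_eq_add_one, hj, Nat.mod_self, ← Module.card_eq_pow_finrank,
        FiniteField.pow_card, pow_zero, pow_one]
  have hneg : FiniteField.frobeniusAlgHom K L M.det = -M.det := by
    have hodd : Odd (Module.finrank K L - 1) :=
      Nat.Even.sub_odd Module.finrank_pos heven odd_one
    have := (FiniteField.frobeniusAlgHom K L).toRingHom.map_det M
    rw [hrot, Matrix.det_permute', sign_finRotate, hodd.neg_one_pow] at this
    simpa using this
  have hL : ringChar L ≠ 2 := by rwa [← Algebra.ringChar_eq K L]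
  have hdet : M.det = 0 := (Ring.eq_self_iff_eq_zero_of_char_ne_two hL).1 (hneg.symm.trans hfix)
  rw [hdet] at hdisc
  simp [hc0] at hdisc

theorem Algebra.isSquare_norm_algebraMap_of_even_finrank {K F L : Type*} [Field K] [Field F]
    [Field L] [Algebra K F] [Algebra F L] [Algebra K L] [IsScalarTower K F L]
    (heven : Even (Module.finrank F L)) (x : F) :
    IsSquare (Algebra.norm K (algebraMap F L x)) := by
  rw [← Algebra.norm_norm (S := F), Algebra.norm_algebraMap, map_pow]
  exact heven.isSquare_pow _

theorem Polynomial.irreducible_of_irreducible_comp {K : Type*} [Field K] {f g : K[X]}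
    (hf : f.natDegree ≠ 0) (h : Irreducible (g.comp f)) : Irreducible g := by
  have hloc : IsLocalHom (compRingHom f) := by
    refine ⟨fun u hu ↦ ?_⟩
    have hu0 : u ≠ 0 := by
      rintro rfl
      simp at hu
    have := natDegree_eq_zero_of_isUnit hu
    rw [coe_compRingHom_apply, natDegree_comp, mul_eq_zero] at this
    rw [isUnit_iff_degree_eq_zero, degree_eq_natDegree hu0, this.resolve_right hf]
    rfl
  exact Irreducible.of_map (f := compRingHom f) h

theorem comp_even_trinomial_reducible_odd_char
    (p t : ℕ) (hp : p.Prime) (hp2 : 2 < p) (ht : 1 ≤ t)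
    (K : Type*) [Field K] [Fintype K] (hcard : Fintype.card K = p ^ t)
    (n m s : ℕ) (hn : 1 ≤ n) (hm : 1 ≤ m) (hpn : p ∣ n) (hs : 2 * s + 1 < 2 * n)
    (a b : K)
    (f g : Polynomial K)
    (hf : f = X ^ (2 * n) + C a * X ^ (2 * s + 1) + C b)
    (hgmonic : g.Monic) (hgdeg : g.natDegree = 2 * m) :
    ¬ Irreducible (g.comp f) := by
  intro hirr
  have : Fact p.Prime := ⟨hp⟩
  have : CharP K p := charP_of_card_eq_prime_pow hcard
  have hnK : (n : K) = 0 := (CharP.cast_eq_zero_iff K p n).2 hpn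
  have hf_eq : f = X ^ (2 * n) + (C a * X ^ (2 * s + 1) + C b) := by rw [hf, add_assoc]
  have hlow : (C a * X ^ (2 * s + 1) + C b).degree < ((2 * n : ℕ) : WithBot ℕ) :=
    (degree_le_of_natDegree_le (by compute_degree)).trans_lt (Nat.cast_lt.2 hs)
  have hfmonic : f.Monic := by
    rw [hf_eq]
    exact monic_X_pow_add hlow
  have hfdeg : f.natDegree = 2 * n := by
    rw [hf_eq]
    refine natDegree_eq_of_degree_eq_some ?_
    rw [degree_add_eq_left_of_degree_lt (by rwa [degree_X_pow]), degree_X_pow]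
  have hder : derivative f = C ((2 * s + 1) * a) * X ^ (2 * s) := by
    simp [hf, hnK, derivative_X_pow]
    ring
  have hgirr : Irreducible g := Polynomial.irreducible_of_irreducible_comp (by omega) hirr
  have hcomp : (g.comp f).Monic := hgmonic.comp hfmonic (by omega)
  have : Fact (Irreducible (g.comp f)) := ⟨hirr⟩
  let pb := AdjoinRoot.powerBasis hirr.ne_zero
  have hfin : FiniteDimensional K (AdjoinRoot (g.comp f)) := pb.finite
  have : Finite (AdjoinRoot (g.comp f)) := Module.finite_of_finite K
  have hmin : minpoly K pb.gen = g.comp f := AdjoinRoot.minpoly_powerBasis_gen_of_monic hcomp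
  have hdim : Module.finrank K (AdjoinRoot (g.comp f)) = 2 * m * (2 * n) := by
    rw [pb.finrank, AdjoinRoot.powerBasis_dim, natDegree_comp, hgdeg, hfdeg]
  have hevendim : Even (2 * m * (2 * n)) := ⟨m * (2 * n), by ring⟩
  refine FiniteField.not_isSquare_discr ?_ (hdim ▸ hevendim) pb.basis ?_
  · rw [ringChar.eq K p]
    omega
  set β := aeval pb.gen f with hβ
  have hβroot : aeval β g = 0 := by
    rw [hβ, ← aeval_comp]
    simpa only [hmin] using minpoly.aeval K pb.gen
  have hβmin : minpoly K β = g := (minpoly.eq_of_irreducible_of_monic hgirr hβroot hgmonic).symm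
  have hβdim : Even (Module.finrank (IntermediateField.adjoin K {β})
      (AdjoinRoot (g.comp f))) := by
    have h := Module.finrank_mul_finrank K (IntermediateField.adjoin K {β})
      (AdjoinRoot (g.comp f))
    rw [IntermediateField.adjoin.finrank (Algebra.IsIntegral.isIntegral β), hβmin, hgdeg, hdim] at h
    exact ⟨n, by rw [Nat.eq_of_mul_eq_mul_left (by omega) h, two_mul]⟩
  have hβnorm : IsSquare (Algebra.norm K (aeval β (derivative g))) := by
    rw [← IntermediateField.AdjoinSimple.algebraMap_gen K β, aeval_algebraMap_apply]
    exact Algebra.isSquare_norm_algebraMap_of_even_finrank hβdim _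
  rw [Algebra.discr_powerBasis_eq_norm, hmin, derivative_comp, map_mul, map_mul, aeval_comp, ← hβ,
    hdim, hder, map_mul, aeval_C, map_mul, map_pow, aeval_X, map_pow]
  refine .mul (Even.isSquare_pow ?_ _) (.mul (.mul ?_ ?_) hβnorm)
  · refine ⟨m * n * (2 * m * (2 * n) - 1), Nat.div_eq_of_eq_mul_left two_pos ?_⟩
    ring
  · rw [Algebra.norm_algebraMap, hdim]
    exact hevendim.isSquare_pow _
  · exact (even_two_mul s).isSquare_pow _
end

section
/- Let p > 2 be a prime, t ≥ 1, and q = p^t. Let n ≥ 1 and s ≥ 0 be integers with p dividing n and 2s+1 < 2n, and let a, b ∈ F_q. Then the trinomial f(x) = x^(2n) + a·x^(2s+1) + b ∈ F_q[x] is not stable over F_q. -/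
open Polynomial

/-- Over a finite field of odd characteristic, the discriminant of a basis of an extension of even
degree is not a square. -/
theorem not_isSquare_discr_of_even {K L : Type*} [Field K] [Finite K] [Field L] [Algebra K L]
    (hK : (2 : K) ≠ 0) {m : ℕ} (hm : Even m) (b : Module.Basis (Fin m) K L) :
    ¬ IsSquare (Algebra.discr K b) := by
  have := Fintype.ofFinite K
  have : Module.Finite K L := .of_basis b
  have : Finite L := Module.finite_of_finite K
  have hfin : Module.finrank K L = m := by simpa using Module.finrank_eq_card_basis b
  subst hfin
  set φ := FiniteField.frobeniusAlgEquivOfAlgebraic K L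
  set e := Equiv.ofBijective _ (FiniteField.bijective_frobeniusAlgEquivOfAlgebraic_pow K L)
  set A : Matrix (Fin (Module.finrank K L)) (Fin (Module.finrank K L)) L :=
    Matrix.of fun i j ↦ (φ ^ (i : ℕ)) (b j) with hA
  have hdisc : algebraMap K L (Algebra.discr K b) = A.det ^ 2 := by
    have htr : (Algebra.traceMatrix K b).map (algebraMap K L) = A.transpose * A := by
      ext i j
      simp only [Matrix.map_apply, Algebra.traceMatrix_apply, Algebra.traceForm_apply,
        trace_eq_sum_automorphisms, Matrix.mul_apply, Matrix.transpose_apply, hA, Matrix.of_apply,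
        ← map_mul]
      exact (e.sum_comp fun σ ↦ σ (b i * b j)).symm
    rw [Algebra.discr_def, RingHom.map_det, RingHom.mapMatrix_apply, htr, Matrix.det_mul,
      Matrix.det_transpose, sq]
  have hpos : 0 < Module.finrank K L := Module.finrank_pos
  have hfrob : φ A.det = -A.det := by
    have hrot : φ.toRingEquiv.toRingHom.mapMatrix A = A.submatrix (finRotate _) id := by
      ext i j
      have hpow : φ ^ ((finRotate _ i : Fin _) : ℕ) = φ ^ ((i : ℕ) + 1) := by
        rw [finRotate_apply]
        have := i.neZero
        rw [Fin.val_add, Fin.val_one', Nat.add_mod_mod, ← pow_mod_orderOf φ (i + 1),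
          FiniteField.orderOf_frobeniusAlgEquivOfAlgebraic]
      simp only [Matrix.submatrix_apply, hA, Matrix.of_apply, hpow, pow_succ', id]
      rfl
    have hdet : φ A.det = (φ.toRingEquiv.toRingHom.mapMatrix A).det :=
      RingHom.map_det φ.toRingEquiv.toRingHom A
    rw [hdet, hrot, Matrix.det_permute, sign_finRotate,
      (Nat.Even.sub_odd hpos hm odd_one).neg_one_pow]
    simp
  rintro ⟨y, hy⟩
  have hfix : φ A.det = A.det := by
    rw [hy, map_mul, ← sq, eq_comm, sq_eq_sq_iff_eq_or_eq_neg] at hdisc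
    rcases hdisc with h | h <;> simp [h]
  have h2 : (2 : L) ≠ 0 := by
    simpa only [map_ofNat] using (map_ne_zero (algebraMap K L)).2 hK
  have hzero : A.det = 0 := by
    have : 2 * A.det = 0 := by linear_combination hfrob - hfix
    simpa [h2] using this
  rw [hzero, zero_pow two_ne_zero, map_eq_zero] at hdisc
  exact Algebra.discr_not_zero_of_basis K b hdisc

/-- If `f` and `f ∘ f` are monic irreducible and `β` is a root of `f ∘ f` generating `M`, then the
minimal polynomial of `β` over `K(f(β))` is `f - f(β)`. -/
theorem minpoly_adjoin_aeval_eq {K M : Type*} [Field K] [Field M] [Algebra K M] {f : K[X]}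
    (hf : f.Monic) (hirr : Irreducible f) (hirr₂ : Irreducible (f.comp f)) {β : M}
    (hβ : aeval β (f.comp f) = 0) (htop : IntermediateField.adjoin K {β} = ⊤) :
    minpoly (IntermediateField.adjoin K {aeval β f}) β =
      f.map (algebraMap K (IntermediateField.adjoin K {aeval β f})) -
        C (IntermediateField.AdjoinSimple.gen K (aeval β f)) := by
  have hdeg : 0 < f.natDegree := hirr.natDegree_pos
  have hf₂ : (f.comp f).Monic := hf.comp hf hdeg.ne'
  have hintβ : IsIntegral K β := ⟨_, hf₂, hβ⟩
  have hα : aeval (aeval β f) f = 0 := by rwa [← aeval_comp]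
  have hintα : IsIntegral K (aeval β f) := ⟨_, hf, hα⟩
  have hKM : Module.finrank K M = f.natDegree * f.natDegree := by
    rw [← IntermediateField.finrank_top', ← htop, IntermediateField.adjoin.finrank hintβ,
      ← minpoly.eq_of_irreducible_of_monic hirr₂ hβ hf₂, natDegree_comp]
  set L := IntermediateField.adjoin K {aeval β f}
  have hKL : Module.finrank K L = f.natDegree := by
    rw [IntermediateField.adjoin.finrank hintα, ← minpoly.eq_of_irreducible_of_monic hirr hα hf]
  have hLM : Module.finrank L M = f.natDegree := by
    have := Module.finrank_mul_finrank K L M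
    rw [hKM, hKL] at this
    exact Nat.eq_of_mul_eq_mul_left hdeg this
  have hmin : (minpoly L β).natDegree = f.natDegree := by
    rw [← IntermediateField.adjoin.finrank hintβ.tower_top,
      IntermediateField.adjoin_eq_top_of_adjoin_eq_top K htop, IntermediateField.finrank_top', hLM]
  have hgdeg : (f.map (algebraMap K L) - C (IntermediateField.AdjoinSimple.gen K
      (aeval β f))).natDegree = f.natDegree := by
    rw [natDegree_sub_C, natDegree_map]
  have hgmonic : (f.map (algebraMap K L) - C (IntermediateField.AdjoinSimple.gen K
      (aeval β f))).Monic := by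
    refine (hf.map _).sub_of_left ?_
    rw [degree_map]
    exact degree_C_le.trans_lt (natDegree_pos_iff_degree_pos.1 hdeg)
  refine (eq_of_monic_of_dvd_of_natDegree_le (minpoly.monic hintβ.tower_top) hgmonic
    (minpoly.dvd _ _ ?_) (by rw [hgdeg, hmin])).symm
  simp [aeval_map_algebraMap]

/-- Over a finite field of odd characteristic, the second iterate of a monic polynomial of even
degree whose derivative is a constant times a square is reducible. -/
theorem not_irreducible_comp_self_of_derivative_eq {K : Type*} [Field K] [Finite K]
    (hK : (2 : K) ≠ 0) {f g : K[X]} {c : K} (hf : f.Monic) (heven : Even f.natDegree)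
    (hirr : Irreducible f) (hder : derivative f = C c * g ^ 2) : ¬ Irreducible (f.comp f) := by
  intro hirr₂
  have := Fact.mk hirr₂
  have hdeg : 0 < f.natDegree := hirr.natDegree_pos
  have hf₂ : (f.comp f).Monic := hf.comp hf hdeg.ne'
  set M := AdjoinRoot (f.comp f)
  set β : M := AdjoinRoot.root (f.comp f)
  have hβ : aeval β (f.comp f) = 0 := by rw [AdjoinRoot.aeval_eq, AdjoinRoot.mk_self]
  have : Module.Finite K M := hf₂.finite_adjoinRoot
  have : Finite M := Module.finite_of_finite K
  have htop : IntermediateField.adjoin K {β} = ⊤ := IntermediateField.adjoin_root_eq_top _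
  have hmin := minpoly_adjoin_aeval_eq hf hirr hirr₂ hβ htop
  set L := IntermediateField.adjoin K {aeval β f}
  have hKL : Even (Module.finrank K L) := by
    have hα : aeval (aeval β f) f = 0 := by rwa [← aeval_comp]
    rwa [IntermediateField.adjoin.finrank (.of_finite K _),
      ← minpoly.eq_of_irreducible_of_monic hirr hα hf]
  have hneg : IsSquare (-1 : L) := by
    have := Fintype.ofFinite K
    have := Fintype.ofFinite L
    rw [FiniteField.isSquare_neg_one_iff, Module.card_eq_pow_finrank (K := K)]
    have hodd : Odd (Fintype.card K) := Nat.odd_iff.2 <| FiniteField.odd_card_of_char_ne_two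
      fun h ↦ hK (by exact_mod_cast h ▸ ringChar.Nat.cast_ringChar (R := K))
    obtain ⟨k, hk⟩ := hKL
    obtain ⟨r, hr⟩ := hodd.pow (n := k)
    have : Fintype.card K ^ Module.finrank K L = 4 * (r * r + r) + 1 := by
      rw [hk, pow_add, hr]
      ring
    omega
  let pb : PowerBasis L M := PowerBasis.ofAdjoinEqTop' (x := β) (.of_finite L β) (by
    rw [← IntermediateField.adjoin_simple_toSubalgebra_of_isAlgebraic,
      IntermediateField.adjoin_eq_top_of_adjoin_eq_top K htop, IntermediateField.top_toSubalgebra]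
    exact Algebra.IsAlgebraic.isAlgebraic β)
  have hgen : pb.gen = β := PowerBasis.ofAdjoinEqTop'_gen _ _
  have hdim : Even pb.dim := by
    rw [← pb.natDegree_minpoly, hgen, hmin, natDegree_sub_C, natDegree_map]
    exact heven
  have h2 : (2 : L) ≠ 0 := by
    simpa only [map_ofNat] using (map_ne_zero (algebraMap K L)).2 hK
  refine not_isSquare_discr_of_even h2 hdim pb.basis ?_
  rw [Algebra.discr_powerBasis_eq_norm]
  refine (hneg.pow _).mul ?_
  have hval : aeval pb.gen (derivative (minpoly L pb.gen)) =
      algebraMap L M (algebraMap K L c) * aeval β g ^ 2 := by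
    rw [hgen, hmin, derivative_sub, derivative_C, sub_zero, derivative_map, aeval_map_algebraMap,
      hder, map_mul, aeval_C, map_pow, ← IsScalarTower.algebraMap_apply]
  rw [hval, map_mul, map_pow, Algebra.norm_algebraMap, pb.finrank]
  exact (hdim.isSquare_pow _).mul (IsSquare.sq _)

theorem even_trinomial_not_stable_odd_char
    (p t : ℕ) (hp : p.Prime) (hp2 : 2 < p) (ht : 1 ≤ t)
    (K : Type*) [Field K] [Fintype K] (hcard : Fintype.card K = p ^ t)
    (n s : ℕ) (hn : 1 ≤ n) (hpn : p ∣ n) (hs : 2 * s + 1 < 2 * n)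
    (a b : K)
    (f : Polynomial K)
    (hf : f = X ^ (2 * n) + C a * X ^ (2 * s + 1) + C b) :
    ¬ (∀ k : ℕ, 1 ≤ k → Irreducible ((fun q => f.comp q)^[k] (X : Polynomial K))) := by
  intro h
  have := Fact.mk hp
  have : CharP K p := charP_of_card_eq_prime_pow hcard
  have h1 : Irreducible f := by simpa using h 1 le_rfl
  have h2 : Irreducible (f.comp f) := by simpa using h 2 one_le_two
  have hK : (2 : K) ≠ 0 := Ring.two_ne_zero (by rw [ringChar.eq K p]; omega)
  have hlow : (C a * X ^ (2 * s + 1) + C b).degree < ((2 * n : ℕ) : WithBot ℕ) := by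
    refine (degree_add_le _ _).trans_lt (max_lt ?_ ?_)
    · exact (degree_C_mul_X_pow_le _ _).trans_lt (by exact_mod_cast hs)
    · exact degree_C_le.trans_lt (by exact_mod_cast (by omega : 0 < 2 * n))
  have hf' : f = X ^ (2 * n) + (C a * X ^ (2 * s + 1) + C b) := by rw [hf, add_assoc]
  have hmonic : f.Monic := hf' ▸ monic_X_pow_add hlow
  have hdeg : f.natDegree = 2 * n := by
    rw [hf']
    exact natDegree_eq_of_degree_eq_some (by
      rw [degree_add_eq_left_of_degree_lt (by simpa using hlow), degree_X_pow])
  have hn0 : (n : K) = 0 := (CharP.cast_eq_zero_iff K p n).2 hpn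
  have hder : derivative f = C (a * (2 * s + 1)) * (X ^ s) ^ 2 := by
    rw [hf]
    simp [derivative_X_pow, hn0]
    ring
  exact not_irreducible_comp_self_of_derivative_eq hK hmonic (by simp [hdeg]) h1 hder h2
end

section
/- Let p > 2 be a prime, t ≥ 1, and q = p^t. Let n, m ≥ 1 and s ≥ 0 be integers with p dividing n and 2s+1 < 2n, and let a, b ∈ F_q. Let f(x) = x^(2n) + a·x^(2s+1) + b ∈ F_q[x], and let g(x) ∈ F_q[x] be a monic polynomial of degree 2m. Then Disc(g(f(x))) is a square in F_q, i.e., there exists c ∈ F_q with Disc(g(f(x))) = c^2. -/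
open Polynomial Finset

/-- The derivative of `∏ i, (X - C (β i))` at `β i` is the product of the differences
`β i - β j` over `j ≠ i`. -/
lemma eval_derivative_prod_X_sub_C {ι R : Type*} [Fintype ι] [DecidableEq ι] [CommRing R]
    (β : ι → R) (i : ι) :
    (derivative (∏ j, (X - C (β j)))).eval (β i) = ∏ j ∈ {i}ᶜ, (β i - β j) := by
  rw [← Finset.prod_mul_prod_compl {i} fun j => X - C (β j)]
  simp [eval_prod]

/-- The discriminant of a monic split polynomial as a product of values of its derivative. -/
lemma prod_sq_sub_eq_prod_eval_derivative {R : Type*} [CommRing R] {N : ℕ} (β : Fin N → R) :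
    (∏ i, ∏ j ∈ Finset.Ioi i, (β i - β j) ^ 2) =
      (-1) ^ (N * (N - 1) / 2) *
        ∏ i, (derivative (∏ j, (X - C (β j)))).eval (β i) := by
  simp_rw [eval_derivative_prod_X_sub_C]
  rw [← Finset.prod_prod_Ioi_mul_eq_prod_prod_off_diag fun i j => β j - β i]
  have hsq (i j : Fin N) : (β i - β j) ^ 2 = -1 * ((β i - β j) * (β j - β i)) := by ring
  simp_rw [hsq]
  simp_rw [Finset.prod_mul_distrib (f := fun _ => (-1 : R)), Finset.prod_const, Fin.card_Ioi]
  rw [Finset.prod_mul_distrib, Finset.prod_pow_eq_pow_sum]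
  congr 2
  rw [Fin.sum_univ_eq_sum_range fun i => N - 1 - i, Finset.sum_range_reflect (fun i => i),
    Finset.sum_range_id]

/-- The product of `h ∘ f` over the roots of `g ∘ f` is a power of the product of `h` over the
roots of `g`. -/
lemma prod_roots_comp_eval {M : Type*} [Field M] [IsAlgClosed M] {f g : M[X]}
    (hf : 0 < f.natDegree) (hg : g.Monic) (h : M[X]) :
    ((g.comp f).roots.map fun x => h.eval (f.eval x)).prod =
      (g.roots.map h.eval).prod ^ f.natDegree := by
  have hcomp : g.comp f = (g.roots.map fun γ => f - C γ).prod := by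
    conv_lhs => rw [(IsAlgClosed.splits g).eq_prod_roots_of_monic hg]
    simp [multiset_prod_comp]
  have hdeg (γ : M) : (f - C γ).natDegree = f.natDegree := natDegree_sub_C
  have hne : (0 : M[X]) ∉ g.roots.map fun γ => f - C γ := by
    intro h0
    obtain ⟨γ, -, hγ⟩ := Multiset.mem_map.1 h0
    have := hdeg γ
    rw [hγ, natDegree_zero] at this
    omega
  rw [hcomp, roots_multiset_prod _ hne, Multiset.bind_map, Multiset.map_bind,
    Multiset.prod_bind, ← Multiset.prod_map_pow]
  refine congrArg Multiset.prod (Multiset.map_congr rfl fun γ _ => ?_)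
  rw [← hdeg γ, (IsAlgClosed.splits (f - C γ)).natDegree_eq_card_roots]
  rw [← Multiset.prod_replicate, ← Multiset.map_const']
  refine congrArg Multiset.prod (Multiset.map_congr rfl fun x hx => ?_)
  rw [show f.eval x = γ by simpa [sub_eq_zero] using isRoot_of_mem_roots hx]

/-- If `g ∘ f` splits with roots `β i`, then `∏ i, h (f (β i))` is a power of the resultant of `g`
and `h`. -/
lemma prod_eval_comp_eq_resultant_pow {K L ι : Type*} [Field K] [Field L] [Algebra K L]
    [Fintype ι] {f g : K[X]} (hf : 0 < f.natDegree) (hg : g.Monic) (h : K[X]) (β : ι → L)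
    (hβ : (g.comp f).map (algebraMap K L) = ∏ i, (X - C (β i))) :
    ∏ i, aeval (aeval (β i) f) h = algebraMap K L (g.resultant h ^ f.natDegree) := by
  let φ := algebraMap L (AlgebraicClosure L)
  let ψ := φ.comp (algebraMap K L)
  apply φ.injective
  have hroots : ((g.map ψ).comp (f.map ψ)).roots = univ.val.map fun i => φ (β i) := by
    rw [← Polynomial.map_comp, ← Polynomial.map_map, hβ, Polynomial.map_prod]
    simp only [Polynomial.map_sub, map_X, map_C]
    rw [← roots_multiset_prod_X_sub_C (univ.val.map fun i => φ (β i)), Multiset.map_map]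
    rfl
  have key := prod_roots_comp_eval (f := f.map ψ) (by simpa using hf) (hg.map ψ) (h.map ψ)
  have hres := resultant_eq_prod_eval (g.map ψ) (h.map ψ) h.natDegree (natDegree_map_le)
    (IsAlgClosed.splits _)
  rw [natDegree_map, resultant_map_map, (hg.map ψ).leadingCoeff, one_pow, one_mul] at hres
  rw [hroots, Multiset.map_map, natDegree_map, ← hres] at key
  change _ = ψ _
  rw [map_pow, ← key, map_prod]
  refine Finset.prod_congr rfl fun i _ => ?_
  simp only [Function.comp, aeval_def, eval_map, hom_eval₂, ψ]

/-- `Disc(g(f(x)))` is a square in `F_q`. Here the discriminant of the monic polynomial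
`g ∘ f` of degree `4nm` is `∏_{i<j} (β_i - β_j)^2` where `β` enumerates the roots of
`g ∘ f` (with multiplicity) in a field extension `L` where it splits. -/
theorem disc_comp_even_trinomial_is_square
    (p t : ℕ) (hp : p.Prime) (hp2 : 2 < p) (ht : 1 ≤ t)
    (K : Type*) [Field K] [Fintype K] (hcard : Fintype.card K = p ^ t)
    (L : Type*) [Field L] [Algebra K L]
    (n m s : ℕ) (hn : 1 ≤ n) (hm : 1 ≤ m) (hpn : p ∣ n) (hs : 2 * s + 1 < 2 * n)
    (a b : K)
    (f g : Polynomial K)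
    (hf : f = X ^ (2 * n) + C a * X ^ (2 * s + 1) + C b)
    (hgmonic : g.Monic) (hgdeg : g.natDegree = 2 * m)
    (β : Fin (4 * n * m) → L)
    (hβ : (g.comp f).map (algebraMap K L) = ∏ i, (X - C (β i))) :
    ∃ c : K, (∏ i, ∏ j ∈ Finset.Ioi i, (β i - β j) ^ 2) = algebraMap K L (c ^ 2) := by
  have hK : (n : K) = 0 := by
    have hp0 : (p : K) = 0 := by
      have := Nat.cast_card_eq_zero K
      rw [hcard, Nat.cast_pow] at this
      exact pow_eq_zero_iff (by omega) |>.1 this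
    obtain ⟨k, rfl⟩ := hpn
    rw [Nat.cast_mul, hp0, zero_mul]
  have hfdeg : f.natDegree = 2 * n := by
    rw [hf, natDegree_add_C]
    rw [natDegree_add_eq_left_of_natDegree_lt, natDegree_X_pow]
    rw [natDegree_X_pow]
    exact (natDegree_C_mul_X_pow_le _ _).trans_lt hs
  have hf' : derivative f = C (a * (2 * s + 1)) * X ^ (2 * s) := by
    rw [hf, derivative_add, derivative_add, derivative_X_pow, derivative_C_mul_X_pow,
      derivative_C]
    simp [hK]
  have hF' (i) : (derivative (∏ j, (X - C (β j)))).eval (β i) =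
      algebraMap K L (a * (2 * s + 1)) * β i ^ (2 * s) *
        aeval (aeval (β i) f) (derivative g) := by
    rw [← hβ, derivative_map, eval_map_algebraMap, derivative_comp, hf']
    simp [aeval_comp]
  have hprod : ∏ i, β i = algebraMap K L ((g.comp f).eval 0) := by
    have := congrArg (eval 0) hβ
    rw [eval_prod] at this
    simp only [eval_sub, eval_X, eval_C, zero_sub, Finset.prod_neg, Finset.card_univ,
      Fintype.card_fin] at this
    rw [Even.neg_one_pow ⟨2 * n * m, by ring⟩, one_mul] at this
    rw [← this, eval_zero_map]
  have hsign : Even (4 * n * m * (4 * n * m - 1) / 2) := by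
    rw [show 4 * n * m * (4 * n * m - 1) = 2 * (2 * (n * m * (4 * n * m - 1))) by ring,
      Nat.mul_div_cancel_left _ two_pos]
    exact even_two_mul _
  rw [prod_sq_sub_eq_prod_eval_derivative, hsign.neg_one_pow, one_mul]
  simp_rw [hF']
  rw [Finset.prod_mul_distrib, Finset.prod_mul_distrib, Finset.prod_pow, hprod,
    prod_eval_comp_eq_resultant_pow (by omega) hgmonic _ β hβ, hfdeg, Finset.prod_const,
    Finset.card_univ, Fintype.card_fin, ← map_pow, ← map_pow, ← map_mul, ← map_mul]
  refine ⟨(a * (2 * s + 1)) ^ (2 * n * m) * (g.comp f).eval 0 ^ s *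
    g.resultant (derivative g) ^ n, congrArg _ ?_⟩
  ring
end
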